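/- The kernel of the universal differential operator D_{K,M}(u,∂) is generated by quasi-exponentials: there exist N·dim(M) M-valued quasi-exponentials, linearly independent over ℂ, each annihilated by D_{K,M}(u,∂) on ℂ∖{z_1,…,z_n}, whose restrictions span the space of holomorphic solutions of D_{K,M}(u,∂)f = 0 on every simply connected open subset of ℂ∖{z_1,…,z_n}. Moreover, every exponent λ appearing in these quasi-exponentials is an eigenvalue of the matrix K; in particular, if K = 0 then the kernel is spanned by M-valued polynomials. -/

import Mathlib

noncomputable section

namespace GaudinModel

/-- A vector-valued quasi-exponential: a finite sum of functions `e^{λu} p(u)` with `p` a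
vector-valued polynomial. -/
def IsQE {M : Type*} [AddCommGroup M] [Module ℂ M] (f : ℂ → M) : Prop :=
  ∃ (k d : ℕ) (lam : Fin k → ℂ) (v : Fin k → Fin d → M),
    ∀ u : ℂ, f u = ∑ i : Fin k, ∑ j : Fin d,
      (Complex.exp (lam i * u) * u ^ (j : ℕ)) • v i j

variable {N n : ℕ}

/-- Points away from the singular points `z_1, …, z_n`. -/
def GoodG {n : ℕ} (z : Fin n → ℂ) (u : ℂ) : Prop := ∀ j : Fin n, u ≠ z j

section Setup

variable (V : Fin n → Type*) [∀ i, AddCommGroup (V i)] [∀ i, Module ℂ (V i)]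
  (M : Type*) [NormedAddCommGroup M] [NormedSpace ℂ M]
  (E : ∀ i : Fin n, Fin N → Fin N → (V i →ₗ[ℂ] V i))
  (φ : M ≃ₗ[ℂ] PiTensorProduct ℂ V)

/-- The commutation relations of `gl_N`: `[e_{ab}, e_{cd}] = δ_{bc} e_{ad} − δ_{da} e_{cb}`,
for the operators `E i a b` (the action of `e_{ab}` on the `i`-th factor `V i`). -/
def GlRel : Prop :=
  ∀ (i : Fin n) (a b c d : Fin N),
    E i a b ∘ₗ E i c d - E i c d ∘ₗ E i a b =
      (if b = c then (1 : ℂ) else 0) • E i a d - (if d = a then (1 : ℂ) else 0) • E i c b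

/-- Each `V i` is the irreducible finite-dimensional `gl_N`-module with highest weight
`Λ i`: it is generated by a nonzero vector `v` with `e_{ab} v = 0` for `a < b` and
`e_{aa} v = Λ_a v`. -/
def IsHW (Λ : Fin n → Fin N → ℤ) : Prop :=
  ∀ i : Fin n, ∃ v : V i, v ≠ 0 ∧
    (∀ a b : Fin N, a < b → E i a b v = 0) ∧
    (∀ a : Fin N, E i a a v = (Λ i a : ℂ) • v) ∧
    ∀ W : Submodule ℂ (V i), (∀ a b : Fin N, ∀ x ∈ W, E i a b x ∈ W) → v ∈ W →
      ∀ x : V i, x ∈ W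

/-- `e_{ab}` acting in the `j`-th tensor factor of `M ≃ V 1 ⊗ ⋯ ⊗ V n`. -/
def EE (j : Fin n) (a b : Fin N) : Module.End ℂ M :=
  φ.symm.toLinearMap ∘ₗ
    (PiTensorProduct.map
      (Function.update (fun i : Fin n => (LinearMap.id : V i →ₗ[ℂ] V i)) j (E j a b))) ∘ₗ
    φ.toLinearMap

variable (z : Fin n → ℂ) (K : Matrix (Fin N) (Fin N) ℂ)

/-- `X_{ab}(u,∂) = δ_{ab} ∂ − K_{ab} − ∑_j e_{ba}^{(j)}/(u − z_j)`,
acting on `M`-valued functions. -/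
def Xg (a b : Fin N) (f : ℂ → M) : ℂ → M :=
  fun u => (if a = b then deriv f u else 0) - K a b • f u
    - ∑ j : Fin n, (u - z j)⁻¹ • (EE V M E φ j b a) (f u)

/-- The universal differential operator
`D_{K,M}(u,∂) = ∑_{σ ∈ S_N} sgn(σ) X_{1σ(1)}(u,∂) ⋯ X_{Nσ(N)}(u,∂)`. -/
def Dg (f : ℂ → M) : ℂ → M :=
  fun u => ∑ σ : Equiv.Perm (Fin N),
    ((Equiv.Perm.sign σ : ℤˣ) : ℤ) •
      (((List.ofFn fun a : Fin N => Xg V M E φ z K a (σ a)).foldr (· ∘ ·) id) f u)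

/-- The weight subspace `M[m]`. -/
def Wt (m : Fin N → ℤ) : Submodule ℂ M :=
  ⨅ a : Fin N, LinearMap.ker
    ((∑ j : Fin n, EE V M E φ j a a) - (m a : ℂ) • (1 : Module.End ℂ M))

/-- The subspace `sing M[m]` of `gl_N`-singular vectors of weight `m`. -/
def SingWt (m : Fin N → ℤ) : Submodule ℂ M :=
  Wt V M E φ m ⊓ ⨅ a : Fin N, ⨅ b : Fin N, ⨅ _ : a < b,
    LinearMap.ker (∑ j : Fin n, EE V M E φ j a b)

end Setup

end GaudinModel

namespace GaudinModel

/-! ### Row determinants -/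

section RowDet

variable {A : Type*} [Ring A] {N : ℕ}

/-- Row determinant with rows chosen by `r`. -/
def rdr (X : Fin N → Fin N → A) (r : Fin N → Fin N) : A :=
  ∑ σ : Equiv.Perm (Fin N), ((Equiv.Perm.sign σ : ℤˣ) : ℤ) •
    (List.ofFn fun i => X (r i) (σ i)).prod

/-- Manin relations. -/
def Manin (X : Fin N → Fin N → A) : Prop :=
  ∀ a b c d, X a b * X c d - X c d * X a b = X a d * X c b - X c b * X a d

theorem list_split : ∀ (m : ℕ) (i : Fin m) (f0 : Fin (m + 1) → A),
    ∃ L R : A, ∀ f : Fin (m + 1) → A, (∀ j, j ≠ i.castSucc → j ≠ i.succ → f j = f0 j) →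
      (List.ofFn f).prod = L * (f i.castSucc * f i.succ) * R := by
  intro m
  induction m with
  | zero => intro i; exact i.elim0
  | succ m ih =>
    intro i f0
    refine Fin.cases ?_ (fun i => ?_) i
    · refine ⟨1, (List.ofFn fun j : Fin m => f0 j.succ.succ).prod, fun f hf => ?_⟩
      rw [List.ofFn_succ, List.ofFn_succ]
      simp only [List.prod_cons, Fin.castSucc_zero, one_mul, mul_assoc]
      congr 3
      congr 1
      funext j
      apply hf
      · exact Fin.succ_ne_zero _
      · intro h
        exact Fin.succ_ne_zero _ (Fin.succ_injective _ h)
    · obtain ⟨L, R, h⟩ := ih i (fun j => f0 j.succ)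
      refine ⟨f0 0 * L, R, fun f hf => ?_⟩
      rw [List.ofFn_succ]
      have h1 := h (fun j => f j.succ) (fun j h1 h2 => hf _ (by
        intro h3
        apply h1
        rw [← Fin.succ_castSucc] at h3
        exact Fin.succ_injective _ h3) (by
        intro h3; exact h2 (Fin.succ_injective _ h3)))
      rw [List.prod_cons, h1, hf 0 (by
        rw [← Fin.succ_castSucc]; exact (Fin.succ_ne_zero _).symm) (Fin.succ_ne_zero _).symm]
      rw [Fin.succ_castSucc]
      simp only [mul_assoc]

theorem rdr_adj {m : ℕ} {X : Fin (m + 1) → Fin (m + 1) → A} (hX : Manin X) (i : Fin m)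
    (r : Fin (m + 1) → Fin (m + 1)) :
    rdr X (r ∘ Equiv.swap i.castSucc i.succ) = - rdr X r := by
  have hne : i.castSucc ≠ i.succ := (Fin.castSucc_lt_succ).ne
  rw [eq_neg_iff_add_eq_zero]
  unfold rdr
  rw [← Finset.sum_add_distrib]
  refine Finset.sum_involution (fun σ _ => σ * Equiv.swap i.castSucc i.succ) ?_ ?_
    (fun _ _ => Finset.mem_univ _) ?_
  · intro σ _
    obtain ⟨L, R, h⟩ := list_split m i (fun j => X (r j) (σ j))
    have hsw : ∀ j, j ≠ i.castSucc → j ≠ i.succ →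
      Equiv.swap i.castSucc i.succ j = j := fun j => Equiv.swap_apply_of_ne_of_ne
    rw [h _ (fun j h1 h2 => rfl), h _ (fun j h1 h2 => by simp [hsw j h1 h2]),
      h _ (fun j h1 h2 => by simp [hsw j h1 h2]), h _ (fun j h1 h2 => by simp [hsw j h1 h2])]
    simp only [Function.comp, Equiv.swap_apply_left, Equiv.swap_apply_right, Equiv.Perm.mul_apply,
      Equiv.Perm.sign_mul, Equiv.Perm.sign_swap hne]
    have := hX (r i.castSucc) (σ i.castSucc) (r i.succ) (σ i.succ)
    generalize Equiv.Perm.sign σ = s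
    have h3 : L * (X (r i.succ) (σ i.castSucc) * X (r i.castSucc) (σ i.succ)) * R
      + L * (X (r i.castSucc) (σ i.castSucc) * X (r i.succ) (σ i.succ)) * R
      - L * (X (r i.succ) (σ i.succ) * X (r i.castSucc) (σ i.castSucc)) * R
      - L * (X (r i.castSucc) (σ i.succ) * X (r i.succ) (σ i.castSucc)) * R = 0 := by
      rw [← add_mul, ← sub_mul, ← sub_mul, ← mul_add, ← mul_sub, ← mul_sub]
      have : X (r i.succ) (σ i.castSucc) * X (r i.castSucc) (σ i.succ) + X (r i.castSucc) (σ i.castSucc) * X (r i.succ) (σ i.succ)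
       - X (r i.succ) (σ i.succ) * X (r i.castSucc) (σ i.castSucc) - X (r i.castSucc) (σ i.succ) * X (r i.succ) (σ i.castSucc) = 0 := by
        rw [add_sub_assoc, this]; abel
      rw [this]; simp
    have h4 : ((s * -1 : ℤˣ) : ℤ) = - (s : ℤ) := by simp
    rw [h4, neg_smul, neg_smul, ← smul_add, ← neg_add, ← smul_add, ← sub_eq_add_neg, ← smul_sub]
    rw [show ∀ a b c d : A, a + b - (c + d) = a + b - c - d by intros; abel, h3, smul_zero]
  · intro σ _ _ h
    have : Equiv.swap i.castSucc i.succ = 1 := by simpa using h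
    have h2 := congrArg (fun e => e i.castSucc) this
    simp at h2
    exact hne h2.symm
  · intro σ _
    simp [mul_assoc]

theorem rdr_perm {X : Fin N → Fin N → A} (hX : Manin X) (τ : Equiv.Perm (Fin N))
    (r : Fin N → Fin N) :
    rdr X (r ∘ τ) = ((Equiv.Perm.sign τ : ℤˣ) : ℤ) • rdr X r := by
  cases N with
  | zero =>
    have : τ = 1 := Subsingleton.elim _ _
    subst this; simp
  | succ m =>
    have hτ : τ ∈ (⊤ : Submonoid (Equiv.Perm (Fin (m + 1)))) := trivial
    rw [← Equiv.Perm.mclosure_swap_castSucc_succ m] at hτ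
    induction hτ using Submonoid.closure_induction generalizing r with
    | mem x hx =>
      obtain ⟨i, rfl⟩ := hx
      rw [rdr_adj hX, Equiv.Perm.sign_swap (Fin.castSucc_lt_succ).ne]
      simp
    | one => simp
    | mul x y _ _ hx hy =>
      have : r ∘ ⇑(x * y) = (r ∘ x) ∘ y := by ext; simp
      rw [this, hy, hx, Equiv.Perm.sign_mul, smul_smul]
      push_cast
      rw [mul_comm]

theorem rdr_noninj [Module ℂ A] {X : Fin N → Fin N → A} (hX : Manin X) (r : Fin N → Fin N)
    (hr : ¬ Function.Injective r) : rdr X r = 0 := by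
  simp only [Function.Injective, not_forall] at hr
  obtain ⟨a, b, h, hne⟩ := hr
  have h1 := rdr_perm hX (Equiv.swap a b) r
  have h2 : r ∘ Equiv.swap a b = r := by
    funext j
    simp only [Function.comp]
    rcases eq_or_ne j a with rfl | h3
    · simp [h]
    rcases eq_or_ne j b with rfl | h4
    · simp [h]
    rw [Equiv.swap_apply_of_ne_of_ne h3 h4]
  rw [h2, Equiv.Perm.sign_swap hne] at h1
  have h3 : rdr X r + rdr X r = 0 := by
    nth_rewrite 1 [h1]; simp
  have h4 : (2 : ℂ) • rdr X r = 0 := by rw [two_smul]; exact h3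
  exact (smul_eq_zero.mp h4).resolve_left two_ne_zero

/-- Expansion of noncommutative products of sums. -/
theorem list_prod_sum [Algebra ℂ A] {N : ℕ} {κ : Type*} [Fintype κ] [DecidableEq κ]
    (c : Fin N → κ → ℂ) (Y : Fin N → κ → A) :
    (List.ofFn fun i => ∑ k, c i k • Y i k).prod =
      ∑ g : Fin N → κ, (∏ i, c i (g i)) • (List.ofFn fun i => Y i (g i)).prod := by
  have := (MultilinearMap.mkPiAlgebraFin ℂ N A).map_sum (fun i k => c i k • Y i k)
  simp only [MultilinearMap.mkPiAlgebraFin_apply] at this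
  rw [this]
  refine Finset.sum_congr rfl fun g _ => ?_
  have := (MultilinearMap.mkPiAlgebraFin ℂ N A).map_smul_univ (fun i => c i (g i)) (fun i => Y i (g i))
  simpa only [MultilinearMap.mkPiAlgebraFin_apply] using this

theorem sum_fun_eq_sum_perm {B : Type*} [AddCommMonoid B] (F : (Fin N → Fin N) → B)
    (h : ∀ g, ¬ Function.Injective g → F g = 0) :
    ∑ g, F g = ∑ τ : Equiv.Perm (Fin N), F τ := by
  symm
  refine Fintype.sum_of_injective (fun τ : Equiv.Perm (Fin N) => (τ : Fin N → Fin N))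
    DFunLike.coe_injective _ _ ?_ (fun _ => rfl)
  intro g hg
  apply h
  intro hi
  exact hg ⟨Equiv.ofBijective g (Finite.injective_iff_bijective.mp hi), rfl⟩

theorem rdr_mul_right [Algebra ℂ A] (X : Fin N → Fin N → A) (C : Matrix (Fin N) (Fin N) ℂ)
    (r : Fin N → Fin N) :
    rdr (fun a b => ∑ d, C d b • X a d) r = C.det • rdr X r := by
  unfold rdr
  simp only [list_prod_sum]
  simp only [Finset.smul_sum]
  rw [Finset.sum_comm]
  have : ∀ g : Fin N → Fin N, ∑ σ : Equiv.Perm (Fin N), ((Equiv.Perm.sign σ : ℤˣ) : ℤ) •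
      ((∏ i, C (g i) (σ i)) • (List.ofFn fun i => X (r i) (g i)).prod) =
      (C.submatrix g id).det • (List.ofFn fun i => X (r i) (g i)).prod := by
    intro g
    rw [← Matrix.det_transpose, Matrix.det_apply, Finset.sum_smul]
    refine Finset.sum_congr rfl fun σ _ => ?_
    simp only [Matrix.transpose_apply, Matrix.submatrix_apply, id, Units.smul_def, smul_assoc]
  simp only [this]
  rw [sum_fun_eq_sum_perm]
  · refine Finset.sum_congr rfl fun τ _ => ?_
    have h := Matrix.det_permute τ C
    rw [h]
    rw [mul_comm, mul_smul]
    congr 1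
    exact Int.cast_smul_eq_zsmul ℂ _ _
  · intro g hg
    simp only [Function.Injective, not_forall] at hg
    obtain ⟨a, b, h, hne⟩ := hg
    rw [Matrix.det_zero_of_row_eq hne, zero_smul]
    funext j; simp [Matrix.submatrix_apply, h]

theorem rdr_mul_left [Algebra ℂ A] {X : Fin N → Fin N → A} (hX : Manin X)
    (B : Matrix (Fin N) (Fin N) ℂ) :
    rdr (fun a b => ∑ c, B a c • X c b) id = B.det • rdr X id := by
  have : rdr (fun a b => ∑ c, B a c • X c b) id =
      ∑ r : Fin N → Fin N, (∏ i, B i (r i)) • rdr X r := by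
    unfold rdr
    simp only [id]
    simp only [list_prod_sum (fun i c => B i c)]
    simp only [Finset.smul_sum]
    rw [Finset.sum_comm]
    refine Finset.sum_congr rfl fun r _ => Finset.sum_congr rfl fun σ _ => ?_
    rw [smul_comm]
  rw [this, sum_fun_eq_sum_perm]
  · rw [← Matrix.det_transpose, Matrix.det_apply, Finset.sum_smul]
    refine Finset.sum_congr rfl fun τ _ => ?_
    have h := rdr_perm hX τ id
    rw [Function.id_comp] at h
    rw [h, Units.smul_def, smul_comm, smul_assoc]
    rfl
  · intro g hg
    rw [rdr_noninj hX g hg, smul_zero]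

theorem rdr_conj [Algebra ℂ A] {X : Fin N → Fin N → A} (hX : Manin X)
    (B C : Matrix (Fin N) (Fin N) ℂ) (hBC : B * C = 1) :
    rdr (fun a b => ∑ d, C d b • ∑ c, B a c • X c d) id = rdr X id := by
  rw [rdr_mul_right (fun a d => ∑ c, B a c • X c d) C, rdr_mul_left hX, smul_smul, ← Matrix.det_mul,
    mul_eq_one_comm.mp hBC]
  simp

theorem rdr_cramer [Module ℂ A] {E : Type*} [AddCommGroup E] [Module A E]
    {X : Fin N → Fin N → A} (hX : Manin X) (g : Fin N → E)
    (hg : ∀ b, ∑ c, X c b • g c = 0) (a : Fin N) : rdr X id • g a = 0 := by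
  cases N with
  | zero => exact a.elim0
  | succ m =>
    set τ := Equiv.swap a (Fin.last m) with hτ
    have hτl : τ (Fin.last m) = a := by simp [hτ]
    have h0 : rdr X τ • g a = 0 := by
      have h1 : ∀ c, c ≠ a → rdr X (Function.update τ (Fin.last m) c) • g c = 0 := by
        intro c hc
        rw [rdr_noninj hX, zero_smul]
        intro hi
        have h2 : τ.symm c ≠ Fin.last m := by
          intro h; apply hc; rw [← hτl, ← h]; simp
        have := @hi (Fin.last m) (τ.symm c) (by
          rw [Function.update_self, Function.update_of_ne h2]; simp)
        exact h2 this.symm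
      have h2 : rdr X τ • g a = ∑ c, rdr X (Function.update τ (Fin.last m) c) • g c := by
        rw [Finset.sum_eq_single a (fun c _ hc => h1 c hc) (by simp)]
        congr 2
        rw [← hτl, Function.update_eq_self]
      rw [h2]
      unfold rdr
      simp only [Finset.sum_smul]
      rw [Finset.sum_comm]
      refine Finset.sum_eq_zero fun σ _ => ?_
      have h3 : ∀ c, ((((Equiv.Perm.sign σ : ℤˣ) : ℤ) • (List.ofFn fun i =>
          X (Function.update τ (Fin.last m) c i) (σ i)).prod) • g c) =
          ((Equiv.Perm.sign σ : ℤˣ) : ℤ) • ((List.ofFn fun i : Fin m =>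
          X (τ i.castSucc) (σ i.castSucc)).prod • (X c (σ (Fin.last m)) • g c)) := by
        intro c
        rw [smul_assoc, List.ofFn_succ_last, List.prod_append, mul_smul]
        simp only [List.prod_cons, List.prod_nil, mul_one, Function.update_self]
        congr 4
        funext i
        rw [Function.update_of_ne (Fin.castSucc_lt_last i).ne]
      simp only [h3]
      rw [← Finset.smul_sum, ← Finset.smul_sum, hg, smul_zero, smul_zero]
    have h := rdr_perm hX τ id
    rw [Function.id_comp] at h
    rw [h, smul_assoc] at h0
    have hu : (((Equiv.Perm.sign τ : ℤˣ) : ℤ)) * ((Equiv.Perm.sign τ : ℤˣ) : ℤ) = 1 := by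
      rw [← Units.val_mul]; simp
    have := congrArg (fun x => ((Equiv.Perm.sign τ : ℤˣ) : ℤ) • x) h0
    simpa [smul_smul, hu] using this

end RowDet

end GaudinModel

namespace GaudinModel

/-! ### Formal differential operators -/

open PowerSeries in
/-- Expansion of `1 / (X - y)`. -/
def gs (R : Type*) [CommRing R] [Algebra ℂ R] (y : ℂ) : PowerSeries R :=
  PowerSeries.map (algebraMap ℂ R) ((X - C y : PowerSeries ℂ)⁻¹)

theorem gs_deriv (R : Type*) [CommRing R] [Algebra ℂ R] (y : ℂ) :
    PowerSeries.derivative R (gs R y) = - (gs R y * gs R y) := by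
  have h : PowerSeries.derivative ℂ ((PowerSeries.X - PowerSeries.C y : PowerSeries ℂ)⁻¹) =
      - ((PowerSeries.X - PowerSeries.C y : PowerSeries ℂ)⁻¹ *
        (PowerSeries.X - PowerSeries.C y : PowerSeries ℂ)⁻¹) := by
    rw [PowerSeries.derivative_inv']
    simp [PowerSeries.derivative_X, PowerSeries.derivative_C, pow_two]
  unfold gs
  rw [← map_mul, ← map_neg, ← h]
  ext k
  simp only [PowerSeries.coeff_derivative, PowerSeries.coeff_map, map_mul, map_add, map_natCast, map_one]

theorem gs_mul (R : Type*) [CommRing R] [Algebra ℂ R] (y : ℂ) (hy : y ≠ 0) :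
    (PowerSeries.X - PowerSeries.C (algebraMap ℂ R y)) * gs R y = 1 := by
  have h : (PowerSeries.X - PowerSeries.C y : PowerSeries ℂ) *
      (PowerSeries.X - PowerSeries.C y : PowerSeries ℂ)⁻¹ = 1 :=
    PowerSeries.mul_inv_cancel _ (by simp [hy])
  have := congrArg (PowerSeries.map (algebraMap ℂ R)) h
  simpa [gs] using this

theorem gs_map {R R' : Type*} [CommRing R] [Algebra ℂ R] [CommRing R'] [Algebra ℂ R']
    (ψ : R →ₐ[ℂ] R') (y : ℂ) : PowerSeries.map (ψ : R →+* R') (gs R y) = gs R' y := by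
  unfold gs
  rw [← RingHom.comp_apply, ← PowerSeries.map_comp]
  congr 2
  exact ψ.comp_algebraMap

section Ops
variable {ι : Type*} {R : Type*} [CommRing R] [Algebra ℂ R]

/-- entrywise derivative -/
def fd (ι R : Type*) [CommRing R] [Algebra ℂ R] : Module.End ℂ (ι → PowerSeries R) where
  toFun f := fun i => PowerSeries.derivative R (f i)
  map_add' f g := by funext i; simp
  map_smul' c f := by
    funext i
    simp only [Pi.smul_apply, RingHom.id_apply]
    rw [← algebraMap_smul R c (f i), ← algebraMap_smul R c (PowerSeries.derivative R (f i))]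
    exact (PowerSeries.derivative R).map_smul _ _

/-- multiplication by a power series -/
def fm (p : PowerSeries R) : Module.End ℂ (ι → PowerSeries R) where
  toFun f := fun i => p * f i
  map_add' f g := by funext i; simp [mul_add]
  map_smul' c f := by funext i; simp

/-- constant matrices -/
def fe [Fintype ι] (m : Matrix ι ι ℂ) : Module.End ℂ (ι → PowerSeries R) where
  toFun f := fun i => ∑ k, m i k • f k
  map_add' f g := by funext i; simp [smul_add, Finset.sum_add_distrib]
  map_smul' c f := by
    funext i
    simp only [Pi.smul_apply, RingHom.id_apply, Finset.smul_sum]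
    exact Finset.sum_congr rfl fun k _ => smul_comm _ _ _

@[simp] theorem fd_apply (f : ι → PowerSeries R) (i : ι) :
    fd ι R f i = PowerSeries.derivative R (f i) := rfl
@[simp] theorem fm_apply (p : PowerSeries R) (f : ι → PowerSeries R) (i : ι) :
    fm p f i = p * f i := rfl
@[simp] theorem fe_apply [Fintype ι] (m : Matrix ι ι ℂ) (f : ι → PowerSeries R) (i : ι) :
    fe m f i = ∑ k, m i k • f k := rfl

theorem fm_comm (p q : PowerSeries R) : (fm p * fm q : Module.End ℂ (ι → PowerSeries R))
    = fm q * fm p := by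
  ext1 f; funext i; simp [Module.End.mul_apply, mul_left_comm]

theorem fm_fe [Fintype ι] (p : PowerSeries R) (m : Matrix ι ι ℂ) :
    (fm p * fe m : Module.End ℂ (ι → PowerSeries R)) = fe m * fm p := by
  ext1 f; funext i; simp [Module.End.mul_apply, Finset.mul_sum]

theorem derivative_smulC (c : ℂ) (f : PowerSeries R) :
    PowerSeries.derivative R (c • f) = c • PowerSeries.derivative R f := by
  rw [← algebraMap_smul R c f, ← algebraMap_smul R c (PowerSeries.derivative R f)]
  exact (PowerSeries.derivative R).map_smul _ _

theorem fd_fe [Fintype ι] (m : Matrix ι ι ℂ) :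
    (fd ι R * fe m : Module.End ℂ (ι → PowerSeries R)) = fe m * fd ι R := by
  ext1 f; funext i; simp [Module.End.mul_apply]

theorem fd_fm (p : PowerSeries R) :
    (fd ι R * fm p : Module.End ℂ (ι → PowerSeries R)) =
      fm p * fd ι R + fm (PowerSeries.derivative R p) := by
  ext1 f; funext i
  simp [Module.End.mul_apply, mul_comm]

theorem fm_mul (p q : PowerSeries R) :
    (fm (p * q) : Module.End ℂ (ι → PowerSeries R)) = fm p * fm q := by
  ext1 f; funext i; simp [Module.End.mul_apply, mul_assoc]

theorem fm_neg_mul (p : PowerSeries R) (T : Module.End ℂ (ι → PowerSeries R)) :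
    fm (-p) * T = - (fm p * T) := by
  ext1 f; funext i; simp [Module.End.mul_apply]

theorem fe_mul [Fintype ι] (m m' : Matrix ι ι ℂ) :
    (fe (m * m') : Module.End ℂ (ι → PowerSeries R)) = fe m * fe m' := by
  ext1 f; funext i
  simp only [Module.End.mul_apply, fe_apply, Matrix.mul_apply, Finset.sum_smul, Finset.smul_sum,
    smul_smul]
  rw [Finset.sum_comm]

theorem fe_sub [Fintype ι] (m m' : Matrix ι ι ℂ) :
    (fe (m - m') : Module.End ℂ (ι → PowerSeries R)) = fe m - fe m' := by
  ext1 f; funext i; simp [sub_smul]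

theorem fe_smul [Fintype ι] (c : ℂ) (m : Matrix ι ι ℂ) :
    (fe (c • m) : Module.End ℂ (ι → PowerSeries R)) = c • fe m := by
  ext1 f; funext i; simp [smul_smul, Finset.smul_sum]

variable {J : Type*} [Fintype J] {N : ℕ}

/-- The formal operators `X_{ab}`. -/
def fX [Fintype ι] (y : J → ℂ) (e : J → Fin N → Fin N → Matrix ι ι ℂ)
    (K : Matrix (Fin N) (Fin N) R) (a b : Fin N) : Module.End ℂ (ι → PowerSeries R) :=
  (if a = b then fd ι R else 0) - fm (PowerSeries.C (K a b)) -
    ∑ j, fm (gs R (y j)) * fe (e j b a)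

/-- The formal universal differential operator. -/
def fD [Fintype ι] (y : J → ℂ) (e : J → Fin N → Fin N → Matrix ι ι ℂ)
    (K : Matrix (Fin N) (Fin N) R) : Module.End ℂ (ι → PowerSeries R) :=
  rdr (fX y e K) id

/-- gl relations at each site, commuting at different sites. -/
def SiteRel [Fintype ι] [DecidableEq J] (e : J → Fin N → Fin N → Matrix ι ι ℂ) : Prop :=
  ∀ j j' a b c d, e j a b * e j' c d - e j' c d * e j a b =
    if j = j' then (if b = c then (1 : ℂ) else 0) • e j a d
      - (if d = a then (1 : ℂ) else 0) • e j c b else 0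

theorem manin_abstract {A : Type*} [Ring A] (D : A) (κ : Fin N → Fin N → A)
    (L : Fin N → Fin N → A) (Q : Fin N → Fin N → A)
    (hκκ : ∀ a b c d, κ a b * κ c d = κ c d * κ a b)
    (hκD : ∀ a b, D * κ a b = κ a b * D)
    (hκL : ∀ a b c d, κ a b * L c d = L c d * κ a b)
    (hDL : ∀ a b, D * L a b - L a b * D = - Q b a)
    (hLL : ∀ a b c d, L a b * L c d - L c d * L a b =
      (if a = d then Q b c else 0) - (if b = c then Q d a else 0)) :
    Manin (fun a b => (if a = b then D else 0) - κ a b - L a b) := by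
  have key : ∀ a b c d, ((if a = b then D else 0) - κ a b - L a b) *
        ((if c = d then D else 0) - κ c d - L c d) -
        ((if c = d then D else 0) - κ c d - L c d) * ((if a = b then D else 0) - κ a b - L a b)
      = (if a = b then Q d c else 0) - (if c = d then Q b a else 0)
        + (if a = d then Q b c else 0) - (if b = c then Q d a else 0) := by
    intro a b c d
    have h0 : ∀ (P : Prop) [Decidable P] (x : A), (if P then x else 0) = (if P then (1:A) else 0) * x := by
      intro P _ x; split_ifs <;> simp
    have e1 : (if a = b then D else 0) * L c d - L c d * (if a = b then D else 0) =
      - (if a = b then Q d c else 0) := by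
      split_ifs
      · exact hDL c d
      · simp
    have e2 : (if c = d then D else 0) * L a b - L a b * (if c = d then D else 0) =
      - (if c = d then Q b a else 0) := by
      split_ifs
      · exact hDL a b
      · simp
    have e3 : (if a = b then D else 0) * κ c d = κ c d * (if a = b then D else 0) := by
      split_ifs
      · exact hκD c d
      · simp
    have e4 : (if c = d then D else 0) * κ a b = κ a b * (if c = d then D else 0) := by
      split_ifs
      · exact hκD a b
      · simp
    have e5 : (if a = b then D else 0) * (if c = d then D else 0) =
      (if c = d then D else 0) * (if a = b then D else 0) := by
      split_ifs <;> simp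
    have e6 := hLL a b c d
    generalize (if a = b then D else 0) = D1 at *
    generalize (if c = d then D else 0) = D2 at *
    have expand : (D1 - κ a b - L a b) * (D2 - κ c d - L c d) -
        (D2 - κ c d - L c d) * (D1 - κ a b - L a b) =
        (D1 * D2 - D2 * D1) - (D1 * κ c d - κ c d * D1) - (D1 * L c d - L c d * D1)
        + (D2 * κ a b - κ a b * D2) + (D2 * L a b - L a b * D2) + (κ a b * κ c d - κ c d * κ a b)
        + (κ a b * L c d - L c d * κ a b) - (κ c d * L a b - L a b * κ c d)
        + (L a b * L c d - L c d * L a b) := by noncomm_ring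
    rw [expand, e5, e3, e4, e1, e2, e6, hκκ a b c d, hκL, hκL]
    abel
  intro a b c d
  have h1 := key a b c d
  have h2 := key a d c b
  simp only at h1 h2 ⊢
  rw [h1, h2]
  simp only [eq_comm (a := d) (b := c), eq_comm (a := b) (b := c)]
  abel

theorem fX_manin [Fintype ι] [DecidableEq J] (y : J → ℂ) (e : J → Fin N → Fin N → Matrix ι ι ℂ)
    (K : Matrix (Fin N) (Fin N) R) (he : SiteRel e) : Manin (fX y e K) := by
  refine manin_abstract (fd ι R) (fun a b => fm (PowerSeries.C (K a b)))
    (fun a b => ∑ j, fm (gs R (y j)) * fe (e j b a))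
    (fun a b => ∑ j, fm (gs R (y j) * gs R (y j)) * fe (e j a b)) ?_ ?_ ?_ ?_ ?_
  · intro a b c d; exact fm_comm _ _
  · intro a b
    rw [fd_fm, PowerSeries.derivative_C]
    ext1 f; funext i; simp
  · intro a b c d
    rw [Finset.mul_sum, Finset.sum_mul]
    refine Finset.sum_congr rfl fun j _ => ?_
    rw [← mul_assoc, fm_comm, mul_assoc, fm_fe, mul_assoc]
  · intro a b
    rw [Finset.mul_sum, Finset.sum_mul, ← Finset.sum_sub_distrib, ← Finset.sum_neg_distrib]
    refine Finset.sum_congr rfl fun j _ => ?_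
    rw [← mul_assoc, fd_fm, gs_deriv, add_mul, mul_assoc, fd_fe, fm_neg_mul, mul_assoc]
    abel
  · intro a b c d
    have h1 : ∀ j j', (fm (gs R (y j)) * fe (e j b a)) * (fm (gs R (y j')) * fe (e j' d c)) -
        (fm (gs R (y j')) * fe (e j' d c)) * (fm (gs R (y j)) * fe (e j b a)) =
        fm (gs R (y j) * gs R (y j')) * (fe (e j b a * e j' d c - e j' d c * e j b a)
          : Module.End ℂ (ι → PowerSeries R)) := by
      intro j j'
      rw [fe_sub, fe_mul, fe_mul, mul_sub]
      congr 1
      · rw [fm_mul, mul_assoc, mul_assoc, ← mul_assoc (fe _), ← fm_fe, mul_assoc]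
      · rw [mul_comm (gs R (y j)), fm_mul, mul_assoc, mul_assoc, ← mul_assoc (fe _), ← fm_fe, mul_assoc]
    rw [Finset.sum_mul_sum, Finset.sum_mul_sum, Finset.sum_comm (s := Finset.univ) (t := Finset.univ)
      (f := fun j' j => (fm (gs R (y j')) * fe (e j' d c)) * (fm (gs R (y j)) * fe (e j b a))),
      ← Finset.sum_sub_distrib]
    simp only [← Finset.sum_sub_distrib, h1]
    have he' : ∀ j j', e j b a * e j' d c - e j' d c * e j b a =
      if j = j' then (if a = d then (1 : ℂ) else 0) • e j b c
      - (if c = b then (1 : ℂ) else 0) • e j d a else 0 := fun j j' => he j j' b a d c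
    simp only [he']
    have h2 : ∀ j, ∑ j', (fm (gs R (y j) * gs R (y j')) * fe (if j = j' then
        (if a = d then (1 : ℂ) else 0) • e j b c - (if c = b then (1 : ℂ) else 0) • e j d a else 0)
          : Module.End ℂ (ι → PowerSeries R)) =
        fm (gs R (y j) * gs R (y j)) * fe (
        (if a = d then (1 : ℂ) else 0) • e j b c - (if c = b then (1 : ℂ) else 0) • e j d a) := by
      intro j
      rw [Finset.sum_eq_single j]
      · simp
      · intro j' _ h
        rw [if_neg (Ne.symm h)]
        ext1 f; funext i; simp
      · simp
    simp only [h2, fe_sub, fe_smul, mul_sub, Finset.sum_sub_distrib]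
    congr 1
    · split_ifs <;> simp
    · simp only [eq_comm (a := c)]
      split_ifs <;> simp

end Ops

/-! ### Intertwiners -/

theorem rdr_intertwine {N : ℕ} {E E' : Type*} [AddCommGroup E] [Module ℂ E] [AddCommGroup E']
    [Module ℂ E'] (Φ : E →ₗ[ℂ] E') (X : Fin N → Fin N → Module.End ℂ E)
    (X' : Fin N → Fin N → Module.End ℂ E') (r : Fin N → Fin N)
    (h : ∀ a b f, Φ (X a b f) = X' a b (Φ f)) (f : E) :
    Φ (rdr X r f) = rdr X' r (Φ f) := by
  have hl : ∀ (m : ℕ) (p q : Fin m → Fin N) (f : E),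
      Φ ((List.ofFn fun i => X (p i) (q i)).prod f) =
      (List.ofFn fun i => X' (p i) (q i)).prod (Φ f) := by
    intro m
    induction m with
    | zero => intro p q f; simp
    | succ m ih =>
      intro p q f
      simp only [List.ofFn_succ, List.prod_cons, Module.End.mul_apply, h]
      rw [ih]
  unfold rdr
  simp only [LinearMap.sum_apply, LinearMap.smul_apply, map_sum, map_zsmul, hl]

/-- change of coefficients -/
def fsp {ι R R' : Type*} [CommRing R] [Algebra ℂ R] [CommRing R'] [Algebra ℂ R']
    (ψ : R →ₐ[ℂ] R') : (ι → PowerSeries R) →ₗ[ℂ] (ι → PowerSeries R') where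
  toFun f := fun i => PowerSeries.map (ψ : R →+* R') (f i)
  map_add' f g := by funext i; simp
  map_smul' c f := by
    funext i; ext k
    simp

theorem fsp_fX {ι R R' J : Type*} [Fintype ι] [Fintype J] {N : ℕ} [CommRing R] [Algebra ℂ R]
    [CommRing R'] [Algebra ℂ R']
    (ψ : R →ₐ[ℂ] R') (y : J → ℂ) (e : J → Fin N → Fin N → Matrix ι ι ℂ)
    (K : Matrix (Fin N) (Fin N) R) (a b : Fin N) (f : ι → PowerSeries R) :
    fsp ψ (fX y e K a b f) = fX y e (K.map ψ) a b (fsp ψ f) := by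
  have h1 : fsp ψ (fd ι R f) = fd ι R' (fsp ψ f) := by
    funext i; ext k
    simp [fsp, PowerSeries.coeff_derivative]
  have h2 : ∀ p (f : ι → PowerSeries R), fsp ψ (fm p f) =
      fm (PowerSeries.map (ψ : R →+* R') p) (fsp ψ f) := by
    intro p f; funext i
    simp [fsp]
  have h3 : ∀ m (f : ι → PowerSeries R), fsp ψ (fe m f) = fe m (fsp ψ f) := by
    intro p f; funext i; ext k
    simp [fsp]
  unfold fX
  simp only [LinearMap.sub_apply, map_sub, LinearMap.sum_apply, map_sum, Module.End.mul_apply,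
    h2, h3, gs_map]
  congr 2
  · split_ifs
    · exact h1
    · simp
  · simp

theorem fsp_fD {ι R R' J : Type*} [Fintype ι] [Fintype J] {N : ℕ} [CommRing R] [Algebra ℂ R]
    [CommRing R'] [Algebra ℂ R']
    (ψ : R →ₐ[ℂ] R') (y : J → ℂ) (e : J → Fin N → Fin N → Matrix ι ι ℂ)
    (K : Matrix (Fin N) (Fin N) R) (f : ι → PowerSeries R) :
    fsp ψ (fD y e K f) = fD y e (K.map ψ) (fsp ψ f) :=
  rdr_intertwine _ _ _ _ (fsp_fX ψ y e K) f

end GaudinModel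

namespace GaudinModel

/-! ### Filtration and formal ODE -/

section Fil
variable {ι : Type*} {R : Type*} [CommRing R] [Algebra ℂ R]

/-- vanishing of the first `k` coefficients -/
def Fil (ι R : Type*) [CommRing R] [Algebra ℂ R] (k : ℕ) : Submodule ℂ (ι → PowerSeries R) where
  carrier := {f | ∀ i, ∀ m < k, PowerSeries.coeff m (f i) = 0}
  add_mem' {f g} hf hg i m hm := by simp [hf i m hm, hg i m hm]
  zero_mem' i m hm := by simp
  smul_mem' c f hf i m hm := by
    simp [hf i m hm]

theorem mem_Fil {k : ℕ} {f : ι → PowerSeries R} :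
    f ∈ Fil ι R k ↔ ∀ i, ∀ m < k, PowerSeries.coeff m (f i) = 0 := Iff.rfl

theorem Fil_anti {k l : ℕ} (h : k ≤ l) : Fil ι R l ≤ Fil ι R k :=
  fun _ hf i m hm => hf i m (hm.trans_le h)

theorem Fil_zero_mem (f : ι → PowerSeries R) : f ∈ Fil ι R 0 := fun i m hm => by omega

theorem eq_zero_of_Fil {f : ι → PowerSeries R} (h : ∀ k, f ∈ Fil ι R k) : f = 0 := by
  funext i; ext m
  simpa using h (m + 1) i m (Nat.lt_succ_self m)

theorem fd_Fil {k : ℕ} {f : ι → PowerSeries R} (hf : f ∈ Fil ι R (k + 1)) :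
    fd ι R f ∈ Fil ι R k := by
  intro i m hm
  simp [PowerSeries.coeff_derivative, hf i (m + 1) (by omega)]

theorem fm_Fil {k : ℕ} {f : ι → PowerSeries R} (p : PowerSeries R) (hf : f ∈ Fil ι R k) :
    fm p f ∈ Fil ι R k := by
  intro i m hm
  simp only [fm_apply, PowerSeries.coeff_mul]
  refine Finset.sum_eq_zero fun x hx => ?_
  rw [hf i x.2 (by have := Finset.HasAntidiagonal.mem_antidiagonal.mp hx; omega), mul_zero]

theorem fe_Fil [Fintype ι] {k : ℕ} {f : ι → PowerSeries R} (p : Matrix ι ι ℂ)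
    (hf : f ∈ Fil ι R k) : fe p f ∈ Fil ι R k := by
  intro i m hm
  simp only [fe_apply, map_sum]
  refine Finset.sum_eq_zero fun x hx => ?_
  simp [hf x m hm]

theorem fdpow_Fil (L : ℕ) {k : ℕ} {f : ι → PowerSeries R} (hf : f ∈ Fil ι R (k + L)) :
    (fd ι R ^ L) f ∈ Fil ι R k := by
  induction L generalizing f with
  | zero => simpa using hf
  | succ L ih =>
    rw [pow_succ, Module.End.mul_apply]
    exact ih (fd_Fil (by simpa [add_assoc] using hf))

theorem fdpow_Fil' (L : ℕ) {k : ℕ} {f : ι → PowerSeries R} (hf : f ∈ Fil ι R L)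
    (h : (fd ι R ^ L) f ∈ Fil ι R k) : f ∈ Fil ι R (k + L) := by
  induction L generalizing f with
  | zero => simpa using h
  | succ L ih =>
    rw [pow_succ, Module.End.mul_apply] at h
    have h1 := ih (fd_Fil hf) h
    intro i m hm
    rcases m with _ | m
    · exact hf i 0 (by omega)
    · have h2 := h1 i m (by omega)
      rw [fd_apply, PowerSeries.coeff_derivative] at h2
      have h3 : ((m : ℂ) + 1) • PowerSeries.coeff (m + 1) (f i) = 0 := by
        rw [Algebra.smul_def, mul_comm]
        simpa using h2
      have h4 : ((m : ℂ) + 1) ≠ 0 := by exact_mod_cast Nat.succ_ne_zero m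
      rw [← inv_smul_smul₀ h4 (PowerSeries.coeff (m + 1) (f i)), h3, smul_zero]

/-- lower order terms -/
def LT (L : ℕ) (Q : Module.End ℂ (ι → PowerSeries R)) : Prop :=
  ∀ k f, f ∈ Fil ι R (k + L) → Q f ∈ Fil ι R (k + 1)

/-- preserves the filtration -/
def FP (Q : Module.End ℂ (ι → PowerSeries R)) : Prop :=
  ∀ k f, f ∈ Fil ι R k → Q f ∈ Fil ι R k

theorem fX_decomp [Fintype ι] {J : Type*} [Fintype J] {N : ℕ} (y : J → ℂ)
    (e : J → Fin N → Fin N → Matrix ι ι ℂ) (K : Matrix (Fin N) (Fin N) R) (a b : Fin N) :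
    FP (fX y e K a b - (if a = b then (1 : ℂ) else 0) • fd ι R) := by
  intro k f hf
  have : (fX y e K a b - (if a = b then (1 : ℂ) else 0) • fd ι R) f =
    - fm (PowerSeries.C (K a b)) f - ∑ j, fm (gs R (y j)) (fe (e j b a) f) := by
    unfold fX
    simp only [LinearMap.sub_apply, LinearMap.sum_apply, Module.End.mul_apply, LinearMap.smul_apply]
    split_ifs
    · rw [one_smul]; abel
    · simp
  rw [this]
  exact Submodule.sub_mem _ (Submodule.neg_mem _ (fm_Fil _ hf))
    (Submodule.sum_mem _ fun j _ => fm_Fil _ (fe_Fil _ hf))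

theorem lead_list : ∀ (m : ℕ) (P : Fin m → Module.End ℂ (ι → PowerSeries R)) (c : Fin m → ℂ),
    (∀ i, FP (P i - c i • fd ι R)) →
    LT m ((List.ofFn P).prod - (∏ i, c i) • fd ι R ^ m) := by
  intro m
  induction m with
  | zero =>
    intro P c h k f hf
    simp
  | succ m ih =>
    intro P c h k f hf
    have hT := ih (fun i => P i.succ) (fun i => c i.succ) (fun i => h _)
    rw [List.ofFn_succ, List.prod_cons, Fin.prod_univ_succ]
    set T := (List.ofFn fun i : Fin m => P i.succ).prod
    set C := ∏ i : Fin m, c i.succ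
    have hd : (P 0 * T - (c 0 * C) • fd ι R ^ (m + 1)) f =
      (P 0 - c 0 • fd ι R) ((T - C • fd ι R ^ m) f) + C • (P 0 - c 0 • fd ι R) ((fd ι R ^ m) f)
       + c 0 • fd ι R ((T - C • fd ι R ^ m) f) := by
      simp only [LinearMap.sub_apply, LinearMap.smul_apply, Module.End.mul_apply, map_sub, map_smul,
        pow_succ' (fd ι R) m, smul_sub, mul_smul]
      rw [smul_comm C (c 0)]
      abel
    rw [hd]
    have h1 : (T - C • fd ι R ^ m) f ∈ Fil ι R (k + 1 + 1) :=
      hT (k + 1) f (by rwa [show k + 1 + m = k + (m + 1) by ring])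
    have h2 : (fd ι R ^ m) f ∈ Fil ι R (k + 1) :=
      fdpow_Fil m (by rwa [show k + 1 + m = k + (m + 1) by ring])
    refine Submodule.add_mem _ (Submodule.add_mem _ ?_ ?_) ?_
    · exact Fil_anti (Nat.le_succ _) (h 0 _ _ h1)
    · exact Submodule.smul_mem _ _ (h 0 _ _ h2)
    · exact Submodule.smul_mem _ _ (fd_Fil h1)

theorem fD_lead [Fintype ι] {J : Type*} [Fintype J] {N : ℕ} (y : J → ℂ)
    (e : J → Fin N → Fin N → Matrix ι ι ℂ) (K : Matrix (Fin N) (Fin N) R) :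
    LT N (fD y e K - fd ι R ^ N) := by
  intro k f hf
  have h1 : fd ι R ^ N = ∑ σ : Equiv.Perm (Fin N), ((Equiv.Perm.sign σ : ℤˣ) : ℤ) •
      ((∏ i, if i = σ i then (1 : ℂ) else 0) • fd ι R ^ N) := by
    rw [Finset.sum_eq_single 1]
    · simp
    · intro σ _ hσ
      obtain ⟨i, hi⟩ : ∃ i, σ i ≠ i := by
        by_contra hc
        push Not at hc
        exact hσ (Equiv.ext hc)
      rw [Finset.prod_eq_zero (Finset.mem_univ i) (if_neg (Ne.symm hi)), zero_smul, smul_zero]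
    · simp
  rw [h1]
  unfold fD rdr
  rw [← Finset.sum_sub_distrib, LinearMap.sum_apply]
  refine Submodule.sum_mem _ fun σ _ => ?_
  rw [LinearMap.sub_apply, LinearMap.smul_apply, LinearMap.smul_apply, ← smul_sub, ← LinearMap.sub_apply]
  refine zsmul_mem ?_ _
  exact lead_list N (fun i => fX y e K (id i) (σ i)) (fun i => if i = σ i then (1 : ℂ) else 0)
    (fun i => fX_decomp y e K i (σ i)) k f hf

theorem lead_unique {L : ℕ} {P : Module.End ℂ (ι → PowerSeries R)} (hP : LT L (P - fd ι R ^ L))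
    {f : ι → PowerSeries R} (hf : f ∈ Fil ι R L) (h0 : P f = 0) : f = 0 := by
  have : ∀ k, f ∈ Fil ι R (k + L) := by
    intro k
    induction k with
    | zero => simpa using hf
    | succ k ih =>
      have h1 := hP k f ih
      rw [LinearMap.sub_apply, h0, zero_sub] at h1
      exact fdpow_Fil' L hf ((Submodule.neg_mem_iff _).mp h1)
  exact eq_zero_of_Fil fun k => Fil_anti (Nat.le_add_right k L) (this k)

/-- formal integration -/
def fI (ι R : Type*) [CommRing R] [Algebra ℂ R] : Module.End ℂ (ι → PowerSeries R) where
  toFun f := fun i => PowerSeries.mk fun n => ((n : ℂ))⁻¹ • PowerSeries.coeff (n - 1) (f i)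
  map_add' f g := by funext i; ext n; simp
  map_smul' c f := by
    funext i; ext n
    simp only [Pi.smul_apply, RingHom.id_apply, PowerSeries.coeff_mk, PowerSeries.coeff_smul]
    rw [smul_comm]

theorem fd_fI (f : ι → PowerSeries R) : fd ι R (fI ι R f) = f := by
  funext i; ext n
  simp only [fd_apply, PowerSeries.coeff_derivative, fI, LinearMap.coe_mk, AddHom.coe_mk,
    PowerSeries.coeff_mk, Nat.add_sub_cancel]
  have h4 : ((n : ℂ) + 1) ≠ 0 := by exact_mod_cast Nat.succ_ne_zero n
  have h5 : ((n : R) + 1) = algebraMap ℂ R ((n : ℂ) + 1) := by simp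
  rw [h5, mul_comm, ← Algebra.smul_def, smul_smul]
  push_cast
  rw [mul_inv_cancel₀ h4, one_smul]

theorem fI_Fil {k : ℕ} {f : ι → PowerSeries R} (hf : f ∈ Fil ι R k) :
    fI ι R f ∈ Fil ι R (k + 1) := by
  intro i m hm
  simp only [fI, LinearMap.coe_mk, AddHom.coe_mk, PowerSeries.coeff_mk]
  rcases m with _ | m
  · simp
  · rw [Nat.add_sub_cancel, hf i m (by omega), smul_zero]

theorem fdpow_fI (L : ℕ) (f : ι → PowerSeries R) : (fd ι R ^ L) ((fI ι R ^ L) f) = f := by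
  induction L with
  | zero => simp
  | succ L ih =>
    rw [pow_succ, pow_succ' (fI ι R), Module.End.mul_apply, Module.End.mul_apply, fd_fI, ih]

theorem fIpow_Fil (L : ℕ) {k : ℕ} {f : ι → PowerSeries R} (hf : f ∈ Fil ι R k) :
    (fI ι R ^ L) f ∈ Fil ι R (k + L) := by
  induction L with
  | zero => simpa using hf
  | succ L ih =>
    rw [pow_succ', Module.End.mul_apply]
    exact fI_Fil ih

theorem one_add_surj (T : Module.End ℂ (ι → PowerSeries R))
    (hT : ∀ k f, f ∈ Fil ι R k → T f ∈ Fil ι R (k + 1)) (h : ι → PowerSeries R) :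
    ∃ g, g + T g = h := by
  set s : ℕ → ι → PowerSeries R := fun n => ∑ k ∈ Finset.range (n + 1), ((-T) ^ k) h with hs
  have hTk : ∀ k, ((-T) ^ k) h ∈ Fil ι R k := by
    intro k
    induction k with
    | zero => exact Fil_zero_mem _
    | succ k ih =>
      rw [pow_succ', Module.End.mul_apply, LinearMap.neg_apply]
      exact Submodule.neg_mem _ (hT _ _ ih)
  have hstep : ∀ n, s n + T (s n) - h ∈ Fil ι R (n + 1) := by
    intro n
    have : s n + T (s n) - h = - ((-T) ^ (n + 1)) h := by
      induction n with
      | zero => simp [hs]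
      | succ n ih =>
        have e1 : s (n + 1) = s n + ((-T) ^ (n + 1)) h := by
          simp only [hs]; rw [Finset.sum_range_succ]
        rw [e1, map_add, pow_succ' (-T) (n + 1), Module.End.mul_apply]
        have : s n + ((-T) ^ (n + 1)) h + (T (s n) + T (((-T) ^ (n + 1)) h)) - h =
          (s n + T (s n) - h) + ((-T) ^ (n + 1)) h + T (((-T) ^ (n + 1)) h) := by abel
        rw [this, ih]
        simp
    rw [this]
    exact Submodule.neg_mem _ (hTk _)
  have hdiff : ∀ n m, n ≤ m → s m - s n ∈ Fil ι R (n + 1) := by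
    intro n m hnm
    induction m, hnm using Nat.le_induction with
    | base => simp
    | succ m hm ih =>
      have e1 : s (m + 1) = s m + ((-T) ^ (m + 1)) h := by
        simp only [hs]; rw [Finset.sum_range_succ]
      rw [e1, add_sub_right_comm]
      exact Submodule.add_mem _ ih (Fil_anti (by omega) (hTk (m + 1)))
  refine ⟨fun i => PowerSeries.mk fun n => PowerSeries.coeff n (s n i), ?_⟩
  set g : ι → PowerSeries R := fun i => PowerSeries.mk fun n => PowerSeries.coeff n (s n i)
  have hg : ∀ n, g - s n ∈ Fil ι R (n + 1) := by
    intro n i m hm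
    have := hdiff m n (by omega) i m (by omega)
    simp only [Pi.sub_apply, map_sub] at this ⊢
    simp only [g, PowerSeries.coeff_mk]
    rw [← neg_sub, this, neg_zero]
  rw [← sub_eq_zero]
  refine eq_zero_of_Fil fun n => ?_
  have : g + T g - h = (g - s n) + T (g - s n) + (s n + T (s n) - h) := by
    rw [map_sub]; abel
  rw [this]
  exact Fil_anti (Nat.le_succ n) (Submodule.add_mem _ (Submodule.add_mem _ (hg n)
    (Fil_anti (Nat.le_succ _) (hT _ _ (hg n)))) (hstep n))

theorem lead_surj {L : ℕ} {P : Module.End ℂ (ι → PowerSeries R)} (hP : LT L (P - fd ι R ^ L))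
    (h : ι → PowerSeries R) : ∃ f ∈ Fil ι R L, P f = h := by
  obtain ⟨g, hg⟩ := one_add_surj ((P - fd ι R ^ L) * fI ι R ^ L) (fun k f hf => by
    rw [Module.End.mul_apply]
    exact hP k _ (fIpow_Fil L hf)) h
  refine ⟨(fI ι R ^ L) g, by simpa using fIpow_Fil L (Fil_zero_mem g), ?_⟩
  rw [Module.End.mul_apply, LinearMap.sub_apply, fdpow_fI] at hg
  rw [← hg]; abel

theorem lead_exists {L : ℕ} {P : Module.End ℂ (ι → PowerSeries R)} (hP : LT L (P - fd ι R ^ L))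
    (p : ι → PowerSeries R) : ∃ f, f - p ∈ Fil ι R L ∧ P f = 0 := by
  obtain ⟨g, hg, h⟩ := lead_surj hP (- P p)
  exact ⟨p + g, by simpa using hg, by rw [map_add, h]; simp⟩

end Fil

end GaudinModel

namespace GaudinModel

/-! ### The tensor space -/

section Tens
variable {J : Type*} [Fintype J] [DecidableEq J] {N : ℕ}

/-- matrix units at site `j` -/
def et (j : J) (a b : Fin N) : Matrix (J → Fin N) (J → Fin N) ℂ :=
  fun c c' => if c j = a ∧ c' = Function.update c j b then 1 else 0

theorem et_mulVec {B : Type*} [AddCommGroup B] [Module ℂ B] (j : J) (a b : Fin N)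
    (f : (J → Fin N) → B) (c : J → Fin N) :
    ∑ c', et j a b c c' • f c' = if c j = a then f (Function.update c j b) else 0 := by
  unfold et
  split_ifs with h
  · simp [h]
  · simp [h]

theorem et_mulVec' (j : J) (a b : Fin N) (f : (J → Fin N) → ℂ) :
    (et j a b).mulVec f = fun c => if c j = a then f (Function.update c j b) else 0 := by
  funext c
  rw [← et_mulVec]; rfl

theorem siteRel_et : SiteRel (fun (j : J) (a b : Fin N) => et j a b) := by
  intro j j' a b c d
  apply Matrix.mulVec_injective
  funext f
  simp only
  rw [Matrix.sub_mulVec, ← Matrix.mulVec_mulVec, ← Matrix.mulVec_mulVec]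
  simp only [et_mulVec']
  by_cases hj : j = j'
  · subst hj
    rw [if_pos rfl, Matrix.sub_mulVec, Matrix.smul_mulVec, Matrix.smul_mulVec]
    simp only [et_mulVec']
    funext x
    simp only [Pi.sub_apply, Function.update_self, Function.update_idem, Pi.smul_apply]
    split_ifs <;> simp_all
  · rw [if_neg hj]
    funext x
    have hj' : j' ≠ j := fun h => hj h.symm
    simp only [Pi.sub_apply, Function.update_of_ne hj, Function.update_of_ne hj',
      Function.update_comm hj, Matrix.zero_mulVec, Pi.zero_apply]
    split_ifs <;> simp

/-- group action on the tensor space -/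
def rho (S : Matrix (Fin N) (Fin N) ℂ) : Matrix (J → Fin N) (J → Fin N) ℂ :=
  fun c c' => ∏ j, S (c j) (c' j)

theorem rho_conj (S B : Matrix (Fin N) (Fin N) ℂ) (h : B * S = 1) (j : J) (a b : Fin N) :
    (∑ d, ∑ c, (S d b * B a c) • et j d c) * rho S = rho S * et j b a := by
  ext x x'
  have hprod : ∀ (y : J → Fin N) (y' : J → Fin N),
      rho S y y' = S (y j) (y' j) * ∏ i ∈ Finset.univ.erase j, S (y i) (y' i) := by
    intro y y'
    exact (Finset.mul_prod_erase Finset.univ (fun i => S (y i) (y' i)) (Finset.mem_univ j)).symm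
  have h1 : ((∑ d, ∑ c, (S d b * B a c) • et j d c) * rho S : Matrix (J → Fin N) (J → Fin N) ℂ) x x' =
      ∑ d, ∑ c, (S d b * B a c) * (if x j = d then rho S (Function.update x j c) x' else 0) := by
    rw [Finset.sum_mul]
    simp only [Finset.sum_mul, Matrix.sum_apply]
    refine Finset.sum_congr rfl fun d _ => Finset.sum_congr rfl fun c _ => ?_
    rw [Matrix.smul_mul, Matrix.smul_apply, smul_eq_mul]
    congr 1
    exact et_mulVec j d c (fun y => rho S y x') x
  have h2 : (rho S * et j b a : Matrix (J → Fin N) (J → Fin N) ℂ) x x' = if x' j = a then rho S x (Function.update x' j b) else 0 := by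
    rw [Matrix.mul_apply]
    have : ∀ y, et j b a y x' = if x' j = a ∧ y = Function.update x' j b then (1:ℂ) else 0 := by
      intro y
      unfold et
      congr 1
      apply propext
      constructor
      · rintro ⟨h8, rfl⟩
        refine ⟨by simp, ?_⟩
        rw [Function.update_idem, ← h8, Function.update_eq_self]
      · rintro ⟨h8, rfl⟩
        refine ⟨by simp, ?_⟩
        rw [Function.update_idem, ← h8, Function.update_eq_self]
    simp only [this]
    split_ifs with h
    · simp [h]
    · simp [h]
  rw [h1, h2]
  have h3 : ∀ d, ∑ c, (S d b * B a c) * (if x j = d then rho S (Function.update x j c) x' else 0)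
     = if x j = d then S d b * (if a = x' j then 1 else 0) *
        ∏ i ∈ Finset.univ.erase j, S (x i) (x' i) else 0 := by
    intro d
    split_ifs with h4 h5
    · have h6 : ∑ c, B a c * S c (x' j) = 1 := by
        have := congrFun (congrFun h a) (x' j)
        rw [Matrix.mul_apply] at this
        rw [this, h5]; simp
      have : ∀ c, S d b * B a c * rho S (Function.update x j c) x' =
        (S d b * ∏ i ∈ Finset.univ.erase j, S (x i) (x' i)) * (B a c * S c (x' j)) := by
        intro c
        rw [hprod, Function.update_self]
        rw [Finset.prod_congr rfl (fun i hi => by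
          rw [Function.update_of_ne (Finset.ne_of_mem_erase hi)])]
        ring
      simp only [this]
      rw [← Finset.mul_sum, h6]; ring
    · have h6 : ∑ c, B a c * S c (x' j) = 0 := by
        have := congrFun (congrFun h a) (x' j)
        rw [Matrix.mul_apply] at this
        rw [this, Matrix.one_apply_ne h5]
      have : ∀ c, S d b * B a c * rho S (Function.update x j c) x' =
        (S d b * ∏ i ∈ Finset.univ.erase j, S (x i) (x' i)) * (B a c * S c (x' j)) := by
        intro c
        rw [hprod, Function.update_self]
        rw [Finset.prod_congr rfl (fun i hi => by
          rw [Function.update_of_ne (Finset.ne_of_mem_erase hi)])]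
        ring
      simp only [this]
      rw [← Finset.mul_sum, h6]; ring
    · simp
  simp only [h3]
  rw [Finset.sum_ite_eq Finset.univ (x j), if_pos (Finset.mem_univ _)]
  simp only [eq_comm (a := a)]
  split_ifs
  · rw [hprod, Function.update_self, mul_one]
    congr 1
    refine Finset.prod_congr rfl (fun i hi => by
          rw [Function.update_of_ne (Finset.ne_of_mem_erase hi)])
  · simp

theorem fe_sum' {ι R κ : Type*} [Fintype ι] [CommRing R] [Algebra ℂ R] (s : Finset κ)
    (m : κ → Matrix ι ι ℂ) :
    (fe (∑ k ∈ s, m k) : Module.End ℂ (ι → PowerSeries R)) = ∑ k ∈ s, fe (m k) := by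
  ext1 f; funext i
  simp only [fe_apply, LinearMap.sum_apply, Finset.sum_apply, Matrix.sum_apply, Finset.sum_smul]
  rw [Finset.sum_comm]

/-- the tensor model operator -/
abbrev tD (y : J → ℂ) (K : Matrix (Fin N) (Fin N) ℂ) :
    Module.End ℂ ((J → Fin N) → PowerSeries ℂ) :=
  fD y (fun (j : J) (a b : Fin N) => et j a b) K

theorem rho_fX (y : J → ℂ) (K S B : Matrix (Fin N) (Fin N) ℂ) (h : B * S = 1) (a b : Fin N)
    (f : (J → Fin N) → PowerSeries ℂ) :
    fe (rho S) (fX y (fun (j : J) (a b : Fin N) => et j a b) (B * K * S) a b f) =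
      (∑ d, S d b • ∑ c, B a c • fX y (fun (j : J) (a b : Fin N) => et j a b) K c d)
        (fe (rho S) f) := by
  have hd : ∀ f, fe (rho S) (fd _ ℂ f) = fd (J → Fin N) ℂ (fe (rho S) f) := fun f =>
    (LinearMap.congr_fun (fd_fe (R := ℂ) (rho (J := J) S)) f).symm
  have hm : ∀ p (f : (J → Fin N) → PowerSeries ℂ), fe (rho S) (fm p f) = fm p (fe (rho S) f) :=
    fun p f => (LinearMap.congr_fun (fm_fe (R := ℂ) p (rho (J := J) S)) f).symm
  have hC : ∀ (c : ℂ) (f : (J → Fin N) → PowerSeries ℂ), fm (PowerSeries.C c) f = c • f := by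
    intro c f; funext i
    simp [PowerSeries.smul_eq_C_mul]
  have he : ∀ j, fe (rho S) (fe (et j b a) f) =
      ∑ d, ∑ c, (S d b * B a c) • fe (et j d c) (fe (rho S) f) := by
    intro j
    have := congrArg (fun m => (fe m : Module.End ℂ ((J → Fin N) → PowerSeries ℂ)) f)
      (rho_conj (J := J) S B h j a b)
    simp only [fe_mul, Module.End.mul_apply] at this
    rw [← this]
    simp only [fe_sum', fe_smul, LinearMap.sum_apply, LinearMap.smul_apply]
  unfold fX
  simp only [LinearMap.sub_apply, map_sub, LinearMap.sum_apply, map_sum, Module.End.mul_apply,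
    hm, he, LinearMap.smul_apply, smul_sub, Finset.sum_sub_distrib, hC]
  congr 1
  · congr 1
    · have h1 : ∀ c d : Fin N, (if c = d then fd (J → Fin N) ℂ else 0) (fe (rho S) f) =
        if c = d then fd (J → Fin N) ℂ (fe (rho S) f) else 0 := by
        intro c d; split_ifs <;> simp
      simp only [h1, smul_ite, smul_zero, Finset.sum_ite_eq', Finset.mem_univ, if_true]
      rw [← hd]
      simp only [smul_smul, ← Finset.sum_smul]
      have : ∑ x, S x b * B a x = if a = b then 1 else 0 := by
        have := congrFun (congrFun h a) b
        rw [Matrix.mul_apply, Matrix.one_apply] at this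
        rw [← this]
        exact Finset.sum_congr rfl fun x _ => mul_comm _ _
      rw [this]
      split_ifs <;> simp
    · rw [map_smul]
      simp only [smul_smul, ← Finset.sum_smul]
      congr 1
      simp only [Matrix.mul_apply, Finset.sum_mul, Finset.mul_sum]
      refine Finset.sum_congr rfl fun d _ => Finset.sum_congr rfl fun c _ => ?_
      ring
  · simp only [Finset.smul_sum, smul_smul, map_smul]
    rw [Finset.sum_comm]
    refine Finset.sum_congr rfl fun d _ => ?_
    rw [Finset.sum_comm]

theorem rho_tD (y : J → ℂ) (K S B : Matrix (Fin N) (Fin N) ℂ) (h : B * S = 1)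
    (f : (J → Fin N) → PowerSeries ℂ) :
    fe (rho S) (tD y (B * K * S) f) = tD y K (fe (rho S) f) := by
  have := rdr_intertwine (fe (rho S) : Module.End ℂ ((J → Fin N) → PowerSeries ℂ)) _ _ id
    (rho_fX y K S B h) f
  unfold tD fD
  rw [this]
  have h2 := rdr_conj (fX_manin y (fun (j : J) (a b : Fin N) => et j a b) K siteRel_et) B S h
  rw [← h2]

end Tens

end GaudinModel

set_option linter.unusedSectionVars false
namespace GaudinModel

section Mask
variable {J : Type*} [Fintype J] [DecidableEq J] {N : ℕ}

/-- colour weight -/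
def wt (c : J → Fin N) (a : Fin N) : ℕ := (Finset.univ.filter fun j => c j = a).card

/-- projection to a colour weight -/
def mask (k : Fin N → ℕ) : Module.End ℂ ((J → Fin N) → PowerSeries ℂ) where
  toFun f := fun c => if wt c = k then f c else 0
  map_add' f g := by funext c; simp only [Pi.add_apply]; split_ifs <;> simp
  map_smul' x f := by funext c; simp

@[simp] theorem mask_apply (k : Fin N → ℕ) (f : (J → Fin N) → PowerSeries ℂ) (c : J → Fin N) :
    mask k f c = if wt c = k then f c else 0 := rfl

theorem sum_mask (f : (J → Fin N) → PowerSeries ℂ) :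
    ∑ k ∈ Finset.univ.image (fun c : J → Fin N => wt c), mask k f = f := by
  funext c
  rw [Finset.sum_apply]
  simp only [mask_apply]
  rw [Finset.sum_ite_eq, if_pos]
  exact Finset.mem_image_of_mem _ (Finset.mem_univ _)

theorem rho_diag_apply (s : Fin N → ℂ) (f : (J → Fin N) → PowerSeries ℂ) (c : J → Fin N) :
    fe (rho (Matrix.diagonal s)) f c = (∏ j, s (c j)) • f c := by
  rw [fe_apply, Finset.sum_eq_single c]
  · simp [rho]
  · intro c' _ h
    obtain ⟨j, hj⟩ := Function.ne_iff.mp h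
    unfold rho
    rw [Finset.prod_eq_zero (Finset.mem_univ j), zero_smul]
    exact Matrix.diagonal_apply_ne' _ hj
  · simp

theorem prod_update (a : Fin N) (c : J → Fin N) :
    ∏ j, (Function.update (1 : Fin N → ℂ) a 2) (c j) = 2 ^ wt c a := by
  simp only [Function.update_apply, Pi.one_apply]
  rw [Finset.prod_ite]
  simp [wt]

theorem tD_supp (y : J → ℂ) (lam : Fin N → ℂ) (k : Fin N → ℕ)
    (f : (J → Fin N) → PowerSeries ℂ) (hf : ∀ c, wt c ≠ k → f c = 0) :
    ∀ c, wt c ≠ k → tD y (Matrix.diagonal lam) f c = 0 := by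
  intro c hc
  obtain ⟨a, ha⟩ := Function.ne_iff.mp hc
  set s := Function.update (1 : Fin N → ℂ) a 2 with hs
  have hs0 : ∀ i, s i ≠ 0 := by
    intro i; rw [hs, Function.update_apply]; split_ifs <;> simp
  have h := rho_tD y (Matrix.diagonal lam) (Matrix.diagonal s) (Matrix.diagonal (fun i => (s i)⁻¹))
    (by rw [Matrix.diagonal_mul_diagonal]; simp [hs0]) f
  have e1 : Matrix.diagonal (fun i => (s i)⁻¹) * Matrix.diagonal lam * Matrix.diagonal s =
      Matrix.diagonal lam := by
    rw [Matrix.diagonal_mul_diagonal, Matrix.diagonal_mul_diagonal]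
    congr 1; funext i
    field_simp [hs0 i]
  have e2 : fe (rho (Matrix.diagonal s)) f = (2 ^ k a : ℂ) • f := by
    funext c'
    rw [rho_diag_apply, prod_update]
    by_cases h : wt c' = k
    · rw [h]; rfl
    · rw [Pi.smul_apply, hf c' h]; simp
  rw [e1, e2, map_smul] at h
  have h2 := congrFun h c
  rw [rho_diag_apply, prod_update, Pi.smul_apply, ← sub_eq_zero, ← sub_smul] at h2
  refine (smul_eq_zero.mp h2).resolve_left ?_
  intro h3
  rw [sub_eq_zero] at h3
  apply ha
  have h4 : (2 : ℕ) ^ wt c a = 2 ^ k a := by exact_mod_cast h3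
  exact Nat.pow_right_injective (le_refl 2) h4

theorem tD_mask (y : J → ℂ) (lam : Fin N → ℂ) (k : Fin N → ℕ)
    (f : (J → Fin N) → PowerSeries ℂ) :
    tD y (Matrix.diagonal lam) (mask k f) = mask k (tD y (Matrix.diagonal lam) f) := by
  have h1 : ∀ k', mask k' (tD y (Matrix.diagonal lam) (mask k' f)) =
    tD y (Matrix.diagonal lam) (mask k' f) := by
    intro k'
    funext c
    rw [mask_apply]
    split_ifs with h
    · rfl
    · exact (tD_supp y lam k' (mask k' f) (fun c hc => by simp [hc]) c h).symm
  have h2 : ∀ k', k' ≠ k → mask k (tD y (Matrix.diagonal lam) (mask k' f)) = 0 := by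
    intro k' hk
    rw [← h1]
    funext c
    simp only [mask_apply, Pi.zero_apply]
    split_ifs with h3 h4
    · exact absurd (h4.symm.trans h3) hk
    · rfl
    · rfl
  by_cases hk : k ∈ Finset.univ.image (fun c : J → Fin N => wt c)
  · conv_rhs => rw [← sum_mask f]
    rw [map_sum, map_sum, Finset.sum_eq_single k (fun k' _ h => h2 k' h) (fun h => absurd hk h), h1]
  · have h3 : ∀ c : J → Fin N, wt c ≠ k := by
      intro c h; exact hk (Finset.mem_image.mpr ⟨c, Finset.mem_univ _, h⟩)
    have h4 : ∀ g : (J → Fin N) → PowerSeries ℂ, mask k g = 0 := by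
      intro g; funext c; simp [h3 c]
    rw [h4, h4, map_zero]

end Mask

section Incl
variable {J : Type*} [Fintype J] [DecidableEq J] {N : ℕ}

/-- inclusion of `N` colours in `N + 1` colours -/
def incl : ((J → Fin N) → PowerSeries ℂ) →ₗ[ℂ] ((J → Fin (N + 1)) → PowerSeries ℂ) where
  toFun f := fun c => ∑ c' : J → Fin N, if c = (fun j => (c' j).castSucc) then f c' else 0
  map_add' f g := by
    funext c
    simp only [Pi.add_apply, ← Finset.sum_add_distrib]
    refine Finset.sum_congr rfl fun c' _ => ?_
    split_ifs <;> simp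
  map_smul' x f := by
    funext c
    simp only [Pi.smul_apply, RingHom.id_apply, Finset.smul_sum]
    refine Finset.sum_congr rfl fun c' _ => ?_
    split_ifs <;> simp

theorem incl_cast (f : (J → Fin N) → PowerSeries ℂ) (c : J → Fin N) :
    incl f (fun j => (c j).castSucc) = f c := by
  simp only [incl, LinearMap.coe_mk, AddHom.coe_mk]
  rw [Finset.sum_eq_single c]
  · simp
  · intro c' _ h
    rw [if_neg]
    intro h2
    apply h
    funext j
    exact (Fin.castSucc_injective _ (congrFun h2 j)).symm
  · simp

theorem incl_last (f : (J → Fin N) → PowerSeries ℂ) (c : J → Fin (N + 1)) (j : J)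
    (h : c j = Fin.last N) : incl f c = 0 := by
  simp only [incl, LinearMap.coe_mk, AddHom.coe_mk]
  refine Finset.sum_eq_zero fun c' _ => ?_
  rw [if_neg]
  rintro rfl
  exact (Fin.castSucc_lt_last _).ne h

theorem col_cases (c : J → Fin (N + 1)) :
    (∃ c' : J → Fin N, c = fun j => (c' j).castSucc) ∨ ∃ j, c j = Fin.last N := by
  by_cases h : ∃ j, c j = Fin.last N
  · exact Or.inr h
  · left
    push Not at h
    exact ⟨fun j => (c j).castPred (h j), by funext j; simp⟩

theorem incl_ext {f g : (J → Fin (N + 1)) → PowerSeries ℂ}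
    (h1 : ∀ c : J → Fin N, f (fun j => (c j).castSucc) = g (fun j => (c j).castSucc))
    (h2 : ∀ c j, c j = Fin.last N → f c = g c) : f = g := by
  funext c
  rcases col_cases c with ⟨c', rfl⟩ | ⟨j, hj⟩
  · exact h1 c'
  · exact h2 c j hj

theorem fe_et_apply (j : J) (a b : Fin N) (f : (J → Fin N) → PowerSeries ℂ) (c : J → Fin N) :
    fe (et j a b) f c = if c j = a then f (Function.update c j b) else 0 := by
  rw [fe_apply]; exact et_mulVec j a b f c

theorem incl_fd (f : (J → Fin N) → PowerSeries ℂ) : fd _ ℂ (incl f) = incl (fd _ ℂ f) := by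
  refine incl_ext ?_ ?_
  · intro c; rw [fd_apply, incl_cast, incl_cast]; rfl
  · intro c j h; rw [fd_apply, incl_last _ c j h, incl_last _ c j h]; simp

theorem incl_fm (p : PowerSeries ℂ) (f : (J → Fin N) → PowerSeries ℂ) :
    fm p (incl f) = incl (fm p f) := by
  refine incl_ext ?_ ?_
  · intro c; rw [fm_apply, incl_cast, incl_cast]; rfl
  · intro c j h; rw [fm_apply, incl_last _ c j h, incl_last _ c j h]; simp

theorem incl_fe (j : J) (a b : Fin N) (f : (J → Fin N) → PowerSeries ℂ) :
    fe (et j a.castSucc b.castSucc) (incl f) = incl (fe (et j a b) f) := by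
  refine incl_ext ?_ ?_
  · intro c
    rw [incl_cast, fe_et_apply, fe_et_apply]
    have : Function.update (fun j => (c j).castSucc) j b.castSucc =
        fun j' => (Function.update c j b j').castSucc := by
      funext j'
      by_cases h : j' = j
      · subst h; simp
      · simp [Function.update_of_ne h]
    rw [this, incl_cast]
    simp
  · intro c j' h
    rw [incl_last _ c j' h, fe_et_apply]
    split_ifs with h2
    · apply incl_last _ _ j'
      rw [Function.update_of_ne, h]
      rintro rfl
      rw [h] at h2
      exact (Fin.castSucc_lt_last _).ne h2.symm
    · rfl

theorem incl_fe_last (j : J) (a : Fin (N + 1)) (f : (J → Fin N) → PowerSeries ℂ) :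
    fe (et j a (Fin.last N)) (incl f) = 0 := by
  funext c
  rw [fe_et_apply]
  split_ifs
  · apply incl_last _ _ j; simp
  · rfl

theorem incl_fX (y : J → ℂ) (lam : Fin N → ℂ) (μ : ℂ) (a b : Fin N)
    (f : (J → Fin N) → PowerSeries ℂ) :
    fX y (fun (j : J) (a b : Fin (N + 1)) => et j a b)
      (Matrix.diagonal (Fin.snoc lam μ : Fin (N + 1) → ℂ)) a.castSucc b.castSucc (incl f) =
    incl (fX y (fun (j : J) (a b : Fin N) => et j a b) (Matrix.diagonal lam) a b f) := by
  unfold fX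
  simp only [LinearMap.sub_apply, map_sub, LinearMap.sum_apply, map_sum, Module.End.mul_apply,
    incl_fe, incl_fm]
  congr 2
  · simp only [Fin.castSucc_inj]
    split_ifs
    · exact incl_fd f
    · simp
  · congr 3
    by_cases h : a = b
    · subst h; simp
    · rw [Matrix.diagonal_apply_ne _ h, Matrix.diagonal_apply_ne]
      simpa using h

theorem incl_fX_last (y : J → ℂ) (lam : Fin N → ℂ) (μ : ℂ) (b : Fin (N + 1))
    (f : (J → Fin N) → PowerSeries ℂ) :
    fX y (fun (j : J) (a b : Fin (N + 1)) => et j a b)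
      (Matrix.diagonal (Fin.snoc lam μ : Fin (N + 1) → ℂ)) (Fin.last N) b (incl f) =
    if b = Fin.last N then incl (fd _ ℂ f - μ • f) else 0 := by
  unfold fX
  simp only [LinearMap.sub_apply, LinearMap.sum_apply, Module.End.mul_apply,
    incl_fe_last]
  have hC : ∀ (c : ℂ) (f : (J → Fin N) → PowerSeries ℂ), fm (PowerSeries.C c) f = c • f := by
    intro c f; funext i
    simp [PowerSeries.smul_eq_C_mul]
  have hC0 : (0 : (J → Fin N) → PowerSeries ℂ) = fm (PowerSeries.C (0 : ℂ)) f := by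
    rw [hC, zero_smul]
  by_cases h : b = Fin.last N
  · subst h
    simp only [if_true, map_zero, Finset.sum_const_zero, sub_zero]
    rw [incl_fd, incl_fm, map_sub, Matrix.diagonal_apply_eq, Fin.snoc_last, hC]
  · rw [if_neg h, if_neg (Ne.symm h), Matrix.diagonal_apply_ne _ (Ne.symm h), incl_fm, ← hC0]
    simp

/-- extension of a permutation fixing the last element -/
def extp (σ : Equiv.Perm (Fin N)) : Equiv.Perm (Fin (N + 1)) :=
  (finSuccEquivLast).symm.permCongr (Equiv.optionCongr σ)

theorem extp_cast (σ : Equiv.Perm (Fin N)) (i : Fin N) :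
    extp σ i.castSucc = (σ i).castSucc := by
  simp [extp, Equiv.permCongr_apply]

theorem extp_last (σ : Equiv.Perm (Fin N)) : extp σ (Fin.last N) = Fin.last N := by
  simp [extp, Equiv.permCongr_apply]

theorem extp_sign (σ : Equiv.Perm (Fin N)) : Equiv.Perm.sign (extp σ) = Equiv.Perm.sign σ := by
  rw [extp, Equiv.Perm.sign_permCongr, Equiv.optionCongr_sign]

theorem extp_surj (τ : Equiv.Perm (Fin (N + 1))) (h : τ (Fin.last N) = Fin.last N) :
    ∃ σ, extp σ = τ := by
  have hne : ∀ i : Fin N, τ i.castSucc ≠ Fin.last N := by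
    intro i hi
    exact (Fin.castSucc_lt_last i).ne (τ.injective (hi.trans h.symm))
  have hinj : Function.Injective (fun i : Fin N => (τ i.castSucc).castPred (hne i)) := by
    intro i j hij
    simp only [Fin.castPred_inj] at hij
    exact Fin.castSucc_injective _ (τ.injective hij)
  refine ⟨Equiv.ofBijective _ (Finite.injective_iff_bijective.mp hinj), ?_⟩
  ext i
  refine Fin.lastCases ?_ (fun i => ?_) i
  · rw [extp_last, h]
  · rw [extp_cast]; simp

theorem extp_inj : Function.Injective (extp : Equiv.Perm (Fin N) → _) := by
  intro σ τ h
  ext i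
  have := congrArg (fun e => e i.castSucc) h
  simp only [extp_cast] at this
  exact congrArg Fin.val (Fin.castSucc_injective _ this)

theorem incl_tD (y : J → ℂ) (lam : Fin N → ℂ) (μ : ℂ) (f : (J → Fin N) → PowerSeries ℂ) :
    tD y (Matrix.diagonal (Fin.snoc lam μ : Fin (N + 1) → ℂ)) (incl f) =
    incl (tD y (Matrix.diagonal lam) (fd _ ℂ f - μ • f)) := by
  unfold tD fD rdr
  rw [LinearMap.sum_apply, LinearMap.sum_apply, map_sum]
  symm
  refine Fintype.sum_of_injective extp extp_inj _ _ ?_ ?_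
  · intro τ hτ
    rw [LinearMap.smul_apply, List.ofFn_succ_last, List.prod_append]
    simp only [List.prod_cons, List.prod_nil, mul_one, Module.End.mul_apply, id]
    rw [incl_fX_last, if_neg, map_zero, smul_zero]
    intro h
    obtain ⟨σ, rfl⟩ := extp_surj τ h
    exact hτ ⟨σ, rfl⟩
  · intro σ
    rw [LinearMap.smul_apply, LinearMap.smul_apply, List.ofFn_succ_last, List.prod_append, extp_sign,
      map_zsmul]
    simp only [List.prod_cons, List.prod_nil, mul_one, Module.End.mul_apply, id, extp_cast,
      extp_last]
    rw [incl_fX_last, if_pos rfl]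
    congr 1
    generalize fd _ ℂ f - μ • f = g
    have hl : ∀ (m : ℕ) (p q : Fin m → Fin N) (g : (J → Fin N) → PowerSeries ℂ),
      incl ((List.ofFn fun i => fX y (fun (j : J) (a b : Fin N) => et j a b)
        (Matrix.diagonal lam) (p i) (q i)).prod g) =
      (List.ofFn fun i => fX y (fun (j : J) (a b : Fin (N + 1)) => et j a b)
      (Matrix.diagonal (Fin.snoc lam μ : Fin (N + 1) → ℂ)) (p i).castSucc (q i).castSucc).prod
        (incl g) := by
      intro m
      induction m with
      | zero => intro p q f; simp
      | succ m ih =>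
        intro p q f
        simp only [List.ofFn_succ, List.prod_cons, Module.End.mul_apply]
        rw [← incl_fX, ih]
    exact hl N (fun i => i) σ g

end Incl

end GaudinModel

set_option linter.unusedSectionVars false
namespace GaudinModel

section Base
variable {J : Type*} [Fintype J] [DecidableEq J] {N : ℕ}

/-- matrix units at site `j` acting on constant vectors -/
def tv (j : J) (a b : Fin N) : Module.End ℂ ((J → Fin N) → ℂ) where
  toFun v := fun c => if c j = a then v (Function.update c j b) else 0
  map_add' f g := by funext c; simp only [Pi.add_apply]; split_ifs <;> simp
  map_smul' x f := by funext c; simp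

theorem tv_apply (j : J) (a b : Fin N) (v : (J → Fin N) → ℂ) (c : J → Fin N) :
    tv j a b v c = if c j = a then v (Function.update c j b) else 0 := rfl

/-- constant vector times a power series -/
def pc {ι : Type*} (p : PowerSeries ℂ) : (ι → ℂ) →ₗ[ℂ] (ι → PowerSeries ℂ) where
  toFun v := fun i => v i • p
  map_add' f g := by funext i; simp [add_smul]
  map_smul' x f := by funext i; simp [smul_smul]

theorem pc_apply {ι : Type*} (p : PowerSeries ℂ) (v : ι → ℂ) (i : ι) : pc p v i = v i • p := rfl

theorem pc_add {ι : Type*} (p q : PowerSeries ℂ) (v : ι → ℂ) : pc (p + q) v = pc p v + pc q v := by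
  funext i; simp [pc_apply]

theorem pc_smul {ι : Type*} (c : ℂ) (q : PowerSeries ℂ) (v : ι → ℂ) :
    pc (c • q) v = c • pc q v := by
  funext i; simp only [pc_apply, Pi.smul_apply]; rw [smul_comm]

theorem fd_pc {ι : Type*} (p : PowerSeries ℂ) (v : ι → ℂ) :
    fd ι ℂ (pc p v) = pc (PowerSeries.derivative ℂ p) v := by
  funext i; simp [pc_apply]

theorem fm_pc {ι : Type*} (q p : PowerSeries ℂ) (v : ι → ℂ) :
    fm q (pc p v) = pc (q * p) v := by
  funext i; simp [pc_apply]

theorem fe_pc (p : PowerSeries ℂ) (j : J) (a b : Fin N) (v : (J → Fin N) → ℂ) :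
    fe (et j a b) (pc p v) = pc p (tv j a b v) := by
  funext c
  rw [fe_et_apply, pc_apply, pc_apply, tv_apply]
  split_ifs <;> simp

/-- exponential series -/
def ex (l : ℂ) : PowerSeries ℂ := PowerSeries.mk fun n => l ^ n / (n.factorial : ℂ)

theorem ex_deriv (l : ℂ) : PowerSeries.derivative ℂ (ex l) = l • ex l := by
  ext n
  rw [PowerSeries.coeff_derivative, PowerSeries.coeff_smul]
  simp only [ex, PowerSeries.coeff_mk, Nat.factorial_succ, smul_eq_mul]
  have h4 : ((n : ℂ) + 1) ≠ 0 := by exact_mod_cast Nat.succ_ne_zero n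
  have h5 : (n.factorial : ℂ) ≠ 0 := by exact_mod_cast Nat.factorial_ne_zero n
  push_cast
  field_simp
  ring

theorem ex_ne_zero (l : ℂ) : ex l ≠ 0 := by
  intro h
  have := congrArg (PowerSeries.coeff 0) h
  simp [ex] at this

theorem pc_inj {ι : Type*} {p : PowerSeries ℂ} (hp : p ≠ 0) {v : ι → ℂ} (h : pc p v = 0) :
    v = 0 := by
  funext i
  have := congrFun h i
  rw [pc_apply, Pi.zero_apply] at this
  exact (smul_eq_zero.mp this).resolve_right hp

theorem kz_sol (y : J → ℂ) (lam : Fin N → ℂ) (g : Fin N → (J → Fin N) → PowerSeries ℂ)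
    (hg : ∀ b, fd _ ℂ (g b) - lam b • g b = ∑ j, fm (gs ℂ (y j)) (∑ c, fe (et j b c) (g c)))
    (a : Fin N) : tD y (Matrix.diagonal lam) (g a) = 0 := by
  refine rdr_cramer (E := (J → Fin N) → PowerSeries ℂ)
    (fX_manin y (fun (j : J) (a b : Fin N) => et j a b) (Matrix.diagonal lam) siteRel_et) g ?_ a
  intro b
  have hC : ∀ (c : ℂ) (f : (J → Fin N) → PowerSeries ℂ), fm (PowerSeries.C c) f = c • f := by
    intro c f; funext i
    simp [PowerSeries.smul_eq_C_mul]
  have h1 : ∀ c, fX y (fun (j : J) (a b : Fin N) => et j a b) (Matrix.diagonal lam) c b • g c =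
    (if c = b then fd _ ℂ (g c) - lam c • g c else 0) - ∑ j, fm (gs ℂ (y j)) (fe (et j b c) (g c)) := by
    intro c
    rw [Module.End.smul_def]
    unfold fX
    simp only [LinearMap.sub_apply, LinearMap.sum_apply, Module.End.mul_apply, hC]
    congr 1
    by_cases h : c = b
    · subst h; simp
    · simp [h, Matrix.diagonal_apply_ne]
  simp only [h1, Finset.sum_sub_distrib, Finset.sum_ite_eq', Finset.mem_univ, if_true]
  rw [hg, sub_eq_zero, Finset.sum_comm]
  simp only [map_sum]

/-- the explicit solution, one site of colour `a` -/
theorem base_one (y : J → ℂ) (hy : ∀ j, y j ≠ 0) (lam : Fin N → ℂ) (hl : Function.Injective lam)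
    (a : Fin N) : ∃ T : Module.End ℂ ((J → Fin N) → ℂ), ∀ v0 : (J → Fin N) → ℂ,
      (∀ c (j l : J), j ≠ l → c j = a → c l = a → v0 c = 0) → (∑ j, tv j a a v0 = v0) →
      tD y (Matrix.diagonal lam) (pc (PowerSeries.X * ex (lam a)) v0 + pc (ex (lam a)) (T v0)) = 0 := by
  classical
  set S : Fin N → Module.End ℂ ((J → Fin N) → ℂ) := fun b => ∑ j, tv j b a with hS
  set T : Module.End ℂ ((J → Fin N) → ℂ) := - ∑ l, y l • tv l a a -
    ∑ b' ∈ Finset.univ.erase a, (lam a - lam b')⁻¹ • ∑ l, tv l a b' * S b' with hT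
  refine ⟨T, fun v0 h2 h1 => ?_⟩
  set g : Fin N → (J → Fin N) → PowerSeries ℂ := fun b =>
    if b = a then pc (PowerSeries.X * ex (lam a)) v0 + pc (ex (lam a)) (T v0) else
      (lam a - lam b)⁻¹ • pc (ex (lam a)) (S b v0) with hg
  have hga : g a = pc (PowerSeries.X * ex (lam a)) v0 + pc (ex (lam a)) (T v0) := by simp [hg]
  rw [← hga]
  apply kz_sol
  have F1 : ∀ j l b, tv j b a (tv l a a v0) = if l = j then tv j b a v0 else 0 := by
    intro j l b
    funext x
    by_cases hlj : l = j
    · subst hlj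
      simp only [tv_apply, if_true, Function.update_self, Function.update_idem]
    · rw [if_neg hlj]
      simp only [tv_apply, Pi.zero_apply, Function.update_of_ne hlj]
      split_ifs with h3 h4
      · apply h2 _ j l (Ne.symm hlj)
        · rw [Function.update_of_ne (Ne.symm hlj), Function.update_self]
        · rw [Function.update_self]
      · rfl
      · rfl
  have F2' : ∀ b', b' ≠ a → ∀ c j, c j = a → S b' v0 c = 0 := by
    intro b' hb c j hc
    simp only [hS, LinearMap.sum_apply, Finset.sum_apply, tv_apply]
    refine Finset.sum_eq_zero fun l _ => ?_
    split_ifs with h3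
    · have hlj : j ≠ l := by
        rintro rfl; exact hb (h3.symm.trans hc)
      apply h2 _ j l hlj
      · rw [Function.update_of_ne hlj, hc]
      · rw [Function.update_self]
    · rfl
  have F2 : ∀ j l b b', b' ≠ a → tv j b a (tv l a b' (S b' v0)) =
      if l = j then tv j b b' (S b' v0) else 0 := by
    intro j l b b' hb
    funext x
    by_cases hlj : l = j
    · subst hlj
      simp only [tv_apply, if_true, Function.update_self, Function.update_idem]
    · rw [if_neg hlj]
      simp only [tv_apply, Pi.zero_apply, Function.update_of_ne hlj]
      split_ifs with h3 h4
      · apply F2' b' hb _ j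
        rw [Function.update_of_ne (Ne.symm hlj), Function.update_self]
      · rfl
      · rfl
  have key : ∀ j b, tv j b a (T v0) + ∑ b' ∈ Finset.univ.erase a,
      (lam a - lam b')⁻¹ • tv j b b' (S b' v0) = - (y j • tv j b a v0) := by
    intro j b
    have e1 : tv j b a (T v0) = - ∑ l, y l • tv j b a (tv l a a v0) -
      ∑ b' ∈ Finset.univ.erase a, (lam a - lam b')⁻¹ • ∑ l, tv j b a (tv l a b' (S b' v0)) := by
      simp only [hT, LinearMap.sub_apply, LinearMap.neg_apply, LinearMap.sum_apply,
        LinearMap.smul_apply, Module.End.mul_apply, map_sub, map_neg, map_sum, map_smul]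
    have e2 : ∑ b' ∈ Finset.univ.erase a, (lam a - lam b')⁻¹ • ∑ l, tv j b a (tv l a b' (S b' v0)) =
      ∑ b' ∈ Finset.univ.erase a, (lam a - lam b')⁻¹ • tv j b b' (S b' v0) := by
      refine Finset.sum_congr rfl fun b' hb' => ?_
      congr 1
      rw [Finset.sum_congr rfl fun l _ => F2 j l b b' (Finset.ne_of_mem_erase hb')]
      simp
    rw [e1, e2]
    simp only [F1]
    simp
  intro b
  -- left-hand side
  have L : fd _ ℂ (g b) - lam b • g b = pc (ex (lam a)) (S b v0) := by
    by_cases hb : b = a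
    · subst hb
      have hSb : S b v0 = v0 := by
        simp only [hS, LinearMap.sum_apply]; exact h1
      rw [hga, hSb, map_add, fd_pc, fd_pc, ex_deriv, pc_smul, smul_add]
      have : PowerSeries.derivative ℂ (PowerSeries.X * ex (lam b)) = ex (lam b) +
          lam b • (PowerSeries.X * ex (lam b)) := by
        rw [Derivation.leibniz, ex_deriv, PowerSeries.derivative_X]
        simp only [smul_eq_mul, mul_one, mul_smul_comm]
        rw [add_comm]
      rw [this, pc_add, pc_smul]
      abel
    · have hne : lam a - lam b ≠ 0 := sub_ne_zero.mpr fun h => hb (hl h).symm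
      simp only [hg, if_neg hb]
      rw [map_smul, fd_pc, ex_deriv, pc_smul, smul_smul, smul_smul, ← sub_smul]
      rw [show (lam a - lam b)⁻¹ * lam a - lam b * (lam a - lam b)⁻¹ = 1 by field_simp, one_smul]
  have Rr : ∀ j, ∑ c, fe (et j b c) (g c) =
      pc ((PowerSeries.X - PowerSeries.C (y j)) * ex (lam a)) (tv j b a v0) := by
    intro j
    rw [← Finset.add_sum_erase _ _ (Finset.mem_univ a)]
    have e1 : ∑ c ∈ Finset.univ.erase a, fe (et j b c) (g c) = pc (ex (lam a))
        (∑ b' ∈ Finset.univ.erase a, (lam a - lam b')⁻¹ • tv j b b' (S b' v0)) := by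
      rw [map_sum]
      refine Finset.sum_congr rfl fun c hc => ?_
      simp only [hg, if_neg (Finset.ne_of_mem_erase hc)]
      rw [map_smul, fe_pc, map_smul]
    rw [e1, hga, map_add, fe_pc, fe_pc, add_assoc, ← map_add, key, map_neg, map_smul, sub_mul,
      sub_eq_add_neg, pc_add, ← neg_mul, ← map_neg, ← PowerSeries.smul_eq_C_mul, pc_smul, neg_smul]
  rw [L]
  simp only [Rr, fm_pc]
  rw [hS]
  simp only [LinearMap.sum_apply, map_sum]
  refine Finset.sum_congr rfl fun j _ => ?_
  have := gs_mul ℂ (y j) (hy j)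
  rw [← mul_assoc, mul_comm (gs ℂ (y j))]
  rw [show (algebraMap ℂ ℂ) (y j) = y j from rfl] at this
  rw [this, one_mul]

theorem base_zero (y : J → ℂ) (lam : Fin N → ℂ) (a : Fin N) (v0 : (J → Fin N) → ℂ)
    (h : ∀ c (j : J), c j = a → v0 c = 0) :
    tD y (Matrix.diagonal lam) (pc (ex (lam a)) v0) = 0 := by
  set g : Fin N → (J → Fin N) → PowerSeries ℂ := fun b =>
    if b = a then pc (ex (lam a)) v0 else 0 with hg
  have hga : g a = pc (ex (lam a)) v0 := by simp [hg]
  rw [← hga]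
  apply kz_sol
  intro b
  have h0 : ∀ j b, tv j b a v0 = 0 := by
    intro j b
    funext x
    rw [tv_apply]
    split_ifs
    · apply h _ j; simp
    · rfl
  have h1 : ∀ j c, fe (et j b c) (g c) = 0 := by
    intro j c
    by_cases hc : c = a
    · subst hc; rw [hga, fe_pc, h0, map_zero]
    · simp [hg, hc]
  have h2 : fd _ ℂ (g b) - lam b • g b = 0 := by
    by_cases hb : b = a
    · subst hb
      rw [hga, fd_pc, ex_deriv, pc_smul, sub_self]
    · simp [hg, hb]
  rw [h2]
  simp [h1]

end Base

end GaudinModel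

set_option linter.unusedSectionVars false
namespace GaudinModel

section BaseProp
variable {J : Type*} [Fintype J] [DecidableEq J] {N : ℕ}

/-- extension by zero -/
def ext0 (k : Fin N → ℕ) : ({c : J → Fin N // wt c = k} → ℂ) →ₗ[ℂ] ((J → Fin N) → ℂ) where
  toFun v := fun c => if h : wt c = k then v ⟨c, h⟩ else 0
  map_add' f g := by funext c; simp only [Pi.add_apply]; split_ifs <;> simp
  map_smul' x f := by funext c; simp

theorem ext0_supp (k : Fin N → ℕ) (v : {c : J → Fin N // wt c = k} → ℂ) (c : J → Fin N)
    (h : wt c ≠ k) : ext0 k v c = 0 := by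
  simp [ext0, h]

theorem ext0_inj (k : Fin N → ℕ) (v : {c : J → Fin N // wt c = k} → ℂ) (h : ext0 k v = 0) :
    v = 0 := by
  funext c
  have := congrFun h c.1
  simpa [ext0, c.2] using this

theorem mask_fd (k : Fin N → ℕ) (f : (J → Fin N) → PowerSeries ℂ) :
    fd _ ℂ (mask k f) = mask k (fd _ ℂ f) := by
  funext c
  simp only [fd_apply, mask_apply]
  split_ifs <;> simp

theorem mask_pc_ext0 (k : Fin N → ℕ) (p : PowerSeries ℂ) (v : {c : J → Fin N // wt c = k} → ℂ) :
    mask k (pc p (ext0 k v)) = pc p (ext0 k v) := by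
  funext c
  rw [mask_apply]
  split_ifs with h
  · rfl
  · rw [pc_apply, ext0_supp k v c h, zero_smul]

theorem base_G (y : J → ℂ) (hy : ∀ j, y j ≠ 0) (lam : Fin N → ℂ) (hl : Function.Injective lam)
    (k : Fin N → ℕ) (hk : ∀ a, k a ≤ 1) (a : Fin N) :
    ∃ G : ({c : J → Fin N // wt c = k} → ℂ) →ₗ[ℂ] ((J → Fin N) → PowerSeries ℂ),
      (∀ v, tD y (Matrix.diagonal lam) (G v) = 0) ∧ (∀ v c, wt c ≠ k → G v c = 0) ∧
      (∀ v, ((fd (J → Fin N) ℂ - lam a • (1 : Module.End ℂ ((J → Fin N) → PowerSeries ℂ))) ^ 2) (G v) = 0) ∧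
      (∀ v, G v = 0 → v = 0) := by
  set P : Module.End ℂ ((J → Fin N) → PowerSeries ℂ) := fd _ ℂ - lam a • (1 : Module.End ℂ _)
    with hP
  have hPa : ∀ f, P f = fd _ ℂ f - lam a • f := by intro f; simp [hP]
  have hP1 : ∀ v, P (pc (ex (lam a)) v) = 0 := by
    intro v
    rw [hPa, fd_pc, ex_deriv, pc_smul, sub_self]
  have hP2 : ∀ v, P (pc (PowerSeries.X * ex (lam a)) v) = pc (ex (lam a)) v := by
    intro v
    rw [hPa, fd_pc, Derivation.leibniz, ex_deriv, PowerSeries.derivative_X, pc_add, ← pc_smul]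
    have e1 : ((PowerSeries.X : PowerSeries ℂ) • lam a • ex (lam a) : PowerSeries ℂ) =
      lam a • (PowerSeries.X * ex (lam a)) := by
      rw [smul_eq_mul, mul_smul_comm]
    rw [e1, smul_eq_mul, mul_one, add_sub_cancel_left]
  have hPm : ∀ f, P (mask k f) = mask k (P f) := by
    intro f
    rw [hPa, hPa, map_sub, map_smul, mask_fd]
  have h01 : k a = 0 ∨ k a = 1 := by have := hk a; omega
  rcases h01 with h0 | h1
  · refine ⟨(pc (ex (lam a))).comp (ext0 k), ?_, ?_, ?_, ?_⟩
    · intro v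
      refine base_zero y lam a _ ?_
      intro c j hc
      apply ext0_supp
      intro h
      have : wt c a = 0 := by rw [h, h0]
      unfold wt at this
      rw [Finset.card_eq_zero, Finset.filter_eq_empty_iff] at this
      exact this (Finset.mem_univ j) hc
    · intro v c hc
      rw [LinearMap.comp_apply, pc_apply, ext0_supp k v c hc, zero_smul]
    · intro v
      rw [pow_two, Module.End.mul_apply, LinearMap.comp_apply, hP1, map_zero]
    · intro v hv
      exact ext0_inj k v (pc_inj (ex_ne_zero _) hv)
  · obtain ⟨T, hT⟩ := base_one y hy lam hl a
    refine ⟨(mask k).comp ((pc (PowerSeries.X * ex (lam a)) + (pc (ex (lam a))).comp T).comp (ext0 k)), ?_, ?_, ?_, ?_⟩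
    · intro v
      rw [LinearMap.comp_apply, tD_mask, LinearMap.comp_apply, LinearMap.add_apply,
        LinearMap.comp_apply, hT, map_zero]
      · intro c j l hjl hj hl'
        apply ext0_supp
        intro h
        have : wt c a = 1 := by rw [h, h1]
        unfold wt at this
        rw [Finset.card_eq_one] at this
        obtain ⟨x, hx⟩ := this
        have e1 : j ∈ ({x} : Finset J) := by rw [← hx]; simp [hj]
        have e2 : l ∈ ({x} : Finset J) := by rw [← hx]; simp [hl']
        rw [Finset.mem_singleton] at e1 e2
        exact hjl (e1.trans e2.symm)
      · funext c
        rw [Finset.sum_apply]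
        have e : ∀ j, tv j a a (ext0 k v) c = if c j = a then ext0 k v c else 0 := by
          intro j
          rw [tv_apply]
          split_ifs with h
          · rw [← h, Function.update_eq_self]
          · rfl
        simp only [e]
        rw [← Finset.sum_filter, Finset.sum_const]
        by_cases h : wt c = k
        · have : wt c a = 1 := by rw [h, h1]
          unfold wt at this
          rw [this, one_smul]
        · rw [ext0_supp k v c h, smul_zero]
    · intro v c hc
      rw [LinearMap.comp_apply, mask_apply, if_neg hc]
    · intro v
      rw [pow_two, Module.End.mul_apply, LinearMap.comp_apply, hPm, LinearMap.comp_apply,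
        LinearMap.add_apply, map_add, LinearMap.comp_apply, hP1, hP2, add_zero, hPm, hP1, map_zero]
    · intro v hv
      have h2 := congrArg P hv
      rw [LinearMap.comp_apply, hPm, LinearMap.comp_apply,
        LinearMap.add_apply, map_add, LinearMap.comp_apply, hP1, hP2, add_zero, map_zero,
        mask_pc_ext0] at h2
      exact ext0_inj k v (pc_inj (ex_ne_zero _) h2)

/-- all solutions of `D_K` supported in `W` are killed by `χ_K(∂)^d` -/
def PropW (y : J → ℂ) (K : Matrix (Fin N) (Fin N) ℂ) (W : (J → Fin N) → Prop) (d : ℕ) : Prop :=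
  ∀ f, tD y K f = 0 → (∀ c, ¬ W c → f c = 0) →
    (Polynomial.aeval (fd (J → Fin N) ℂ) (K.charpoly ^ d)) f = 0

theorem aeval_dvd {F : Type*} [AddCommGroup F] [Module ℂ F] (D : Module.End ℂ F)
    {p q : Polynomial ℂ} (h : p ∣ q) (f : F)
    (hf : (Polynomial.aeval D p) f = 0) : (Polynomial.aeval D q) f = 0 := by
  obtain ⟨r, rfl⟩ := h
  rw [mul_comm, map_mul, Module.End.mul_apply, hf, map_zero]

theorem char_kill {F : Type*} [AddCommGroup F] [Module ℂ F] {D : Module.End ℂ F} (lam : Fin N → ℂ)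
    (a : Fin N) (d : ℕ) (f : F) (hf : ((D - lam a • (1 : Module.End ℂ F)) ^ d) f = 0) :
    (Polynomial.aeval D ((Matrix.diagonal lam).charpoly ^ d)) f = 0 := by
  refine aeval_dvd D (p := (Polynomial.X - Polynomial.C (lam a)) ^ d) ?_ f ?_
  · rw [Matrix.charpoly_diagonal]
    exact pow_dvd_pow_of_dvd (Finset.dvd_prod_of_mem _ (Finset.mem_univ a)) d
  · rw [map_pow, map_sub, Polynomial.aeval_X, Polynomial.aeval_C, Algebra.algebraMap_eq_smul_one]
    exact hf

theorem base_prop (y : J → ℂ) (hy : ∀ j, y j ≠ 0) (lam : Fin N → ℂ) (hl : Function.Injective lam)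
    (k : Fin N → ℕ) (hk : ∀ a, k a ≤ 1) :
    PropW y (Matrix.diagonal lam) (fun c => wt c = k) 2 := by
  choose G hG1 hG2 hG3 hG4 using base_G y hy lam hl k hk
  let Φ : (Fin N → {c : J → Fin N // wt c = k} → ℂ) →ₗ[ℂ] ((J → Fin N) → PowerSeries ℂ) :=
    ∑ a, (G a).comp (LinearMap.proj a)
  have hΦ : ∀ v, Φ v = ∑ a, G a (v a) := by intro v; simp [Φ]
  let I : ((J → Fin N) → PowerSeries ℂ) →ₗ[ℂ] (Fin N → {c : J → Fin N // wt c = k} → ℂ) :=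
    LinearMap.pi fun m => LinearMap.pi fun c =>
      (PowerSeries.coeff (R := ℂ) (m : ℕ)).comp (LinearMap.proj c.1)
  have hI : ∀ f m c, I f m c = PowerSeries.coeff (m : ℕ) (f c.1) := by intro f m c; rfl
  have hΦ1 : ∀ v, tD y (Matrix.diagonal lam) (Φ v) = 0 := by
    intro v; rw [hΦ, map_sum]; exact Finset.sum_eq_zero fun a _ => hG1 a _
  have hΦ2 : ∀ v c, wt c ≠ k → Φ v c = 0 := by
    intro v c hc; rw [hΦ, Finset.sum_apply]; exact Finset.sum_eq_zero fun a _ => hG2 a _ c hc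
  have huniq : ∀ f, tD y (Matrix.diagonal lam) f = 0 → (∀ c, wt c ≠ k → f c = 0) → I f = 0 →
      f = 0 := by
    intro f h1 h2 h3
    refine lead_unique (fD_lead y _ _) ?_ h1
    rw [mem_Fil]
    intro c m hm
    by_cases hc : wt c = k
    · have := congrFun (congrFun h3 ⟨m, hm⟩) ⟨c, hc⟩
      rwa [hI] at this
    · rw [h2 c hc, map_zero]
  have hinj : ∀ v, Φ v = 0 → v = 0 := by
    intro v hv
    rw [hΦ] at hv
    have hind := (Module.End.independent_maxGenEigenspace (fd (J → Fin N) ℂ)).comp hl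
    rw [iSupIndep_iff_finsetSum_eq_zero_imp_eq_zero] at hind
    funext a
    refine hG4 a _ ?_
    refine hind Finset.univ (fun a => G a (v a)) ?_ hv a (Finset.mem_univ a)
    intro b _
    simp only [Function.comp]
    rw [Module.End.mem_maxGenEigenspace]
    exact ⟨2, hG3 b _⟩
  have hsurj : Function.Surjective (I.comp Φ) := by
    rw [← LinearMap.injective_iff_surjective, injective_iff_map_eq_zero]
    intro v hv
    exact hinj v (huniq _ (hΦ1 v) (hΦ2 v) hv)
  intro f hf hW
  obtain ⟨v, hv⟩ := hsurj (I f)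
  have hfv : f = Φ v := by
    rw [← sub_eq_zero]
    refine huniq _ ?_ ?_ ?_
    · rw [map_sub, hf, hΦ1, sub_zero]
    · intro c hc; rw [Pi.sub_apply, hW c hc, hΦ2 v c hc, sub_zero]
    · rw [map_sub, ← hv]; exact sub_self _
  rw [hfv, hΦ, map_sum]
  refine Finset.sum_eq_zero fun a _ => ?_
  exact char_kill lam a 2 _ (hG3 a _)

end BaseProp

end GaudinModel

set_option linter.unusedSectionVars false
namespace GaudinModel

section Closure
variable {J : Type*} [Fintype J] [DecidableEq J] {N : ℕ}

/-- scalar constant coefficient operator with coefficients in `R` -/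
def sop {R : Type*} [CommRing R] (B : ℕ) (p : Polynomial R) (f : PowerSeries R) : PowerSeries R :=
  ∑ n ∈ Finset.range B, PowerSeries.C (p.coeff n) * ((PowerSeries.derivative R)^[n] f)

theorem map_deriv {R R' : Type*} [CommRing R] [CommRing R'] (ψ : R →+* R') (f : PowerSeries R) :
    PowerSeries.map ψ (PowerSeries.derivative R f) =
      PowerSeries.derivative R' (PowerSeries.map ψ f) := by
  ext n
  simp [PowerSeries.coeff_derivative]

theorem map_deriv_iter {R R' : Type*} [CommRing R] [CommRing R'] (ψ : R →+* R') (n : ℕ)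
    (f : PowerSeries R) :
    PowerSeries.map ψ ((PowerSeries.derivative R)^[n] f) =
      (PowerSeries.derivative R')^[n] (PowerSeries.map ψ f) := by
  induction n generalizing f with
  | zero => rfl
  | succ n ih => rw [Function.iterate_succ_apply, Function.iterate_succ_apply, ih, map_deriv]

theorem sop_map {R R' : Type*} [CommRing R] [CommRing R'] (ψ : R →+* R') (B : ℕ)
    (p : Polynomial R) (f : PowerSeries R) :
    PowerSeries.map ψ (sop B p f) = sop B (p.map ψ) (PowerSeries.map ψ f) := by
  unfold sop
  rw [map_sum]
  refine Finset.sum_congr rfl fun n _ => ?_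
  rw [map_mul, map_deriv_iter, PowerSeries.map_C, Polynomial.coeff_map]

theorem fdpow_apply {ι : Type*} (n : ℕ) (f : ι → PowerSeries ℂ) (c : ι) :
    (fd ι ℂ ^ n) f c = (PowerSeries.derivative ℂ)^[n] (f c) := by
  induction n generalizing f with
  | zero => rfl
  | succ n ih =>
    rw [pow_succ, Module.End.mul_apply, ih, fd_apply, Function.iterate_succ_apply]

theorem aeval_fd {ι : Type*} (B : ℕ) (p : Polynomial ℂ) (hp : p.natDegree < B)
    (f : ι → PowerSeries ℂ) (c : ι) :
    (Polynomial.aeval (fd ι ℂ) p) f c = sop B p (f c) := by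
  rw [Polynomial.aeval_eq_sum_range' hp, LinearMap.sum_apply, Finset.sum_apply]
  refine Finset.sum_congr rfl fun n _ => ?_
  rw [LinearMap.smul_apply, Pi.smul_apply, fdpow_apply, PowerSeries.smul_eq_C_mul]

theorem closure_prop (y : J → ℂ) (Ke : Matrix (Fin N) (Fin N) (Polynomial ℂ))
    (W : (J → Fin N) → Prop) [DecidablePred W] (d : ℕ) (bad : Set ℂ) (hbad : bad.Finite)
    (h : ∀ t ∉ bad, PropW y (Ke.map (Polynomial.aeval t)) W d)
    (hm : ∀ t ∉ bad, ∀ f, tD y (Ke.map (Polynomial.aeval t)) f = 0 →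
      tD y (Ke.map (Polynomial.aeval t)) (fun c => if W c then f c else 0) = 0) :
    PropW y (Ke.map (Polynomial.aeval (0 : ℂ))) W d := by
  intro f hf hW
  set ψ : ℂ → Polynomial ℂ →ₐ[ℂ] ℂ := fun t => Polynomial.aeval t with hψ
  obtain ⟨F, hF1, hF2⟩ := lead_exists (fD_lead y (fun (j : J) (a b : Fin N) => et j a b) Ke)
    (fsp (Algebra.ofId ℂ (Polynomial ℂ)) f)
  have hsol : ∀ t, tD y (Ke.map (ψ t)) (fsp (ψ t) F) = 0 := by
    intro t
    have := fsp_fD (ψ t) y (fun (j : J) (a b : Fin N) => et j a b) Ke F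
    rw [hF2, map_zero] at this
    exact this.symm
  have h0 : fsp (ψ 0) F = f := by
    rw [← sub_eq_zero]
    refine lead_unique (fD_lead y (fun (j : J) (a b : Fin N) => et j a b) (Ke.map (ψ 0))) ?_ ?_
    · rw [mem_Fil] at hF1 ⊢
      intro c m hmN
      have := hF1 c m hmN
      rw [Pi.sub_apply, map_sub, sub_eq_zero] at this ⊢
      have e : PowerSeries.coeff m (fsp (ψ 0) F c) = ψ 0 (PowerSeries.coeff m (F c)) := by
        simp [fsp]
      rw [e, this]
      simp [fsp, Algebra.ofId_apply, hψ]
    · rw [map_sub]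
      have e1 := hsol 0
      rw [e1, hf, sub_zero]
  have hch : ∀ t, (Ke.map (ψ t)).charpoly ^ d = (Ke.charpoly ^ d).map (ψ t : Polynomial ℂ →+* ℂ) := by
    intro t
    rw [Polynomial.map_pow, ← Matrix.charpoly_map]
    rfl
  set B := (Ke.charpoly ^ d).natDegree + 1 with hB
  have hdeg : ∀ t, ((Ke.map (ψ t)).charpoly ^ d).natDegree < B := by
    intro t
    rw [hch, hB]
    exact Nat.lt_succ_of_le (Polynomial.natDegree_map_le)
  have key : ∀ t c, (Polynomial.aeval (fd (J → Fin N) ℂ) ((Ke.map (ψ t)).charpoly ^ d))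
      (fsp (ψ t) F) c = PowerSeries.map (ψ t : Polynomial ℂ →+* ℂ) (sop B (Ke.charpoly ^ d) (F c)) := by
    intro t c
    rw [aeval_fd B _ (hdeg t), hch, sop_map]
    rfl
  have hz : ∀ c, W c → sop B (Ke.charpoly ^ d) (F c) = 0 := by
    intro c hc
    ext1 m
    rw [map_zero]
    apply Polynomial.eq_zero_of_infinite_isRoot
    refine Set.Infinite.mono ?_ hbad.infinite_compl
    intro t ht
    have h1 := h t ht _ (hm t ht _ (hsol t)) (fun c hc => by simp [hc])
    have h2 := congrFun h1 c
    have h3 : (Polynomial.aeval (fd (J → Fin N) ℂ) ((Ke.map (ψ t)).charpoly ^ d))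
      (fsp (ψ t) F) c = 0 := by
      rw [aeval_fd B _ (hdeg t)] at h2 ⊢
      rw [if_pos hc] at h2
      exact h2
    rw [key] at h3
    have h4 := congrArg (PowerSeries.coeff m) h3
    rw [PowerSeries.coeff_map, map_zero] at h4
    rw [Set.mem_setOf_eq, Polynomial.IsRoot.def, ← h4]
    simp [hψ, Polynomial.coe_aeval_eq_eval]
  funext c
  by_cases hc : W c
  · have h5 := key 0 c
    rw [h0, hz c hc, map_zero] at h5
    exact h5
  · rw [aeval_fd B _ (hdeg 0), hW c hc]
    unfold sop
    refine Finset.sum_eq_zero fun n _ => ?_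
    rw [Function.iterate_fixed (map_zero _), mul_zero]

end Closure

end GaudinModel

set_option linter.unusedSectionVars false
namespace GaudinModel

section Step
variable {J : Type*} [Fintype J] [DecidableEq J] {N : ℕ}

theorem base_all (y : J → ℂ) (hy : ∀ j, y j ≠ 0) (lam : Fin N → ℂ)
    (k : Fin N → ℕ) (hk : ∀ a, k a ≤ 1) :
    PropW y (Matrix.diagonal lam) (fun c => wt c = k) 2 := by
  set Ke : Matrix (Fin N) (Fin N) (Polynomial ℂ) :=
    Matrix.diagonal fun a => Polynomial.C (lam a) + Polynomial.X * Polynomial.C ((a : ℕ) : ℂ)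
    with hKe
  have hmap : ∀ t : ℂ, Ke.map (Polynomial.aeval t) =
      Matrix.diagonal fun a => lam a + t * ((a : ℕ) : ℂ) := by
    intro t
    rw [hKe, Matrix.diagonal_map (map_zero _)]
    congr 1
    funext a
    simp
  have h0 := closure_prop y Ke (fun c => wt c = k) 2
    (Set.range fun p : Fin N × Fin N => (lam p.2 - lam p.1) / (((p.1 : ℕ) : ℂ) - ((p.2 : ℕ) : ℂ)))
    (Set.finite_range _) ?_ ?_
  · rw [hmap] at h0
    simpa using h0
  · intro t ht
    rw [hmap]
    apply base_prop y hy _ _ k hk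
    intro a b hab
    by_contra hne
    apply ht
    refine ⟨(a, b), ?_⟩
    have hd : ((a : ℕ) : ℂ) - ((b : ℕ) : ℂ) ≠ 0 := by
      rw [sub_ne_zero]
      intro h
      exact hne (Fin.ext (by exact_mod_cast h))
    simp only at hab ⊢
    rw [div_eq_iff hd]
    linear_combination -hab
  · intro t ht f hf
    rw [hmap] at hf ⊢
    have := tD_mask y (fun a => lam a + t * ((a : ℕ) : ℂ)) k f
    rw [hf, map_zero] at this
    exact this

theorem PropW_mono {y : J → ℂ} {K : Matrix (Fin N) (Fin N) ℂ} {W : (J → Fin N) → Prop} {d d' : ℕ}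
    (hd : d ≤ d') (h : PropW y K W d) : PropW y K W d' :=
  fun f h1 h2 => aeval_dvd _ (pow_dvd_pow _ hd) f (h f h1 h2)

theorem step_G (a : Fin N) (h : (J → Fin N) → PowerSeries ℂ) (c : J → Fin N) (j : J)
    (hj : c j = a) :
    fe (rho (1 + Matrix.single (Fin.last N) a.castSucc (1 : ℂ))) (incl h)
      (Function.update (fun l => (c l).castSucc) j (Fin.last N)) = h c := by
  rw [fe_apply, Finset.sum_eq_single (fun l => (c l).castSucc)]
  · rw [incl_cast]
    unfold rho
    rw [Finset.prod_eq_one, one_smul]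
    intro l _
    by_cases hl : l = j
    · subst hl
      rw [Function.update_self, Matrix.add_apply]
      beta_reduce
      rw [hj, Matrix.single_apply_same,
        Matrix.one_apply_ne (Fin.castSucc_lt_last a).ne', zero_add]
    · rw [Function.update_of_ne hl, Matrix.add_apply, Matrix.one_apply_eq, Matrix.single_apply_of_row_ne, add_zero]
      exact (Fin.castSucc_lt_last _).ne'
  · intro c' _ hne
    rcases col_cases c' with ⟨c'', rfl⟩ | ⟨l, hl⟩
    · have : c'' ≠ c := by rintro rfl; exact hne rfl
      obtain ⟨l, hl⟩ := Function.ne_iff.mp this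
      unfold rho
      rw [Finset.prod_eq_zero (Finset.mem_univ l), zero_smul]
      by_cases hlj : l = j
      · subst hlj
        rw [Function.update_self, Matrix.add_apply,
          Matrix.one_apply_ne (Fin.castSucc_lt_last _).ne', zero_add, Matrix.single_apply_of_col_ne]
        intro h2
        apply hl
        rw [hj]
        exact (Fin.castSucc_injective _ h2).symm
      · rw [Function.update_of_ne hlj, Matrix.add_apply, Matrix.one_apply_ne, zero_add,
          Matrix.single_apply_of_row_ne]
        · exact (Fin.castSucc_lt_last _).ne'
        · intro h2; exact hl (Fin.castSucc_injective _ h2).symm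
    · rw [incl_last _ _ l hl, smul_zero]
  · simp

theorem step_wt (a : Fin N) (k : Fin N → ℕ) (c : J → Fin N) (hc : wt c = k) (j : J) (hj : c j = a) :
    wt (Function.update (fun l => (c l).castSucc) j (Fin.last N)) =
      (Fin.snoc (Function.update k a (k a - 1)) 1 : Fin (N + 1) → ℕ) := by
  funext x
  refine Fin.lastCases ?_ (fun x => ?_) x
  · rw [Fin.snoc_last]
    unfold wt
    rw [Finset.card_eq_one]
    refine ⟨j, ?_⟩
    ext l
    simp only [Finset.mem_filter, Finset.mem_univ, true_and, Finset.mem_singleton]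
    by_cases hl : l = j
    · simp [hl]
    · simp [hl, Function.update_of_ne hl, (Fin.castSucc_lt_last _).ne]
  · rw [Fin.snoc_castSucc]
    have e : (Finset.univ.filter fun l => Function.update (fun l => (c l).castSucc) j (Fin.last N) l
        = x.castSucc) = (Finset.univ.filter fun l => c l = x).erase j := by
      ext l
      simp only [Finset.mem_filter, Finset.mem_univ, true_and, Finset.mem_erase]
      by_cases hl : l = j
      · simp [hl, (Fin.castSucc_lt_last x).ne']
      · simp [hl, Function.update_of_ne hl]
    unfold wt
    rw [e]
    by_cases hx : x = a
    · subst hx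
      rw [Finset.card_erase_of_mem (by simp [hj]), Function.update_self, ← hc]
      rfl
    · rw [Finset.erase_eq_of_notMem, Function.update_of_ne hx, ← hc]
      · rfl
      · simp [hj, Ne.symm hx]

theorem aeval_comm {F : Type*} [AddCommGroup F] [Module ℂ F] (D : Module.End ℂ F)
    (p : Polynomial ℂ) (μ : ℂ) (f : F) :
    (Polynomial.aeval D p) (D f - μ • f) = D ((Polynomial.aeval D p) f) -
      μ • (Polynomial.aeval D p) f := by
  rw [map_sub, map_smul]
  congr 1
  have h : (Polynomial.aeval D p) * D = D * (Polynomial.aeval D p) := by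
    conv_lhs => rw [← Polynomial.aeval_X (R := ℂ) D]
    conv_rhs => rw [← Polynomial.aeval_X (R := ℂ) D]
    simp only [Polynomial.aeval_X]
    have := congrArg (Polynomial.aeval D) (mul_comm p Polynomial.X)
    rwa [map_mul, map_mul, Polynomial.aeval_X] at this
  exact LinearMap.congr_fun h f

theorem snoc_charpoly_dvd (lam : Fin N → ℂ) (a : Fin N) (d : ℕ) :
    (Matrix.diagonal (Fin.snoc lam (lam a) : Fin (N + 1) → ℂ)).charpoly ^ d ∣
      (Matrix.diagonal lam).charpoly ^ (2 * d) := by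
  rw [pow_mul]
  apply pow_dvd_pow_of_dvd
  rw [Matrix.charpoly_diagonal, Matrix.charpoly_diagonal, Fin.prod_univ_castSucc, pow_two]
  simp only [Fin.snoc_castSucc, Fin.snoc_last]
  exact mul_dvd_mul_left _ (Finset.dvd_prod_of_mem (fun i => Polynomial.X - Polynomial.C (lam i)) (Finset.mem_univ a))

theorem ring_conj {A : Type*} [Ring A] (s D : A) (h1 : s * s = 0) (h2 : s * D = D * s) :
    (1 - s) * D * (1 + s) = D ∧ (1 - s) * (1 + s) = 1 := by
  constructor
  · have : (1 - s) * D * (1 + s) = D + (D * s - s * D) - (s * D) * s := by noncomm_ring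
    rw [this, h2, mul_assoc, h1]; simp
  · have : (1 - s) * (1 + s) = 1 - s * s := by noncomm_ring
    rw [this, h1, sub_zero]

theorem single_diag {m : ℕ} (v : Fin m → ℂ) (p q : Fin m) (h : v p = v q) :
    Matrix.single p q (1 : ℂ) * Matrix.diagonal v = Matrix.diagonal v * Matrix.single p q (1 : ℂ) := by
  ext i j
  rw [Matrix.mul_diagonal, Matrix.diagonal_mul, Matrix.single_apply]
  split_ifs with h1
  · rw [← h1.1, ← h1.2, h, mul_comm]
  · simp

theorem conj_single (lam : Fin N → ℂ) (a : Fin N) :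
    (1 - Matrix.single (Fin.last N) a.castSucc (1 : ℂ)) *
      Matrix.diagonal (Fin.snoc lam (lam a) : Fin (N + 1) → ℂ) *
      (1 + Matrix.single (Fin.last N) a.castSucc (1 : ℂ)) =
      Matrix.diagonal (Fin.snoc lam (lam a) : Fin (N + 1) → ℂ) ∧
    (1 - Matrix.single (Fin.last N) a.castSucc (1 : ℂ)) *
      (1 + Matrix.single (Fin.last N) a.castSucc (1 : ℂ)) = 1 := by
  refine ring_conj _ _ ?_ ?_
  · exact Matrix.single_mul_single_of_ne _ _ _ _ (Fin.castSucc_lt_last a).ne _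
  · apply single_diag
    rw [Fin.snoc_last, Fin.snoc_castSucc]

theorem diag_prop (y : J → ℂ) (hy : ∀ j, y j ≠ 0) (m : ℕ) : ∀ (N : ℕ) (lam : Fin N → ℂ)
    (k : Fin N → ℕ) (_ : ∑ a, (k a - 1) ≤ m),
    PropW y (Matrix.diagonal lam) (fun c => wt c = k) (2 ^ (m + 1)) := by
  induction m with
  | zero =>
    intro N lam k hk
    apply base_all y hy lam k
    intro a
    have : k a - 1 ≤ ∑ a, (k a - 1) :=
      Finset.single_le_sum (f := fun a => k a - 1) (fun _ _ => Nat.zero_le _) (Finset.mem_univ a)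
    omega
  | succ m ih =>
    intro N lam k hk
    by_cases hall : ∀ a, k a ≤ 1
    · exact PropW_mono (by rw [pow_succ]; have := Nat.one_le_two_pow (n := m + 1); omega) (base_all y hy lam k hall)
    push Not at hall
    obtain ⟨a, ha⟩ := hall
    set k' : Fin (N + 1) → ℕ := Fin.snoc (Function.update k a (k a - 1)) 1 with hk'
    have hex : ∑ x, (k' x - 1) ≤ m := by
      rw [Fin.sum_univ_castSucc]
      simp only [hk', Fin.snoc_castSucc, Fin.snoc_last]
      rw [← Finset.add_sum_erase _ _ (Finset.mem_univ a)] at hk ⊢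
      have : ∑ x ∈ Finset.univ.erase a, (Function.update k a (k a - 1) x - 1) =
          ∑ x ∈ Finset.univ.erase a, (k x - 1) := by
        refine Finset.sum_congr rfl fun x hx => ?_
        rw [Function.update_of_ne (Finset.ne_of_mem_erase hx)]
      rw [this, Function.update_self]
      omega
    have IH := ih (N + 1) (Fin.snoc lam (lam a)) k' hex
    intro f hf hW
    obtain ⟨F0, _, hF0⟩ := lead_surj (L := 1)
      (P := fd (J → Fin N) ℂ - lam a • (1 : Module.End ℂ ((J → Fin N) → PowerSeries ℂ))) (by
        intro l g hg
        have : (fd (J → Fin N) ℂ - lam a • (1 : Module.End ℂ ((J → Fin N) → PowerSeries ℂ)) - fd (J → Fin N) ℂ ^ 1) g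
          = - (lam a • g) := by simp
        rw [this]
        exact Submodule.neg_mem _ (Submodule.smul_mem _ _ hg)) f
    set F := mask k F0 with hF
    have hF1 : fd _ ℂ F - lam a • F = f := by
      rw [hF, mask_fd, ← map_smul, ← map_sub]
      have : fd (J → Fin N) ℂ F0 - lam a • F0 = f := by rw [← hF0]; simp
      rw [this]
      funext c
      rw [mask_apply]
      split_ifs with h
      · rfl
      · exact (hW c h).symm
    set G := fe (rho (1 + Matrix.single (Fin.last N) a.castSucc (1 : ℂ))) (incl F) with hG
    have hGs : tD y (Matrix.diagonal (Fin.snoc lam (lam a) : Fin (N + 1) → ℂ)) G = 0 := by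
      rw [hG, ← rho_tD _ _ _ _ (conj_single lam a).2, (conj_single lam a).1, incl_tD, hF1, hf]
      simp
    have h1 := IH (mask k' G) (by rw [tD_mask, hGs, map_zero]) (fun c hc => by simp [hc])
    set χ := (Matrix.diagonal (Fin.snoc lam (lam a) : Fin (N + 1) → ℂ)).charpoly ^ (2 ^ (m + 1)) with hχ
    have h2 : Polynomial.aeval (fd (J → Fin N) ℂ) χ F = 0 := by
      funext c
      rw [aeval_fd _ _ (Nat.lt_succ_self _)]
      by_cases hc : wt c = k
      · have hex : ∃ j, c j = a := by
          have : 0 < wt c a := by rw [hc]; omega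
          unfold wt at this
          rw [Finset.card_pos] at this
          obtain ⟨j, hj⟩ := this
          exact ⟨j, by simpa using hj⟩
        obtain ⟨j, hj⟩ := hex
        have h3 := congrFun h1 (Function.update (fun l => (c l).castSucc) j (Fin.last N))
        rw [aeval_fd _ _ (Nat.lt_succ_self _), mask_apply, if_pos (step_wt a k c hc j hj), hG,
          step_G a F c j hj] at h3
        exact h3
      · rw [hF, mask_apply, if_neg hc]
        unfold sop
        refine Finset.sum_eq_zero fun n _ => ?_
        rw [Function.iterate_fixed (map_zero _), mul_zero]
    have h4 : Polynomial.aeval (fd (J → Fin N) ℂ) χ f = 0 := by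
      rw [← hF1, aeval_comm, h2, map_zero, smul_zero, sub_zero]
    refine aeval_dvd _ ?_ f h4
    rw [pow_succ 2 (m + 1), mul_comm _ 2]
    exact snoc_charpoly_dvd lam a _

theorem sum_wt (c : J → Fin N) : ∑ a, wt c a = Fintype.card J := by
  unfold wt
  rw [← Finset.card_univ, ← Finset.card_eq_sum_card_fiberwise]
  intro _ _; simp

theorem diag_prop_all (y : J → ℂ) (hy : ∀ j, y j ≠ 0) (lam : Fin N → ℂ) :
    PropW y (Matrix.diagonal lam) (fun _ => True) (2 ^ (Fintype.card J + 1)) := by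
  intro f hf _
  rw [← sum_mask f, map_sum]
  refine Finset.sum_eq_zero fun k hk => ?_
  obtain ⟨c, _, hc⟩ := Finset.mem_image.mp hk
  refine diag_prop y hy (Fintype.card J) N lam k ?_ _ (by rw [tD_mask, hf, map_zero])
    (fun c hc => by simp [hc])
  rw [← sum_wt c, ← hc]
  exact Finset.sum_le_sum fun a _ => Nat.sub_le _ _

theorem rho_mul (S B : Matrix (Fin N) (Fin N) ℂ) :
    (rho S * rho B : Matrix (J → Fin N) (J → Fin N) ℂ) = rho (S * B) := by
  ext c c'
  rw [Matrix.mul_apply]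
  unfold rho
  simp only [Matrix.mul_apply, ← Finset.prod_mul_distrib]
  rw [Finset.prod_univ_sum, Fintype.piFinset_univ]

theorem rho_one : (rho 1 : Matrix (J → Fin N) (J → Fin N) ℂ) = 1 := by
  ext c c'
  unfold rho
  by_cases h : c = c'
  · subst h; simp
  · rw [Matrix.one_apply_ne h]
    obtain ⟨j, hj⟩ := Function.ne_iff.mp h
    exact Finset.prod_eq_zero (Finset.mem_univ j) (Matrix.one_apply_ne hj)

theorem aeval_fe {ι : Type*} [Fintype ι] (p : Polynomial ℂ) (m : Matrix ι ι ℂ) (f : ι → PowerSeries ℂ) :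
    Polynomial.aeval (fd ι ℂ) p (fe m f) = fe m (Polynomial.aeval (fd ι ℂ) p f) := by
  have h : Commute (fd ι ℂ) (fe m) := fd_fe m
  have h2 : Commute (fe m) (Polynomial.aeval (fd ι ℂ) p) := by
    rw [Polynomial.aeval_eq_sum_range]
    refine Commute.sum_right _ _ _ fun n _ => ?_
    exact (h.symm.pow_right n).smul_right _
  exact (LinearMap.congr_fun h2.eq f).symm

theorem conj_prop (y : J → ℂ) (hy : ∀ j, y j ≠ 0) (K S B : Matrix (Fin N) (Fin N) ℂ)
    (lam : Fin N → ℂ) (hB : B * S = 1) (hK : B * K * S = Matrix.diagonal lam) :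
    PropW y K (fun _ => True) (2 ^ (Fintype.card J + 1)) := by
  intro f hf _
  have hS : S * B = 1 := mul_eq_one_comm.mp hB
  have hK2 : S * Matrix.diagonal lam * B = K := by
    rw [← hK]
    calc S * (B * K * S) * B = (S * B) * K * (S * B) := by noncomm_ring
      _ = K := by rw [hS]; simp
  have h1 := rho_tD y (Matrix.diagonal lam) B S hS f
  rw [hK2, hf, map_zero] at h1
  have h2 := diag_prop_all y hy lam (fe (rho B) f) h1.symm (fun c hc => absurd trivial hc)
  have hf2 : f = fe (rho S) (fe (rho B) f) := by
    rw [← Module.End.mul_apply, ← fe_mul, rho_mul, hS, rho_one]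
    funext i
    rw [fe_apply, Finset.sum_eq_single i]
    · simp
    · intro j _ hj
      rw [Matrix.one_apply_ne (Ne.symm hj), zero_smul]
    · simp
  have hch : K.charpoly = (Matrix.diagonal lam).charpoly := by
    rw [← hK]
    rw [Matrix.charpoly_mul_comm, ← mul_assoc, hS, one_mul]
  rw [hf2, aeval_fe, hch, h2, map_zero]

theorem diagonalize (K : Matrix (Fin N) (Fin N) ℂ) (h : K.charpoly.Separable) :
    ∃ (S B : Matrix (Fin N) (Fin N) ℂ) (lam : Fin N → ℂ), B * S = 1 ∧
      B * K * S = Matrix.diagonal lam := by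
  have hnd := Polynomial.nodup_roots h
  have hcard : K.charpoly.roots.toList.length = N := by
    rw [Multiset.length_toList]
    have := (IsAlgClosed.splits K.charpoly).natDegree_eq_card_roots
    rw [← this, Matrix.charpoly_natDegree_eq_dim, Fintype.card_fin]
  set lam : Fin N → ℂ := fun i => K.charpoly.roots.toList.get (Fin.cast hcard.symm i) with hlam
  have hinj : Function.Injective lam := by
    intro i j hij
    have h1 : K.charpoly.roots.toList.Nodup := by
      rw [← Multiset.coe_nodup, Multiset.coe_toList]; exact hnd
    have := (List.nodup_iff_injective_get.mp h1) hij
    exact Fin.ext (by simpa using congrArg Fin.val this)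
  have hroot : ∀ i, ∃ x : Fin N → ℂ, x ≠ 0 ∧ K.mulVec x = lam i • x := by
    intro i
    have h1 : lam i ∈ K.charpoly.roots := by
      rw [← Multiset.mem_toList]; exact List.get_mem _ _
    have h2 := Polynomial.isRoot_of_mem_roots h1
    rw [Polynomial.IsRoot.def, Matrix.eval_charpoly] at h2
    obtain ⟨x, hx, hx2⟩ := Matrix.exists_mulVec_eq_zero_iff.mpr h2
    refine ⟨x, hx, ?_⟩
    rw [Matrix.sub_mulVec, sub_eq_zero, Matrix.scalar_apply] at hx2
    rw [← hx2]
    funext a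
    simp [Matrix.mulVec_diagonal]
  choose x hx0 hx using hroot
  have hli : LinearIndependent ℂ x := by
    refine Module.End.eigenvectors_linearIndependent' (Matrix.toLin' K) lam hinj x fun i => ?_
    refine ⟨Module.End.mem_eigenspace_iff.mpr ?_, hx0 i⟩
    rw [Matrix.toLin'_apply, hx]
  set S : Matrix (Fin N) (Fin N) ℂ := Matrix.of fun a i => x i a with hS
  have hu : IsUnit S := by
    rw [← Matrix.linearIndependent_cols_iff_isUnit]
    exact hli
  obtain ⟨B, hB⟩ := hu.exists_left_inv
  refine ⟨S, B, lam, hB, ?_⟩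
  have : K * S = S * Matrix.diagonal lam := by
    ext a i
    rw [Matrix.mul_diagonal, Matrix.mul_apply]
    have := congrFun (hx i) a
    rw [Matrix.mulVec, dotProduct, Pi.smul_apply, smul_eq_mul] at this
    simp only [hS, Matrix.of_apply]
    rw [this, mul_comm]
  rw [mul_assoc, this, ← mul_assoc, hB, one_mul]

theorem prop_all (y : J → ℂ) (hy : ∀ j, y j ≠ 0) (K : Matrix (Fin N) (Fin N) ℂ) :
    PropW y K (fun _ => True) (2 ^ (Fintype.card J + 1)) := by
  set Ke : Matrix (Fin N) (Fin N) (Polynomial ℂ) := fun a b =>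
    (1 - Polynomial.X) * Polynomial.C (K a b) +
      Polynomial.X * Polynomial.C (Matrix.diagonal (fun i : Fin N => ((i : ℕ) : ℂ)) a b) with hKe
  have hmap : ∀ t : ℂ, Ke.map (Polynomial.aeval t) =
      (1 - t) • K + t • Matrix.diagonal (fun i : Fin N => ((i : ℕ) : ℂ)) := by
    intro t
    ext a b
    rw [Matrix.map_apply, hKe]
    simp
    ring
  set r : Polynomial ℂ := Polynomial.resultant Ke.charpoly (Polynomial.derivative Ke.charpoly) N (N - 1)
    with hr
  have hrt : ∀ t, Polynomial.eval t r = 0 ↔ ¬ (Ke.map (Polynomial.aeval t)).charpoly.Separable := by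
    intro t
    set φ : Polynomial ℂ →+* ℂ := Polynomial.evalRingHom t with hφ
    have hK : Ke.map (Polynomial.aeval t) = Ke.map φ := by
      ext a b
      simp [hφ, Polynomial.coe_aeval_eq_eval]
    have h1 := Polynomial.resultant_map_map Ke.charpoly (Polynomial.derivative Ke.charpoly) N (N-1) φ
    rw [← Polynomial.derivative_map, ← Matrix.charpoly_map, ← hK] at h1
    have h2 : Polynomial.eval t r = φ r := by simp [hφ]
    rw [h2, hr, ← h1]
    have hN : (Ke.map (Polynomial.aeval t)).charpoly.natDegree = N := by
      rw [Matrix.charpoly_natDegree_eq_dim, Fintype.card_fin]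
    have h3 := Polynomial.resultant_eq_zero_iff (f := (Ke.map (Polynomial.aeval t)).charpoly)
      (g := Polynomial.derivative (Ke.map (Polynomial.aeval t)).charpoly)
    rw [Polynomial.natDegree_derivative, hN] at h3
    rw [h3, Polynomial.separable_def]
    constructor
    · exact fun h => h.2
    · exact fun h => ⟨Or.inl (Matrix.charpoly_monic _).ne_zero, h⟩
  have hr0 : r ≠ 0 := by
    intro h
    have := (hrt 1).mp (by rw [h]; simp)
    apply this
    rw [hmap, Matrix.charpoly]
    simp only [sub_self, zero_smul, one_smul, zero_add]
    rw [← Matrix.charpoly, Matrix.charpoly_diagonal, Polynomial.separable_prod_X_sub_C_iff]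
    intro i j hij
    exact Fin.ext (by simpa using hij)
  have h0 := closure_prop y Ke (fun _ => True) (2 ^ (Fintype.card J + 1)) {t | Polynomial.IsRoot r t}
    (Polynomial.finite_setOfPred_isRoot hr0) ?_ ?_
  · rw [hmap] at h0
    simpa using h0
  · intro t ht
    have : (Ke.map (Polynomial.aeval t)).charpoly.Separable := by
      by_contra h
      exact ht ((hrt t).mpr h)
    obtain ⟨S, B, lam, h1, h2⟩ := diagonalize _ this
    exact conj_prop y hy _ S B lam h1 h2
  · intro t _ f hf
    simpa using hf

end Step

end GaudinModel

set_option linter.unusedSectionVars false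
namespace GaudinModel

section HWT
variable {N : ℕ} {A : Type*} [AddCommGroup A] [Module ℂ A]

/-- gl relations for a single family -/
def Rel1 (X : Fin N → Fin N → Module.End ℂ A) : Prop :=
  ∀ a b c d, X a b * X c d - X c d * X a b =
      (if b = c then (1 : ℂ) else 0) • X a d - (if d = a then (1 : ℂ) else 0) • X c b

theorem Rel1.app {X : Fin N → Fin N → Module.End ℂ A} (h : Rel1 X) (a b c d : Fin N) (x : A) :
    X a b (X c d x) = X c d (X a b x) + ((if b = c then (1 : ℂ) else 0) • X a d x -
      (if d = a then (1 : ℂ) else 0) • X c b x) := by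
  have := LinearMap.congr_fun (h a b c d) x
  simp only [LinearMap.sub_apply, Module.End.mul_apply, LinearMap.smul_apply] at this
  rw [← this]; abel

/-- weights strictly below `Λ` -/
inductive Low (Λ : Fin N → ℤ) : (Fin N → ℤ) → Prop
  | base (c d : Fin N) (h : d < c) : Low Λ (Λ + Pi.single c 1 - Pi.single d 1)
  | step (μ : Fin N → ℤ) (c d : Fin N) (h : d < c) (hμ : Low Λ μ) :
      Low Λ (μ + Pi.single c 1 - Pi.single d 1)

theorem low_pos {Λ μ : Fin N → ℤ} (h : Low Λ μ) (t : Fin N → ℤ) (ht : ∀ a b, a < b → t b < t a) :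
    0 < ∑ a, t a * (Λ a - μ a) := by
  have key : ∀ (ν : Fin N → ℤ) (c d : Fin N), ∑ a, t a * (Λ a - (ν + Pi.single c 1 - Pi.single d 1 : Fin N → ℤ) a)
      = ∑ a, t a * (Λ a - ν a) + (t d - t c) := by
    intro ν c d
    simp only [Pi.add_apply, Pi.sub_apply, mul_sub, mul_add, Finset.sum_sub_distrib,
      Finset.sum_add_distrib, Pi.single_apply, mul_ite, mul_one, mul_zero, Finset.sum_ite_eq',
      Finset.sum_ite_eq, Finset.mem_univ, if_true]
    ring
  induction h with
  | base c d h =>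
    rw [key]
    have := ht _ _ h
    simp only [sub_self, mul_zero, Finset.sum_const_zero, zero_add]
    omega
  | step μ c d h _ ih =>
    rw [key]
    have := ht _ _ h
    omega

theorem low_ne {Λ μ : Fin N → ℤ} (h : Low Λ μ) : μ ≠ Λ := by
  rintro rfl
  have := low_pos h (fun a => -(a : ℕ)) (by intro a b hab; simpa using hab)
  simp at this

/-- weight space -/
def WS (X : Fin N → Fin N → Module.End ℂ A) (χ : Fin N → ℂ) : Submodule ℂ A :=
  ⨅ a, LinearMap.ker (X a a - χ a • (1 : Module.End ℂ A))

theorem mem_WS {X : Fin N → Fin N → Module.End ℂ A} {χ : Fin N → ℂ} {x : A} :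
    x ∈ WS X χ ↔ ∀ a, X a a x = χ a • x := by
  simp [WS, Submodule.mem_iInf, sub_eq_zero]

theorem WS_lower {X : Fin N → Fin N → Module.End ℂ A} (hX : Rel1 X) (μ : Fin N → ℤ) (c d : Fin N)
    {x : A} (hx : x ∈ WS X (fun a => (μ a : ℂ))) :
    X c d x ∈ WS X (fun a => (((μ + Pi.single c 1 - Pi.single d 1 : Fin N → ℤ) a : ℤ) : ℂ)) := by
  rw [mem_WS] at hx ⊢
  intro a
  rw [hX.app, hx a, map_smul]
  simp only [Pi.add_apply, Pi.sub_apply, Pi.single_apply]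
  by_cases h1 : a = c
  · subst h1
    by_cases h2 : a = d
    · subst h2; simp
    · simp [h2, Ne.symm h2, add_smul]
  · by_cases h2 : a = d
    · subst h2; simp [h1, sub_eq_add_neg, add_smul, neg_smul]
    · simp [h1, h2, Ne.symm h2]

theorem WS_indep (X : Fin N → Fin N → Module.End ℂ A) (hX : Rel1 X) :
    iSupIndep (WS X) := by
  have h1 : iSupIndep fun χ : Fin N → ℂ => ⨅ i, (X i i).maxGenEigenspace (χ i) := by
    refine Module.End.independent_iInf_maxGenEigenspace_of_forall_mapsTo _ ?_
    intro i j φ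
    refine Module.End.mapsTo_maxGenEigenspace_of_comm ?_ φ
    have := hX j j i i
    rw [Commute, SemiconjBy, ← sub_eq_zero, this]
    by_cases h : i = j
    · subst h; simp
    · simp [h, Ne.symm h]
  refine h1.mono fun χ => ?_
  intro x hx
  rw [mem_WS] at hx
  rw [Submodule.mem_iInf]
  intro i
  rw [Module.End.mem_maxGenEigenspace]
  exact ⟨1, by simp [hx i]⟩

/-- the lowering closure -/
theorem lower_closure (X : Fin N → Fin N → Module.End ℂ A) (hX : Rel1 X) (v : A) (Λ : Fin N → ℂ)
    (hup : ∀ a b, a < b → X a b v = 0) (hdiag : ∀ a, X a a v = Λ a • v) (L : Submodule ℂ A)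
    (hv : v ∈ L) (hL : ∀ c d, d < c → ∀ x ∈ L, X c d x ∈ L) :
    ∃ S : Submodule ℂ A, S ≤ L ∧ v ∈ S ∧ ∀ a b, ∀ x ∈ S, X a b x ∈ S := by
  set S0 : Submodule ℂ A := sInf {L | v ∈ L ∧ ∀ c d, d < c → ∀ x ∈ L, X c d x ∈ L} with hS0
  have hv0 : v ∈ S0 := by
    rw [hS0, Submodule.mem_sInf]; exact fun L hL => hL.1
  have hlow : ∀ c d, d < c → ∀ x ∈ S0, X c d x ∈ S0 := by
    intro c d h x hx
    rw [hS0, Submodule.mem_sInf] at hx ⊢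
    exact fun L hL => hL.2 c d h x (hx L hL)
  refine ⟨S0, sInf_le ⟨hv, hL⟩, hv0, ?_⟩
  let S1 : Submodule ℂ A := S0 ⊓ ⨅ a, ⨅ b, S0.comap (X a b)
  have hmem : ∀ x, x ∈ S1 ↔ x ∈ S0 ∧ ∀ a b, X a b x ∈ S0 := by
    intro x; simp [S1, Submodule.mem_iInf]
  have hle : S0 ≤ S1 := by
    refine sInf_le ⟨?_, ?_⟩
    · rw [hmem]
      refine ⟨hv0, fun a b => ?_⟩
      rcases lt_trichotomy a b with h | h | h
      · rw [hup a b h]; exact zero_mem _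
      · subst h; rw [hdiag]; exact Submodule.smul_mem _ _ hv0
      · exact hlow a b h v hv0
    · intro c d h x hx
      rw [hmem] at hx ⊢
      refine ⟨hx.2 c d, fun a b => ?_⟩
      rw [hX.app]
      refine add_mem (hlow c d h _ (hx.2 a b)) (sub_mem ?_ ?_)
      · exact Submodule.smul_mem _ _ (hx.2 _ _)
      · exact Submodule.smul_mem _ _ (hx.2 _ _)
  intro a b x hx
  exact ((hmem x).mp (hle hx)).2 a b

/-- Casimir -/
def Cas (X : Fin N → Fin N → Module.End ℂ A) : Module.End ℂ A := ∑ a, ∑ b, X a b * X b a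

theorem Cas_comm (X : Fin N → Fin N → Module.End ℂ A) (hX : Rel1 X) (c d : Fin N) :
    Cas X * X c d = X c d * Cas X := by
  rw [← sub_eq_zero]
  have e : ∀ a b, X a b * X b a * X c d - X c d * (X a b * X b a) =
      ((if a = c then X a b * X b d else 0) - (if d = b then X a b * X c a else 0)) +
      ((if b = c then X a d * X b a else 0) - (if d = a then X c b * X b a else 0)) := by
    intro a b
    have : X a b * X b a * X c d - X c d * (X a b * X b a) =
      X a b * (X b a * X c d - X c d * X b a) + (X a b * X c d - X c d * X a b) * X b a := by
      noncomm_ring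
    rw [this, hX b a c d, hX a b c d]
    split_ifs <;> simp [mul_sub, sub_mul]
  unfold Cas
  simp only [Finset.sum_mul, Finset.mul_sum, ← Finset.sum_sub_distrib, e]
  simp only [Finset.sum_add_distrib, Finset.sum_sub_distrib]
  rw [Finset.sum_comm (f := fun a b => if a = c then X a b * X b d else 0),
    Finset.sum_comm (f := fun a b => if d = a then X c b * X b a else 0)]
  simp only [Finset.sum_ite_eq, Finset.sum_ite_eq', Finset.mem_univ, if_true]
  abel

theorem Cas_sing (X : Fin N → Fin N → Module.End ℂ A) (hX : Rel1 X) (x : A) (ν : Fin N → ℂ)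
    (hup : ∀ a b, a < b → X a b x = 0) (hdiag : ∀ a, X a a x = ν a • x) :
    Cas X x = (∑ a, ν a * (ν a + ((N : ℂ) - 1 - 2 * ((a : ℕ) : ℂ)))) • x := by
  have h1 : ∀ a b, X a b (X b a x) = ((if a = b then ν a * ν a else 0) +
      ((if a < b then ν a else 0) - (if a < b then ν b else 0))) • x := by
    intro a b
    rcases lt_trichotomy a b with h | h | h
    · rw [hX.app, hup a b h]
      simp [h, h.ne, hdiag, sub_smul]
    · subst h
      simp [hdiag, smul_smul]
    · rw [hup b a h]
      simp [h.ne', not_lt.mpr h.le]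
  unfold Cas
  simp only [LinearMap.sum_apply, Module.End.mul_apply, h1]
  simp only [← Finset.sum_smul]
  congr 1
  simp only [Finset.sum_add_distrib, Finset.sum_sub_distrib, Finset.sum_ite_eq, Finset.mem_univ,
    if_true]
  rw [Finset.sum_comm (f := fun a b => if a < b then ν b else 0)]
  simp only [mul_add, Finset.sum_add_distrib, ← Finset.sum_filter, Finset.sum_const]
  congr 1
  rw [← Finset.sum_sub_distrib]
  refine Finset.sum_congr rfl fun a _ => ?_
  have e1 : (Finset.univ.filter fun b : Fin N => a < b).card = N - 1 - a := by
    rw [← Fin.card_Ioi]; congr 1; ext b; simp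
  have e2 : (Finset.univ.filter fun b : Fin N => b < a).card = a := by
    rw [← Fin.card_Iio]; congr 1; ext b; simp
  rw [e1, e2, nsmul_eq_mul, nsmul_eq_mul, Nat.cast_sub (by omega), Nat.cast_sub (by have := a.2; omega)]
  push_cast
  ring

theorem common_eig (X : Fin N → Fin N → Module.End ℂ A) [FiniteDimensional ℂ A]
    (s : Finset (Fin N)) (U : Submodule ℂ A) (hU : U ≠ ⊥) (hst : ∀ a, ∀ x ∈ U, X a a x ∈ U)
    (hX : Rel1 X) :
    ∃ U' ≤ U, U' ≠ ⊥ ∧ (∀ a, ∀ x ∈ U', X a a x ∈ U') ∧ ∃ ν : Fin N → ℂ, ∀ a ∈ s, ∀ x ∈ U',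
      X a a x = ν a • x := by
  induction s using Finset.induction_on with
  | empty => exact ⟨U, le_rfl, hU, hst, 0, by simp⟩
  | insert b s hb ih =>
    obtain ⟨U', h1, h2, h3, ν, h4⟩ := ih
    have : Nontrivial U' := Submodule.nontrivial_iff_ne_bot.mpr h2
    obtain ⟨θ, hθ⟩ := Module.End.exists_eigenvalue ((X b b).restrict (h3 b))
    obtain ⟨x, hx⟩ := hθ.exists_hasEigenvector
    refine ⟨U' ⊓ LinearMap.ker (X b b - θ • (1 : Module.End ℂ A)), inf_le_left.trans h1, ?_, ?_,
      Function.update ν b θ, ?_⟩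
    · intro hbot
      apply hx.2
      have hm : (x : A) ∈ U' ⊓ LinearMap.ker (X b b - θ • (1 : Module.End ℂ A)) := by
        refine ⟨x.2, ?_⟩
        have := congrArg Subtype.val hx.apply_eq_smul
        rw [SetLike.mem_coe, LinearMap.mem_ker, LinearMap.sub_apply, sub_eq_zero]
        exact this
      rw [hbot, Submodule.mem_bot] at hm
      exact Subtype.ext hm
    · intro a y hy
      refine ⟨h3 a y hy.1, ?_⟩
      have hy2 : X b b y = θ • y := by
        have := hy.2
        rwa [SetLike.mem_coe, LinearMap.mem_ker, LinearMap.sub_apply, sub_eq_zero] at this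
      rw [SetLike.mem_coe, LinearMap.mem_ker, LinearMap.sub_apply, sub_eq_zero, hX.app, hy2]
      by_cases h : a = b
      · subst h; simp
      · simp [h, Ne.symm h]
    · intro a ha y hy
      by_cases h : a = b
      · subst h
        rw [Function.update_self]
        have := hy.2
        rwa [SetLike.mem_coe, LinearMap.mem_ker, LinearMap.sub_apply, sub_eq_zero] at this
      · rw [Function.update_of_ne h]
        exact h4 a (Finset.mem_of_mem_insert_of_ne ha h) y hy.1

theorem sing_exists (X : Fin N → Fin N → Module.End ℂ A) [FiniteDimensional ℂ A]
    (hX : Rel1 X) (W : Submodule ℂ A) (hW : W ≠ ⊥) (hst : ∀ a b, ∀ x ∈ W, X a b x ∈ W) :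
    ∃ x ∈ W, x ≠ 0 ∧ (∀ a b, a < b → X a b x = 0) ∧ ∃ ν : Fin N → ℂ, ∀ a, X a a x = ν a • x := by
  set H : Module.End ℂ A := ∑ a : Fin N, (-((a : ℕ) : ℂ)) • X a a with hH
  have hHst : ∀ x ∈ W, H x ∈ W := by
    intro x hx
    rw [hH, LinearMap.sum_apply]
    exact Submodule.sum_mem _ fun a _ => Submodule.smul_mem _ _ (hst a a x hx)
  have hHc : ∀ a b x, H (X a b x) = X a b (H x) + (((b : ℕ) : ℂ) - ((a : ℕ) : ℂ)) • X a b x := by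
    intro a b x
    simp only [hH, LinearMap.sum_apply, LinearMap.smul_apply, hX.app _ _ a b x, map_sum, map_smul,
      smul_add, smul_sub, Finset.sum_add_distrib, Finset.sum_sub_distrib, ite_smul, one_smul, smul_ite, smul_zero,
       zero_smul, Finset.sum_ite_eq, Finset.sum_ite_eq', Finset.mem_univ, if_true]
    congr 1
    rw [sub_smul, neg_smul, neg_smul]; abel
  have : Nontrivial W := Submodule.nontrivial_iff_ne_bot.mpr hW
  set H' : Module.End ℂ W := H.restrict hHst with hH'
  have hne : {μ | H'.HasEigenvalue μ}.Nonempty := Module.End.exists_eigenvalue H'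
  obtain ⟨θ, hθ, hmax⟩ := Set.exists_max_image _ Complex.re (Module.End.finite_hasEigenvalue H') hne
  obtain ⟨x0, hx0⟩ := Module.End.HasEigenvalue.exists_hasEigenvector hθ
  let U : Submodule ℂ A := W ⊓ ⨅ a, ⨅ b, ⨅ _ : a < b, LinearMap.ker (X a b)
  have hU : ∀ x, x ∈ U ↔ x ∈ W ∧ ∀ a b, a < b → X a b x = 0 := by
    intro x; simp [U, Submodule.mem_iInf]
  have hx0U : (x0 : A) ∈ U := by
    rw [hU]
    refine ⟨x0.2, fun a b hab => ?_⟩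
    by_contra hne
    have he : H'.HasEigenvector (θ + (((b : ℕ) : ℂ) - ((a : ℕ) : ℂ))) ⟨X a b x0, hst a b _ x0.2⟩ := by
      refine ⟨Module.End.mem_eigenspace_iff.mpr ?_, fun h => hne (congrArg Subtype.val h)⟩
      apply Subtype.ext
      have h1 : H x0 = θ • (x0 : A) := congrArg Subtype.val hx0.apply_eq_smul
      change H (X a b x0) = (θ + (((b : ℕ) : ℂ) - ((a : ℕ) : ℂ))) • X a b x0
      rw [hHc, h1, map_smul, add_smul]
    have h2 := hmax _ (Module.End.hasEigenvalue_of_hasEigenvector he)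
    simp only [Complex.add_re, Complex.sub_re, Complex.natCast_re] at h2
    have h3 : ((a : ℕ) : ℝ) < ((b : ℕ) : ℝ) := by exact_mod_cast hab
    linarith
  have hUne : U ≠ ⊥ := by
    intro h
    rw [h, Submodule.mem_bot] at hx0U
    exact hx0.2 (Subtype.ext hx0U)
  obtain ⟨U', h1, h2, h3, ν, h4⟩ := common_eig X Finset.univ U hUne (by
    intro c x hx
    rw [hU] at hx ⊢
    refine ⟨hst c c x hx.1, fun a b hab => ?_⟩
    rw [hX.app, hx.2 a b hab, map_zero]
    by_cases hbc : b = c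
    · subst hbc
      simp [hx.2 a b hab, hab.ne']
    · by_cases hca : c = a
      · subst hca; simp [hbc, hx.2 c b hab]
      · simp [hbc, hca]) hX
  obtain ⟨x, hx, hxne⟩ := Submodule.exists_mem_ne_zero_of_ne_bot h2
  exact ⟨x, ((hU x).mp (h1 hx)).1, hxne, ((hU x).mp (h1 hx)).2, ν, fun a => h4 a (Finset.mem_univ a) x hx⟩

theorem sing_dom (X : Fin N → Fin N → Module.End ℂ A) [FiniteDimensional ℂ A]
    (hX : Rel1 X) (x : A) (hx : x ≠ 0) (hup : ∀ a b, a < b → X a b x = 0) (μ : Fin N → ℤ)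
    (hdiag : ∀ a, X a a x = (μ a : ℂ) • x) (a b : Fin N) (hab : a < b) : μ b ≤ μ a := by
  have hh : (X a a - X b b) x = ((μ a : ℂ) - (μ b : ℂ)) • x := by
    rw [LinearMap.sub_apply, hdiag, hdiag, sub_smul]
  by_cases h0 : X a a - X b b = 0
  · rw [h0, LinearMap.zero_apply] at hh
    have := (smul_eq_zero.mp hh.symm).resolve_right hx
    rw [sub_eq_zero] at this
    exact le_of_eq (by exact_mod_cast this.symm)
  · letI : LieRing (Module.End ℂ A) := LieRing.ofAssociativeRing
    have t : IsSl2Triple (X a a - X b b) (X a b) (X b a) := by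
      refine ⟨h0, ?_, ?_, ?_⟩
      · rw [Ring.lie_def, hX]; simp
      · rw [Ring.lie_def, sub_mul, mul_sub]
        have e1 := hX a a a b
        have e2 := hX b b a b
        rw [if_pos rfl, if_neg hab.ne', one_smul, zero_smul, sub_zero] at e1
        rw [if_neg hab.ne', if_pos rfl, one_smul, zero_smul, zero_sub] at e2
        have : X a a * X a b - X b b * X a b - (X a b * X a a - X a b * X b b) =
          (X a a * X a b - X a b * X a a) - (X b b * X a b - X a b * X b b) := by abel
        rw [this, e1, e2, two_smul]; abel
      · rw [Ring.lie_def, sub_mul, mul_sub]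
        have e1 := hX a a b a
        have e2 := hX b b b a
        rw [if_neg hab.ne, if_pos rfl, one_smul, zero_smul, zero_sub] at e1
        rw [if_pos rfl, if_neg hab.ne, one_smul, zero_smul, sub_zero] at e2
        have : X a a * X b a - X b b * X b a - (X b a * X a a - X b a * X b b) =
          (X a a * X b a - X b a * X a a) - (X b b * X b a - X b a * X b b) := by abel
        rw [this, e1, e2, two_smul]; abel
    have P : t.HasPrimitiveVectorWith x ((μ a : ℂ) - (μ b : ℂ)) :=
      ⟨hx, hh, hup a b hab⟩
    obtain ⟨n, hn⟩ := P.exists_nat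
    have : μ a - μ b = (n : ℤ) := by exact_mod_cast hn
    omega

theorem hw_irred (X : Fin N → Fin N → Module.End ℂ A) [FiniteDimensional ℂ A]
    (hX : Rel1 X) (v : A) (Λ : Fin N → ℤ) (hdom : ∀ a b, a ≤ b → Λ b ≤ Λ a)
    (hup : ∀ a b, a < b → X a b v = 0) (hdiag : ∀ a, X a a v = (Λ a : ℂ) • v)
    (C : Submodule ℂ A) (hC : ∀ S : Submodule ℂ A, v ∈ S → (∀ a b, ∀ x ∈ S, X a b x ∈ S) → C ≤ S)
    (W : Submodule ℂ A) (hWC : W ≤ C) (hst : ∀ a b, ∀ x ∈ W, X a b x ∈ W) (hvW : v ∉ W) :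
    W = ⊥ := by
  by_contra hW
  obtain ⟨x, hxW, hx0, hxup, ν, hν⟩ := sing_exists X hX W hW hst
  set c : (Fin N → ℂ) → ℂ := fun ν => ∑ a, ν a * (ν a + ((N : ℂ) - 1 - 2 * ((a : ℕ) : ℂ))) with hc
  -- Casimir
  have hcas : c ν = c (fun a => (Λ a : ℂ)) := by
    have h1 : C ≤ LinearMap.ker (Cas X - c (fun a => (Λ a : ℂ)) • (1 : Module.End ℂ A)) := by
      apply hC
      · rw [LinearMap.mem_ker, LinearMap.sub_apply, sub_eq_zero]
        exact Cas_sing X hX v _ hup hdiag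
      · intro a b y hy
        rw [LinearMap.mem_ker, LinearMap.sub_apply, sub_eq_zero] at hy ⊢
        have := LinearMap.congr_fun (Cas_comm X hX a b) y
        rw [Module.End.mul_apply, Module.End.mul_apply, hy] at this
        rw [this]
        simp
    have h2 := h1 (hWC hxW)
    rw [LinearMap.mem_ker, LinearMap.sub_apply, sub_eq_zero, Cas_sing X hX x ν hxup hν] at h2
    exact smul_left_injective ℂ hx0 h2
  -- weights
  set R : Submodule ℂ A := Submodule.span ℂ {v} ⊔ ⨆ μ : {μ // Low Λ μ}, WS X (fun a => ((μ.1 a : ℤ) : ℂ))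
    with hR
  have hvR : v ∈ R := Submodule.mem_sup_left (Submodule.mem_span_singleton_self v)
  have hRlow : ∀ c d, d < c → ∀ y ∈ R, X c d y ∈ R := by
    intro c d hcd
    change R ≤ R.comap (X c d)
    rw [hR]
    refine sup_le ?_ (iSup_le ?_)
    · rw [Submodule.span_singleton_le_iff_mem, Submodule.mem_comap]
      refine Submodule.mem_sup_right (Submodule.mem_iSup_of_mem ⟨_, Low.base c d hcd⟩ ?_)
      exact WS_lower hX Λ c d (mem_WS.mpr hdiag)
    · rintro ⟨μ, hμ⟩ y hy
      rw [Submodule.mem_comap]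
      refine Submodule.mem_sup_right (Submodule.mem_iSup_of_mem ⟨_, Low.step μ c d hcd hμ⟩ ?_)
      exact WS_lower hX μ c d hy
  obtain ⟨S, hS1, hS2, hS3⟩ := lower_closure X hX v _ hup hdiag R hvR hRlow
  have hxR : x ∈ R := hS1 (hC S hS2 hS3 (hWC hxW))
  have hind := WS_indep X hX
  have hxν : x ∈ WS X ν := mem_WS.mpr hν
  by_cases hlow : ∃ μ, Low Λ μ ∧ ν = fun a => ((μ a : ℤ) : ℂ)
  · obtain ⟨μ, hμ, rfl⟩ := hlow
    have hμdom := sing_dom X hX x hx0 hxup μ hν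
    have h1 := low_pos hμ (fun a => Λ a + μ a + ((N : ℤ) - 1 - 2 * ((a : ℕ) : ℤ))) (by
      intro a b hab
      have e1 := hdom a b hab.le
      have e2 := hμdom a b hab
      have e3 : (a : ℕ) < (b : ℕ) := hab
      omega)
    have h2 : ∑ a, (Λ a + μ a + ((N : ℤ) - 1 - 2 * ((a : ℕ) : ℤ))) * (Λ a - μ a) =
      ∑ a, Λ a * (Λ a + ((N : ℤ) - 1 - 2 * ((a : ℕ) : ℤ))) -
      ∑ a, μ a * (μ a + ((N : ℤ) - 1 - 2 * ((a : ℕ) : ℤ))) := by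
      rw [← Finset.sum_sub_distrib]
      refine Finset.sum_congr rfl fun a _ => ?_
      ring
    have h3 : ∑ a, μ a * (μ a + ((N : ℤ) - 1 - 2 * ((a : ℕ) : ℤ))) =
        ∑ a, Λ a * (Λ a + ((N : ℤ) - 1 - 2 * ((a : ℕ) : ℤ))) := by
      simp only [hc] at hcas
      exact_mod_cast hcas
    rw [h2, h3, sub_self] at h1
    exact lt_irrefl _ h1
  · push Not at hlow
    have hle : (⨆ μ : {μ // Low Λ μ}, WS X (fun a => ((μ.1 a : ℤ) : ℂ))) ≤
        ⨆ (χ) (_ : χ ≠ ν), WS X χ := by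
      refine iSup_le fun μ => ?_
      exact le_iSup₂_of_le (fun a => ((μ.1 a : ℤ) : ℂ)) (hlow μ.1 μ.2).symm le_rfl
    have hdis := hind ν
    rw [hR, Submodule.mem_sup] at hxR
    obtain ⟨y, hy, r, hr, hxy⟩ := hxR
    obtain ⟨s, rfl⟩ := Submodule.mem_span_singleton.mp hy
    have hvΛ : v ∈ WS X (fun a => (Λ a : ℂ)) := mem_WS.mpr hdiag
    by_cases hνΛ : ν = fun a => (Λ a : ℂ)
    · have hr0 : r = 0 := by
        refine (Submodule.disjoint_def.mp hdis) r ?_ (hle hr)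
        rw [← eq_sub_iff_add_eq'] at hxy
        rw [hxy]
        refine sub_mem hxν (Submodule.smul_mem _ _ ?_)
        rw [hνΛ]; exact hvΛ
      rw [hr0, add_zero] at hxy
      have hs : s ≠ 0 := by rintro rfl; apply hx0; rw [← hxy, zero_smul]
      apply hvW
      rw [← inv_smul_smul₀ hs v, hxy]
      exact Submodule.smul_mem _ _ hxW
    · apply hx0
      refine (Submodule.disjoint_def.mp hdis) x hxν ?_
      rw [← hxy]
      refine add_mem (Submodule.smul_mem _ _ ?_) (hle hr)
      exact Submodule.mem_iSup_of_mem _ (Submodule.mem_iSup_of_mem (Ne.symm hνΛ) hvΛ)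

end HWT

end GaudinModel

set_option linter.unusedSectionVars false
set_option linter.unusedSimpArgs false
namespace GaudinModel

section TV
variable {N : ℕ} {J : Type*} [Fintype J] [DecidableEq J]

theorem tv_comm (j l : J) (a b c d : Fin N) :
    tv j a b * tv l c d - tv l c d * tv j a b = if j = l then
      (if b = c then (1 : ℂ) else 0) • tv j a d - (if d = a then (1 : ℂ) else 0) • tv j c b else 0 := by
  have same : ∀ (a b c d : Fin N) (v : (J → Fin N) → ℂ), tv j a b (tv j c d v) =
      (if b = c then (1 : ℂ) else 0) • tv j a d v := by
    intro a b c d v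
    funext x
    simp only [tv_apply, Pi.smul_apply, Function.update_self, Function.update_idem]
    split_ifs <;> simp
  refine LinearMap.ext fun v => ?_
  by_cases h : j = l
  · subst h
    rw [if_pos rfl]
    simp only [LinearMap.sub_apply, Module.End.mul_apply, LinearMap.smul_apply]
    rw [same, same]
  · rw [if_neg h]
    simp only [LinearMap.sub_apply, Module.End.mul_apply, LinearMap.zero_apply]
    rw [sub_eq_zero]
    funext x
    simp only [tv_apply, Function.update_of_ne h, Function.update_of_ne (Ne.symm h)]
    rw [Function.update_comm h]
    split_ifs <;> rfl

/-- total action on the tensor power -/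
def tS (J : Type*) [Fintype J] [DecidableEq J] (a b : Fin N) : Module.End ℂ ((J → Fin N) → ℂ) :=
  ∑ j : J, tv j a b

theorem tS_rel : Rel1 (fun a b : Fin N => tS J a b) := by
  intro a b c d
  beta_reduce
  unfold tS
  rw [Finset.sum_mul_sum, Finset.sum_mul_sum, Finset.sum_comm (f := fun i j => tv i c d * tv j a b),
    ← Finset.sum_sub_distrib]
  simp only [← Finset.sum_sub_distrib, tv_comm]
  simp only [Finset.sum_ite_eq, Finset.mem_univ, if_true, Finset.sum_sub_distrib, Finset.smul_sum]

theorem tS_apply (a b : Fin N) (w : (J → Fin N) → ℂ) (c : J → Fin N) :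
    tS J a b w c = ∑ j, if c j = a then w (Function.update c j b) else 0 := by
  simp only [tS, LinearMap.sum_apply, Finset.sum_apply, tv_apply]

end TV

/-- existence of a highest weight vector in a tensor power -/
def HasHW {N : ℕ} (Λ : Fin N → ℤ) : Prop :=
  ∃ (J : Type) (_ : Fintype J) (_ : DecidableEq J) (w : (J → Fin N) → ℂ), w ≠ 0 ∧
    (∀ a b : Fin N, a < b → tS J a b w = 0) ∧ ∀ a : Fin N, tS J a a w = (Λ a : ℂ) • w

theorem hasHW_add {N : ℕ} {Λ Λ' : Fin N → ℤ} (h : HasHW Λ) (h' : HasHW Λ') : HasHW (Λ + Λ') := by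
  obtain ⟨J, i1, i2, w, hw, hu, hd⟩ := h
  obtain ⟨J', i1', i2', w', hw', hu', hd'⟩ := h'
  set W : ((J ⊕ J') → Fin N) → ℂ := fun c => w (c ∘ Sum.inl) * w' (c ∘ Sum.inr) with hW
  have key : ∀ (a b : Fin N) c, tS (J ⊕ J') a b W c = tS J a b w (c ∘ Sum.inl) * w' (c ∘ Sum.inr) +
      w (c ∘ Sum.inl) * tS J' a b w' (c ∘ Sum.inr) := by
    intro a b c
    rw [tS_apply, tS_apply, tS_apply, Fintype.sum_sum_type, Finset.sum_mul, Finset.mul_sum]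
    simp only [hW, Function.comp_apply, Sum.update_inl_comp_inl, Sum.update_inl_comp_inr,
      Sum.update_inr_comp_inl, Sum.update_inr_comp_inr, ite_mul, mul_ite, zero_mul, mul_zero]
  refine ⟨J ⊕ J', inferInstance, inferInstance, W, ?_, ?_, ?_⟩
  · obtain ⟨c, hc⟩ := Function.ne_iff.mp hw
    obtain ⟨c', hc'⟩ := Function.ne_iff.mp hw'
    intro h0
    have := congrFun h0 (Sum.elim c c')
    simp only [hW, Sum.elim_comp_inl, Sum.elim_comp_inr, Pi.zero_apply, mul_eq_zero] at this
    exact this.elim hc hc'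
  · intro a b hab
    funext c
    rw [key, hu a b hab, hu' a b hab]; simp
  · intro a
    funext c
    rw [key, hd, hd']
    simp only [Pi.smul_apply, smul_eq_mul, hW, Pi.add_apply, Int.cast_add]
    ring

theorem hasHW_fund {N : ℕ} (h : ℕ) (hN : h ≤ N) : HasHW (fun a : Fin N => if (a : ℕ) < h then 1 else 0) := by
  set A : (Fin h → Fin N) → Matrix (Fin h) (Fin h) ℂ := fun c => Matrix.of fun i j =>
    if c i = Fin.castLE hN j then 1 else 0 with hA
  have hup : ∀ c j (b : Fin h), A (Function.update c j (Fin.castLE hN b)) =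
      (A c).updateRow j (Pi.single b 1) := by
    intro c j b
    ext i k
    by_cases hij : i = j
    · subst hij
      simp only [hA, Matrix.of_apply, Function.update_self, Matrix.updateRow_self, Pi.single_apply,
        Fin.castLE_inj, eq_comm]
    · simp [hA, Matrix.of_apply, Function.update_of_ne hij, Matrix.updateRow_ne hij]
  have hzero : ∀ c j (b : Fin N), h ≤ (b : ℕ) → c j = b → (A c).det = 0 := by
    intro c j b hb hc
    refine Matrix.det_eq_zero_of_row_eq_zero j fun k => ?_
    simp only [hA, Matrix.of_apply, hc]
    rw [if_neg]
    intro he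
    have := congrArg Fin.val he
    simp at this
    omega
  have key : ∀ (a b : Fin N), a ≤ b → ∀ c, tS (Fin h) a b (fun c => (A c).det) c =
      if a = b ∧ (b : ℕ) < h then (A c).det else 0 := by
    intro a b hab c
    rw [tS_apply]
    by_cases hb : (b : ℕ) < h
    · have ha : (a : ℕ) < h := lt_of_le_of_lt (by exact_mod_cast hab) hb
      have ea : a = Fin.castLE hN ⟨a, ha⟩ := by ext; simp
      have eb : b = Fin.castLE hN ⟨b, hb⟩ := by ext; simp
      have e : ∀ j, (if c j = a then (A (Function.update c j b)).det else 0) =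
          (A c).adjugate ⟨b, hb⟩ j * A c j ⟨a, ha⟩ := by
        intro j
        conv_lhs => rw [eb, hup, ← Matrix.adjugate_apply]
        simp only [hA, Matrix.of_apply, ← ea, mul_ite, mul_one, mul_zero]
      rw [Finset.sum_congr rfl fun j _ => e j, ← Matrix.mul_apply, Matrix.adjugate_mul]
      simp only [Matrix.smul_apply, Matrix.one_apply, smul_eq_mul, mul_ite, mul_one, mul_zero, hb,
        and_true, Fin.mk.injEq, Fin.ext_iff, eq_comm]
    · rw [if_neg (by tauto)]
      refine Finset.sum_eq_zero fun j _ => ?_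
      rw [hzero _ j b (not_lt.mp hb) (by simp)]
      simp
  refine ⟨Fin h, inferInstance, inferInstance, fun c => (A c).det, ?_, ?_, ?_⟩
  · intro h0
    have := congrFun h0 (Fin.castLE hN)
    have e : A (Fin.castLE hN) = 1 := by
      ext i j
      simp [hA, Matrix.one_apply]
    simp [e] at this
  · intro a b hab
    funext c
    rw [key a b hab.le, if_neg]; · rfl
    exact fun h => hab.ne h.1
  · intro a
    funext c
    rw [key a a le_rfl]
    simp

theorem hasHW_all {N : ℕ} (k : ℕ) : ∀ (Λ : Fin N → ℤ), (∀ a b, a ≤ b → Λ b ≤ Λ a) → (∀ a, 0 ≤ Λ a) →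
    (∀ a, Λ a ≤ k) → HasHW Λ := by
  induction k with
  | zero =>
    intro Λ hd h0 hk
    have : Λ = fun a : Fin N => if (a : ℕ) < 0 then 1 else 0 := by
      funext a
      have := h0 a
      have := hk a
      simp at *
      omega
    rw [this]
    exact hasHW_fund 0 (Nat.zero_le _)
  | succ k ih =>
    intro Λ hd h0 hk
    have hex : ∃ h, h ≤ N ∧ ∀ a : Fin N, 0 < Λ a ↔ (a : ℕ) < h := by
      classical
      have hP : ∃ h : ℕ, N ≤ h ∨ ∃ hh : h < N, Λ ⟨h, hh⟩ ≤ 0 := ⟨N, Or.inl le_rfl⟩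
      refine ⟨Nat.find hP, Nat.find_min' hP (Or.inl le_rfl), fun a => ⟨fun ha => ?_, fun ha => ?_⟩⟩
      · by_contra hlt
        push Not at hlt
        rcases Nat.find_spec hP with h1 | ⟨h1, h2⟩
        · have := a.2; omega
        · have := hd ⟨Nat.find hP, h1⟩ a hlt
          omega
      · have := Nat.find_min hP ha
        push Not at this
        exact this.2 a.2
    obtain ⟨h, hN, hh⟩ := hex
    have e : Λ = (fun a => if 0 < Λ a then Λ a - 1 else 0) +
        (fun a : Fin N => if (a : ℕ) < h then 1 else 0) := by
      funext a
      simp only [Pi.add_apply, ← hh a]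
      have := h0 a
      split_ifs <;> omega
    rw [e]
    refine hasHW_add (ih _ ?_ ?_ ?_) (hasHW_fund h hN)
    · intro a b hab
      have := hd a b hab
      have := h0 a
      have := h0 b
      split_ifs <;> omega
    · intro a
      have := h0 a
      split_ifs <;> omega
    · intro a
      have := hk a
      push_cast at this
      split_ifs <;> omega

theorem hasHW_dom {N : ℕ} (Λ : Fin N → ℤ) (hd : ∀ a b, a ≤ b → Λ b ≤ Λ a) (h0 : ∀ a, 0 ≤ Λ a) :
    HasHW Λ := by
  refine hasHW_all (∑ a, Λ a).toNat Λ hd h0 fun a => ?_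
  have := Finset.single_le_sum (f := Λ) (fun i _ => h0 i) (Finset.mem_univ a)
  omega

end GaudinModel

set_option linter.unusedSectionVars false
set_option linter.unusedSimpArgs false
namespace GaudinModel

theorem embed_tensor {N : ℕ} {V : Type*} [AddCommGroup V] [Module ℂ V] [FiniteDimensional ℂ V]
    (X : Fin N → Fin N → Module.End ℂ V) (hX : Rel1 X) (v : V) (hv : v ≠ 0) (Λ : Fin N → ℤ)
    (hdom : ∀ a b, a ≤ b → Λ b ≤ Λ a) (hpos : ∀ a, 0 ≤ Λ a)
    (hup : ∀ a b, a < b → X a b v = 0) (hdiag : ∀ a, X a a v = (Λ a : ℂ) • v)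
    (hcyc : ∀ W : Submodule ℂ V, (∀ a b, ∀ x ∈ W, X a b x ∈ W) → v ∈ W → ∀ x, x ∈ W) :
    ∃ (J : Type) (_ : Fintype J) (_ : DecidableEq J) (g : V →ₗ[ℂ] ((J → Fin N) → ℂ)),
      Function.Injective g ∧ ∀ a b x, g (X a b x) = tS J a b (g x) := by
  obtain ⟨J, i1, i2, w, hw, hwu, hwd⟩ := hasHW_dom Λ hdom hpos
  refine ⟨J, i1, i2, ?_⟩
  let Y : Fin N → Fin N → Module.End ℂ (V × ((J → Fin N) → ℂ)) :=
    fun a b => (X a b).prodMap (tS J a b)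
  have hY1 : ∀ a b p, (Y a b p).1 = X a b p.1 := fun a b p => rfl
  have hY2 : ∀ a b p, (Y a b p).2 = tS J a b p.2 := fun a b p => rfl
  have hY : Rel1 Y := by
    intro a b c d
    refine LinearMap.ext fun p => Prod.ext ?_ ?_
    · have := LinearMap.congr_fun (hX a b c d) p.1
      exact this
    · have := LinearMap.congr_fun (tS_rel (J := J) a b c d) p.2
      exact this
  let C : Submodule ℂ (V × ((J → Fin N) → ℂ)) :=
    sInf {S | (v, w) ∈ S ∧ ∀ a b, ∀ x ∈ S, Y a b x ∈ S}
  have hvC : (v, w) ∈ C := Submodule.mem_sInf.mpr fun S hS => hS.1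
  have hCst : ∀ a b, ∀ x ∈ C, Y a b x ∈ C := by
    intro a b x hx
    rw [Submodule.mem_sInf] at hx ⊢
    exact fun S hS => hS.2 a b x (hx S hS)
  have hCle : ∀ S : Submodule ℂ (V × ((J → Fin N) → ℂ)), (v, w) ∈ S →
      (∀ a b, ∀ x ∈ S, Y a b x ∈ S) → C ≤ S := fun S h1 h2 => sInf_le ⟨h1, h2⟩
  have hYu : ∀ a b, a < b → Y a b (v, w) = 0 := by
    intro a b hab
    exact Prod.ext (hup a b hab) (hwu a b hab)
  have hYd : ∀ a, Y a a (v, w) = (Λ a : ℂ) • (v, w) := by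
    intro a
    exact Prod.ext (hdiag a) (hwd a)
  have k1 : C ⊓ LinearMap.ker (LinearMap.fst ℂ V ((J → Fin N) → ℂ)) = ⊥ := by
    refine hw_irred Y hY (v, w) Λ hdom hYu hYd C hCle _ inf_le_left ?_ ?_
    · intro a b x hx
      refine ⟨hCst a b x hx.1, ?_⟩
      have h2 : x.1 = 0 := hx.2
      change X a b x.1 = 0
      rw [h2, map_zero]
    · intro h
      exact hv h.2
  have k2 : C ⊓ LinearMap.ker (LinearMap.snd ℂ V ((J → Fin N) → ℂ)) = ⊥ := by
    refine hw_irred Y hY (v, w) Λ hdom hYu hYd C hCle _ inf_le_left ?_ ?_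
    · intro a b x hx
      refine ⟨hCst a b x hx.1, ?_⟩
      have h2 : x.2 = 0 := hx.2
      change tS J a b x.2 = 0
      rw [h2, map_zero]
    · intro h
      exact hw h.2
  have inj1 : ∀ x ∈ C, x.1 = 0 → x = 0 := by
    intro x hx h
    have : x ∈ C ⊓ LinearMap.ker (LinearMap.fst ℂ V ((J → Fin N) → ℂ)) := ⟨hx, h⟩
    rwa [k1, Submodule.mem_bot] at this
  have inj2 : ∀ x ∈ C, x.2 = 0 → x = 0 := by
    intro x hx h
    have : x ∈ C ⊓ LinearMap.ker (LinearMap.snd ℂ V ((J → Fin N) → ℂ)) := ⟨hx, h⟩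
    rwa [k2, Submodule.mem_bot] at this
  have surj : ∀ x : V, ∃ y ∈ C, y.1 = x := by
    intro x
    have := hcyc (C.map (LinearMap.fst ℂ V ((J → Fin N) → ℂ))) (by
      rintro a b _ ⟨y, hy, rfl⟩
      exact ⟨Y a b y, hCst a b y hy, rfl⟩) ⟨(v, w), hvC, rfl⟩ x
    obtain ⟨y, hy, h⟩ := this
    exact ⟨y, hy, h⟩
  let p : C →ₗ[ℂ] V := (LinearMap.fst ℂ V ((J → Fin N) → ℂ)) ∘ₗ C.subtype
  have hp : Function.Bijective p := by
    refine ⟨?_, ?_⟩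
    · rw [injective_iff_map_eq_zero]
      intro x hx
      exact Subtype.ext (inj1 x.1 x.2 hx)
    · intro x
      obtain ⟨y, hy, h⟩ := surj x
      exact ⟨⟨y, hy⟩, h⟩
  let e := LinearEquiv.ofBijective p hp
  have he : ∀ x, ((e.symm x : C) : V × ((J → Fin N) → ℂ)).1 = x := fun x => e.apply_symm_apply x
  refine ⟨(LinearMap.snd ℂ V ((J → Fin N) → ℂ)) ∘ₗ C.subtype ∘ₗ e.symm.toLinearMap, ?_, ?_⟩
  · rw [injective_iff_map_eq_zero]
    intro x hx
    have h0 := inj2 (e.symm x : C).1 (e.symm x : C).2 hx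
    rw [← he x, h0]; rfl
  · intro a b x
    have : e.symm (X a b x) = ⟨Y a b (e.symm x : C), hCst a b _ (e.symm x : C).2⟩ := by
      rw [LinearEquiv.symm_apply_eq]
      change X a b x = X a b ((e.symm x : C) : V × ((J → Fin N) → ℂ)).1
      rw [he]
    change ((e.symm (X a b x) : C) : V × ((J → Fin N) → ℂ)).2 = _
    rw [this]
    rfl

end GaudinModel

set_option linter.unusedSectionVars false
set_option linter.unusedSimpArgs false
namespace GaudinModel

section PT
variable {N n : ℕ} (V : Fin n → Type*) [∀ i, AddCommGroup (V i)] [∀ i, Module ℂ (V i)]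
  (J : Fin n → Type) [∀ i, Fintype (J i)] [∀ i, DecidableEq (J i)]
  (g : ∀ i, V i →ₗ[ℂ] ((J i → Fin N) → ℂ))

/-- tensor product of the embeddings -/
def ptj : PiTensorProduct ℂ V →ₗ[ℂ] (((Σ i, J i) → Fin N) → ℂ) :=
  LinearMap.pi fun c => PiTensorProduct.lift
    ((MultilinearMap.mkPiAlgebra ℂ (Fin n) ℂ).compLinearMap
      fun i => (LinearMap.proj (fun l => c ⟨i, l⟩)) ∘ₗ g i)

theorem ptj_tprod (x : ∀ i, V i) (c : (Σ i, J i) → Fin N) :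
    ptj V J g (PiTensorProduct.tprod ℂ x) c = ∏ i, g i (x i) (fun l => c ⟨i, l⟩) := by
  simp [ptj]

theorem ptj_inj (hg : ∀ i, Function.Injective (g i)) : Function.Injective (ptj V J g) := by
  have : ∀ i, ∃ r : ((J i → Fin N) → ℂ) →ₗ[ℂ] V i, r ∘ₗ g i = LinearMap.id := fun i =>
    LinearMap.exists_leftInverse_of_injective (g i) (LinearMap.ker_eq_bot.mpr (hg i))
  choose r hr using this
  let G : (((Σ i, J i) → Fin N) → ℂ) →ₗ[ℂ] PiTensorProduct ℂ V :=
    ∑ c : (Σ i, J i) → Fin N, (LinearMap.toSpanSingleton ℂ (PiTensorProduct ℂ V)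
      (PiTensorProduct.tprod ℂ fun i => r i (Pi.single (fun l => c ⟨i, l⟩) 1))) ∘ₗ
      (LinearMap.proj c : (((Σ i, J i) → Fin N) → ℂ) →ₗ[ℂ] ℂ)
  have hG : G ∘ₗ ptj V J g = LinearMap.id := by
    refine PiTensorProduct.ext (MultilinearMap.ext fun x => ?_)
    simp only [LinearMap.compMultilinearMap_apply, LinearMap.comp_apply, LinearMap.id_apply, G,
      LinearMap.sum_apply, LinearMap.proj_apply, LinearMap.toSpanSingleton_apply, ptj_tprod]
    have e : ∀ i, x i = ∑ d : J i → Fin N, g i (x i) d • r i (Pi.single d 1) := by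
      intro i
      conv_lhs => rw [← LinearMap.id_apply (R := ℂ) (x i), ← hr i, LinearMap.comp_apply,
        pi_eq_sum_univ' (g i (x i)), map_sum]
      refine Finset.sum_congr rfl fun d _ => ?_
      rw [map_smul]
    conv_rhs => rw [show x = fun i => ∑ d : J i → Fin N, g i (x i) d • r i (Pi.single d 1) from funext e,
      MultilinearMap.map_sum]
    rw [← (Equiv.piCurry (fun (i : Fin n) (_ : J i) => Fin N)).sum_comp]
    refine Finset.sum_congr rfl fun c _ => ?_
    rw [MultilinearMap.map_smul_univ]
    rfl
  intro s t h
  rw [← LinearMap.id_apply (R := ℂ) s, ← LinearMap.id_apply (R := ℂ) t, ← hG, LinearMap.comp_apply,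
    LinearMap.comp_apply, h]

theorem ptj_map (X : ∀ i, Fin N → Fin N → Module.End ℂ (V i))
    (hg : ∀ i a b x, g i (X i a b x) = tS (J i) a b (g i x)) (k : Fin n) (a b : Fin N)
    (t : PiTensorProduct ℂ V) :
    ptj V J g (PiTensorProduct.map
      (Function.update (fun i : Fin n => (LinearMap.id : V i →ₗ[ℂ] V i)) k (X k a b)) t) =
    ∑ l : J k, tv (⟨k, l⟩ : Σ i, J i) a b (ptj V J g t) := by
  have : ptj V J g ∘ₗ (PiTensorProduct.map
      (Function.update (fun i : Fin n => (LinearMap.id : V i →ₗ[ℂ] V i)) k (X k a b))) =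
      (∑ l : J k, tv (⟨k, l⟩ : Σ i, J i) a b) ∘ₗ ptj V J g := by
    refine PiTensorProduct.ext (MultilinearMap.ext fun x => ?_)
    funext c
    simp only [LinearMap.compMultilinearMap_apply, LinearMap.comp_apply, PiTensorProduct.map_tprod,
      ptj_tprod, LinearMap.sum_apply, Finset.sum_apply, tv_apply]
    rw [← Finset.mul_prod_erase _ _ (Finset.mem_univ k), Function.update_self, hg, tS_apply,
      Finset.sum_mul]
    refine Finset.sum_congr rfl fun l _ => ?_
    rw [← Finset.mul_prod_erase Finset.univ (fun i => g i (x i)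
      (fun l' => Function.update c ⟨k, l⟩ b ⟨i, l'⟩)) (Finset.mem_univ k)]
    have e1 : (fun l' => Function.update c ⟨k, l⟩ b ⟨k, l'⟩) =
        Function.update (fun l => c ⟨k, l⟩) l b := by
      funext l'
      by_cases h : l' = l
      · subst h; simp
      · rw [Function.update_of_ne h, Function.update_of_ne]
        intro h'; exact h (by simpa using h')
    have e2 : ∏ i ∈ Finset.univ.erase k, g i (x i) (fun l' => Function.update c ⟨k, l⟩ b ⟨i, l'⟩) =
        ∏ i ∈ Finset.univ.erase k, g i ((Function.update (fun i : Fin n =>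
          (LinearMap.id : V i →ₗ[ℂ] V i)) k (X k a b) i) (x i)) (fun l => c ⟨i, l⟩) := by
      refine Finset.prod_congr rfl fun i hi => ?_
      have hik := Finset.ne_of_mem_erase hi
      rw [Function.update_of_ne hik, LinearMap.id_apply]
      refine congrArg _ (funext fun l' => ?_)
      rw [Function.update_of_ne]
      intro h'; exact hik (congrArg Sigma.fst h')
    rw [e1, e2]
    split_ifs <;> simp
  have h2 := LinearMap.congr_fun this t
  simp only [LinearMap.comp_apply, LinearMap.sum_apply] at h2
  exact h2

end PT

theorem embed_M {N n : ℕ} (V : Fin n → Type*) [∀ i, AddCommGroup (V i)] [∀ i, Module ℂ (V i)]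
    [∀ i, FiniteDimensional ℂ (V i)]
    (M : Type*) [NormedAddCommGroup M] [NormedSpace ℂ M]
    (Λ : Fin n → Fin N → ℤ)
    (hdom : ∀ i, ∀ a b : Fin N, a ≤ b → Λ i b ≤ Λ i a)
    (hpoly : ∀ i a, 0 ≤ Λ i a)
    (E : ∀ i : Fin n, Fin N → Fin N → (V i →ₗ[ℂ] V i))
    (hrel : GlRel V E)
    (hhw : IsHW V E Λ)
    (φ : M ≃ₗ[ℂ] PiTensorProduct ℂ V) :
    ∃ (J : Fin n → Type) (_ : ∀ i, Fintype (J i)) (_ : ∀ i, DecidableEq (J i))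
      (g : M →ₗ[ℂ] (((Σ i, J i) → Fin N) → ℂ)), Function.Injective g ∧
      ∀ k a b m, g (EE V M E φ k a b m) = ∑ l : J k, tv (⟨k, l⟩ : Σ i, J i) a b (g m) := by
  have : ∀ i, ∃ (J : Type) (_ : Fintype J) (_ : DecidableEq J) (g : V i →ₗ[ℂ] ((J → Fin N) → ℂ)),
      Function.Injective g ∧ ∀ a b x, g (E i a b x) = tS J a b (g x) := by
    intro i
    obtain ⟨v, hv, h1, h2, h3⟩ := hhw i
    exact embed_tensor (E i) (hrel i) v hv (Λ i) (hdom i) (hpoly i) h1 h2 h3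
  choose J i1 i2 g hg hg2 using this
  refine ⟨J, i1, i2, ptj V J g ∘ₗ φ.toLinearMap, (ptj_inj V J g hg).comp φ.injective, ?_⟩
  intro k a b m
  simp only [LinearMap.comp_apply, EE, LinearEquiv.coe_coe, LinearEquiv.apply_symm_apply]
  exact ptj_map V J g E hg2 k a b (φ m)

end GaudinModel

set_option linter.unusedSectionVars false
set_option linter.unusedSimpArgs false
namespace GaudinModel

/-- rectangular constant matrices -/
def fG {ι κ : Type*} [Fintype ι] (G : Matrix κ ι ℂ) :
    (ι → PowerSeries ℂ) →ₗ[ℂ] (κ → PowerSeries ℂ) where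
  toFun f := fun c => ∑ i, G c i • f i
  map_add' f g := by funext i; simp [smul_add, Finset.sum_add_distrib]
  map_smul' c f := by
    funext i
    simp only [Pi.smul_apply, RingHom.id_apply, Finset.smul_sum]
    exact Finset.sum_congr rfl fun k _ => smul_comm _ _ _

theorem fG_apply {ι κ : Type*} [Fintype ι] (G : Matrix κ ι ℂ) (f : ι → PowerSeries ℂ) (c : κ) :
    fG G f c = ∑ i, G c i • f i := rfl

theorem fG_fd {ι κ : Type*} [Fintype ι] (G : Matrix κ ι ℂ) (f : ι → PowerSeries ℂ) :
    fG G (fd ι ℂ f) = fd κ ℂ (fG G f) := by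
  funext c
  simp [fG_apply, map_sum]

theorem fG_fm {ι κ : Type*} [Fintype ι] (G : Matrix κ ι ℂ) (p : PowerSeries ℂ)
    (f : ι → PowerSeries ℂ) :
    fG G (fm p f) = fm p (fG G f) := by
  funext c
  simp [fG_apply, Finset.mul_sum]

theorem fG_fe {ι κ : Type*} [Fintype ι] [Fintype κ] (G : Matrix κ ι ℂ) (m : Matrix ι ι ℂ)
    (f : ι → PowerSeries ℂ) : fG G (fe m f) = fG (G * m) f := by
  funext c
  simp only [fG_apply, fe_apply, Matrix.mul_apply, Finset.sum_smul, Finset.smul_sum, smul_smul]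
  rw [Finset.sum_comm]

theorem fe_fG {ι κ : Type*} [Fintype ι] [Fintype κ] (G : Matrix κ ι ℂ) (m : Matrix κ κ ℂ)
    (f : ι → PowerSeries ℂ) : fe m (fG G f) = fG (m * G) f := by
  funext c
  simp only [fG_apply, fe_apply, Matrix.mul_apply, Finset.sum_smul, Finset.smul_sum, smul_smul]
  rw [Finset.sum_comm]

theorem fG_sum {ι κ τ : Type*} [Fintype ι] (s : Finset τ) (G : τ → Matrix κ ι ℂ)
    (f : ι → PowerSeries ℂ) : fG (∑ t ∈ s, G t) f = ∑ t ∈ s, fG (G t) f := by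
  funext c
  simp only [fG_apply, Finset.sum_apply, Matrix.sum_apply, Finset.sum_smul]
  rw [Finset.sum_comm]

theorem fG_inj {ι κ : Type*} [Fintype ι] (G : Matrix κ ι ℂ) (hG : ∀ v : ι → ℂ, G.mulVec v = 0 → v = 0)
    (f : ι → PowerSeries ℂ) (h : fG G f = 0) : f = 0 := by
  funext i
  ext m
  have h2 := hG (fun i => PowerSeries.coeff m (f i)) (by
    funext c
    have := congrArg (PowerSeries.coeff m) (congrFun h c)
    simpa [fG_apply, Matrix.mulVec, dotProduct, map_sum] using this)
  have := congrFun h2 i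
  simpa using this

theorem fG_aeval {ι κ : Type*} [Fintype ι] (G : Matrix κ ι ℂ) (p : Polynomial ℂ)
    (f : ι → PowerSeries ℂ) :
    fG G (Polynomial.aeval (fd ι ℂ) p f) = Polynomial.aeval (fd κ ℂ) p (fG G f) := by
  have hp : ∀ (k : ℕ) (f : ι → PowerSeries ℂ), fG G ((fd ι ℂ ^ k) f) = (fd κ ℂ ^ k) (fG G f) := by
    intro k
    induction k with
    | zero => intro f; simp
    | succ k ih =>
      intro f
      rw [pow_succ, pow_succ, Module.End.mul_apply, Module.End.mul_apply, ih, fG_fd]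
  rw [Polynomial.aeval_eq_sum_range, Polynomial.aeval_eq_sum_range]
  simp only [LinearMap.sum_apply, LinearMap.smul_apply, map_sum, map_smul, hp]

theorem formal_kill {N n : ℕ} {ι : Type*} [Fintype ι] (J : Fin n → Type) [∀ i, Fintype (J i)]
    [∀ i, DecidableEq (J i)] (y : Fin n → ℂ) (hy : ∀ j, y j ≠ 0)
    (e : Fin n → Fin N → Fin N → Matrix ι ι ℂ) (K : Matrix (Fin N) (Fin N) ℂ)
    (G : Matrix ((Σ i, J i) → Fin N) ι ℂ) (hG : ∀ v : ι → ℂ, G.mulVec v = 0 → v = 0)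
    (hGe : ∀ k a b, G * e k a b = ∑ l : J k, et (⟨k, l⟩ : Σ i, J i) a b * G)
    (f : ι → PowerSeries ℂ) (hf : fD y e K f = 0) :
    Polynomial.aeval (fd ι ℂ) (K.charpoly ^ (2 ^ (Fintype.card (Σ i, J i) + 1))) f = 0 := by
  have h1 : ∀ a b f, fG G (fX y e K a b f) =
      fX (fun p : Σ i, J i => y p.1) (fun j a b => et j a b) K a b (fG G f) := by
    intro a b f
    simp only [fX, LinearMap.sub_apply, map_sub, LinearMap.sum_apply, map_sum, Module.End.mul_apply,
      fG_fm, fG_fe, hGe, fG_sum]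
    rw [Fintype.sum_sigma]
    simp only [← fe_fG]
    congr 1
    congr 1
    split_ifs
    · exact fG_fd G f
    · simp
  have h2 := rdr_intertwine (fG G) _ _ id h1 f
  have h3 : tD (fun p : Σ i, J i => y p.1) K (fG G f) = 0 := by
    refine h2.symm.trans ?_
    change fG G (fD y e K f) = 0
    rw [hf, map_zero]
  have h4 := prop_all (fun p : Σ i, J i => y p.1) (fun p => hy p.1) K (fG G f) h3
    (fun c hc => absurd trivial hc)
  rw [← fG_aeval] at h4
  exact fG_inj G hG _ h4

end GaudinModel

set_option linter.unusedSectionVars false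
set_option linter.unusedSimpArgs false
namespace GaudinModel

/-- Taylor series -/
def tay (u₀ : ℂ) (h : ℂ → ℂ) : PowerSeries ℂ :=
  PowerSeries.mk fun k => iteratedDeriv k h u₀ / (k.factorial : ℂ)

theorem coeff_tay (u₀ : ℂ) (h : ℂ → ℂ) (k : ℕ) :
    PowerSeries.coeff k (tay u₀ h) = iteratedDeriv k h u₀ / (k.factorial : ℂ) := by
  simp [tay]

theorem tay_congr {u₀ : ℂ} {h g : ℂ → ℂ} (e : h =ᶠ[nhds u₀] g) : tay u₀ h = tay u₀ g := by
  ext k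
  rw [coeff_tay, coeff_tay, e.iteratedDeriv_eq k]

theorem tay_deriv (u₀ : ℂ) (h : ℂ → ℂ) : tay u₀ (deriv h) = PowerSeries.derivative ℂ (tay u₀ h) := by
  ext k
  rw [PowerSeries.coeff_derivative, coeff_tay, coeff_tay, ← iteratedDeriv_succ', Nat.factorial_succ]
  have h4 : ((k : ℂ) + 1) ≠ 0 := by exact_mod_cast Nat.succ_ne_zero k
  have h5 : (k.factorial : ℂ) ≠ 0 := by exact_mod_cast Nat.factorial_ne_zero k
  push_cast
  field_simp

theorem tay_sum {u₀ : ℂ} {τ : Type*} (s : Finset τ) (h : τ → ℂ → ℂ)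
    (hh : ∀ t ∈ s, AnalyticAt ℂ (h t) u₀) :
    tay u₀ (fun u => ∑ t ∈ s, h t u) = ∑ t ∈ s, tay u₀ (h t) := by
  ext k
  rw [coeff_tay, map_sum, iteratedDeriv_fun_sum (fun i hi => (hh i hi).contDiffAt), Finset.sum_div]
  simp only [coeff_tay]

theorem tay_add {u₀ : ℂ} {h g : ℂ → ℂ} (hh : AnalyticAt ℂ h u₀) (hg : AnalyticAt ℂ g u₀) :
    tay u₀ (fun u => h u + g u) = tay u₀ h + tay u₀ g := by
  ext k
  rw [coeff_tay, map_add, iteratedDeriv_fun_add hh.contDiffAt hg.contDiffAt, add_div]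
  simp only [coeff_tay]

theorem tay_smul {u₀ : ℂ} {h : ℂ → ℂ} (c : ℂ) :
    tay u₀ (fun u => c * h u) = c • tay u₀ h := by
  ext k
  rw [coeff_tay, iteratedDeriv_const_mul_field, PowerSeries.coeff_smul, coeff_tay, smul_eq_mul,
    mul_div_assoc]

theorem tay_sub {u₀ : ℂ} {h g : ℂ → ℂ} (hh : AnalyticAt ℂ h u₀) (hg : AnalyticAt ℂ g u₀) :
    tay u₀ (fun u => h u - g u) = tay u₀ h - tay u₀ g := by
  have e : (fun u => h u - g u) = fun u => h u + (-1) * g u := by funext u; ring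
  rw [e, tay_add hh (show AnalyticAt ℂ (fun u => (-1) * g u) u₀ from analyticAt_const.mul hg), tay_smul]
  simp [sub_eq_add_neg]

theorem tay_mul {u₀ : ℂ} {h g : ℂ → ℂ} (hh : AnalyticAt ℂ h u₀) (hg : AnalyticAt ℂ g u₀) :
    tay u₀ (fun u => h u * g u) = tay u₀ h * tay u₀ g := by
  ext k
  have := iteratedDeriv_mul (n := k) (x := u₀) (f := h) (g := g) hh.contDiffAt hg.contDiffAt
  rw [coeff_tay, PowerSeries.coeff_mul, Finset.Nat.sum_antidiagonal_eq_sum_range_succ_mk]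
  change iteratedDeriv k (h * g) u₀ / _ = _
  rw [this, Finset.sum_div]
  refine Finset.sum_congr rfl fun i hi => ?_
  have hi' : i ≤ k := by simpa [Nat.lt_succ_iff] using hi
  rw [coeff_tay, coeff_tay, Nat.cast_choose ℂ hi']
  have h5 : ∀ m : ℕ, (m.factorial : ℂ) ≠ 0 := fun m => by exact_mod_cast Nat.factorial_ne_zero m
  have := h5 i
  have := h5 k
  have := h5 (k - i)
  field_simp

theorem tay_const (u₀ c : ℂ) : tay u₀ (fun _ => c) = PowerSeries.C c := by
  ext k
  rw [coeff_tay, iteratedDeriv_const, PowerSeries.coeff_C]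
  split_ifs with h <;> simp [h]

theorem tay_zero (u₀ : ℂ) : tay u₀ (fun _ => 0) = 0 := by
  rw [tay_const, map_zero]

theorem tay_id (u₀ : ℂ) : tay u₀ (fun u => u) = PowerSeries.X + PowerSeries.C u₀ := by
  have h : PowerSeries.derivative ℂ (tay u₀ (fun u => u)) = 1 := by
    rw [← tay_deriv]
    simp [tay_const]
  ext k
  cases k with
  | zero => simp [coeff_tay, PowerSeries.coeff_zero_X]
  | succ k =>
    have h2 := congrArg (PowerSeries.coeff k) h
    rw [PowerSeries.coeff_derivative, PowerSeries.coeff_one] at h2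
    have h4 : ((k : ℂ) + 1) ≠ 0 := by exact_mod_cast Nat.succ_ne_zero k
    rw [map_add, PowerSeries.coeff_X, PowerSeries.coeff_C, if_neg (Nat.succ_ne_zero k), add_zero]
    by_cases hk : k = 0
    · subst hk; simpa using h2
    · rw [if_neg hk] at h2
      rw [if_neg (by omega)]
      exact (mul_eq_zero.mp h2).resolve_right h4

theorem tay_inv (u₀ z : ℂ) (h : u₀ ≠ z) : tay u₀ (fun u => (u - z)⁻¹) = gs ℂ (z - u₀) := by
  have a1 : AnalyticAt ℂ (fun u : ℂ => u - z) u₀ := analyticAt_id.sub analyticAt_const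
  have a2 : AnalyticAt ℂ (fun u : ℂ => (u - z)⁻¹) u₀ := a1.inv (sub_ne_zero.mpr h)
  have h1 : tay u₀ (fun u => u - z) = PowerSeries.X - PowerSeries.C (z - u₀) := by
    rw [tay_sub (h := fun u => u) (g := fun _ => z) analyticAt_id analyticAt_const, tay_const]
    have := tay_id u₀
    rw [this, map_sub]; ring
  have h2 : tay u₀ (fun u => (u - z) * (u - z)⁻¹) = 1 := by
    rw [← map_one (PowerSeries.C (R := ℂ)), ← tay_const u₀ 1]
    apply tay_congr
    filter_upwards [isOpen_ne.mem_nhds h] with u hu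
    exact mul_inv_cancel₀ (sub_ne_zero.mpr hu)
  rw [tay_mul a1 a2, h1] at h2
  have h3 := gs_mul ℂ (z - u₀) (sub_ne_zero.mpr h.symm)
  simp only [Algebra.algebraMap_self, RingHom.id_apply] at h3
  calc _ = tay u₀ (fun u => (u - z)⁻¹) * ((PowerSeries.X - PowerSeries.C (z - u₀)) * gs ℂ (z - u₀)) := by
        rw [h3, mul_one]
    _ = ((PowerSeries.X - PowerSeries.C (z - u₀)) * tay u₀ (fun u => (u - z)⁻¹)) * gs ℂ (z - u₀) := by ring
    _ = _ := by rw [h2, one_mul]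

theorem tay_exp (u₀ l : ℂ) : tay u₀ (fun u => Complex.exp (l * u)) = Complex.exp (l * u₀) • ex l := by
  ext k
  rw [coeff_tay, iteratedDeriv_cexp_const_mul, PowerSeries.coeff_smul]
  simp only [ex, PowerSeries.coeff_mk, smul_eq_mul]
  ring

theorem tay_eq_zero {u₀ : ℂ} {h : ℂ → ℂ} (hh : AnalyticAt ℂ h u₀) (h0 : tay u₀ h = 0) :
    ∀ᶠ u in nhds u₀, h u = 0 := by
  have h1 := hh.hasFPowerSeriesAt
  have h2 : (fun n => iteratedDeriv n h u₀ / (n.factorial : ℂ)) = fun _ => 0 := by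
    funext n
    rw [← coeff_tay, h0, map_zero]
  rw [h2] at h1
  have h3 : FormalMultilinearSeries.ofScalars ℂ (fun _ : ℕ => (0 : ℂ)) = 0 := by
    ext n
    simp [FormalMultilinearSeries.ofScalars]
  rw [h3] at h1
  exact h1.eventually_eq_zero

/-- scalar quasi-exponentials with exponents in `S` -/
def QE (S : Set ℂ) : Submodule ℂ (ℂ → ℂ) :=
  Submodule.span ℂ {h | ∃ l ∈ S, ∃ j : ℕ, h = fun u => Complex.exp (l * u) * u ^ j}

theorem qe_mem {S : Set ℂ} {l : ℂ} (hl : l ∈ S) (j : ℕ) :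
    (fun u => Complex.exp (l * u) * u ^ j) ∈ QE S :=
  Submodule.subset_span ⟨l, hl, j, rfl⟩

theorem exp_pow_diff (l : ℂ) (j : ℕ) : Differentiable ℂ (fun u : ℂ => Complex.exp (l * u) * u ^ j) := by
  fun_prop

theorem qe_diff {S : Set ℂ} {h : ℂ → ℂ} (hh : h ∈ QE S) : Differentiable ℂ h := by
  induction hh using Submodule.span_induction with
  | mem x hx =>
    obtain ⟨l, _, j, rfl⟩ := hx
    exact exp_pow_diff l j
  | zero => exact differentiable_const 0
  | add x y _ _ hx hy => exact hx.add hy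
  | smul c x _ hx => exact hx.const_smul c

theorem qe_solve {S : Set ℂ} {l : ℂ} (hl : l ∈ S) {h : ℂ → ℂ} (hh : h ∈ QE S) :
    ∃ g ∈ QE S, ∀ u, deriv g u - l * g u = h u := by
  have hd : ∀ (m : ℂ) (j : ℕ) (u : ℂ), deriv (fun u : ℂ => Complex.exp (m * u) * u ^ j) u =
      m * (Complex.exp (m * u) * u ^ j) + (j : ℂ) * (Complex.exp (m * u) * u ^ (j - 1)) := by
    intro m j u
    have h1 : HasDerivAt (fun u : ℂ => Complex.exp (m * u)) (Complex.exp (m * u) * m) u := by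
      have := ((hasDerivAt_id u).const_mul m).cexp
      simpa using this
    have h2 := h1.mul (hasDerivAt_pow j u)
    have h3 : deriv (fun u : ℂ => Complex.exp (m * u) * u ^ j) u = _ := h2.deriv
    rw [h3]; ring
  induction hh using Submodule.span_induction with
  | mem x hx =>
    obtain ⟨m, hm, j, rfl⟩ := hx
    by_cases hlm : m = l
    · subst hlm
      have h4 : ((j : ℂ) + 1) ≠ 0 := by exact_mod_cast Nat.succ_ne_zero j
      refine ⟨((j : ℂ) + 1)⁻¹ • (fun u => Complex.exp (m * u) * u ^ (j + 1)),
        Submodule.smul_mem _ _ (qe_mem hl _), fun u => ?_⟩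
      rw [deriv_const_smul _ (exp_pow_diff m (j + 1) u), hd]
      simp only [Pi.smul_apply, smul_eq_mul, Nat.add_sub_cancel]
      push_cast
      field_simp
      ring
    · have h4 : m - l ≠ 0 := sub_ne_zero.mpr hlm
      induction j with
      | zero =>
        refine ⟨(m - l)⁻¹ • (fun u => Complex.exp (m * u) * u ^ 0),
          Submodule.smul_mem _ _ (qe_mem hm _), fun u => ?_⟩
        rw [deriv_const_smul _ (exp_pow_diff m 0 u), hd]
        simp only [Pi.smul_apply, smul_eq_mul]
        push_cast
        field_simp
        ring
      | succ j ih =>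
        obtain ⟨g, hg, hg2⟩ := ih
        refine ⟨(m - l)⁻¹ • ((fun u => Complex.exp (m * u) * u ^ (j + 1)) - ((j : ℂ) + 1) • g),
          Submodule.smul_mem _ _ (Submodule.sub_mem _ (qe_mem hm _) (Submodule.smul_mem _ _ hg)), fun u => ?_⟩
        have d1 := exp_pow_diff m (j + 1) u
        have d2 := qe_diff hg u
        rw [deriv_const_smul _ (d1.sub (d2.const_smul _)), deriv_sub d1 (d2.const_smul _),
          deriv_const_smul _ d2, hd]
        simp only [Pi.smul_apply, Pi.sub_apply, smul_eq_mul, Nat.add_sub_cancel]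
        have e : deriv g u - l * g u = Complex.exp (m * u) * u ^ j := hg2 u
        have e' : deriv g u = Complex.exp (m * u) * u ^ j + l * g u := by linear_combination e
        rw [e']
        push_cast
        field_simp
        ring
  | zero => exact ⟨0, zero_mem _, fun u => by simp⟩
  | add x y _ _ hx hy =>
    obtain ⟨g, hg, hg2⟩ := hx
    obtain ⟨g', hg', hg2'⟩ := hy
    refine ⟨g + g', add_mem hg hg', fun u => ?_⟩
    rw [deriv_add (qe_diff hg u) (qe_diff hg' u), Pi.add_apply, Pi.add_apply, ← hg2, ← hg2']
    ring
  | smul c x _ hx =>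
    obtain ⟨g, hg, hg2⟩ := hx
    refine ⟨c • g, Submodule.smul_mem _ _ hg, fun u => ?_⟩
    rw [deriv_const_smul _ (qe_diff hg u), Pi.smul_apply, Pi.smul_apply, ← hg2, smul_eq_mul, smul_eq_mul,
      smul_eq_mul]
    ring

/-- the derivative as an endomorphism -/
def pd : Module.End ℂ (PowerSeries ℂ) := (PowerSeries.derivative ℂ).toLinearMap

theorem pd_apply (f : PowerSeries ℂ) : pd f = PowerSeries.derivative ℂ f := rfl

theorem ker_pd (l : ℂ) (f : PowerSeries ℂ) (h : PowerSeries.derivative ℂ f = l • f) :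
    f = PowerSeries.coeff 0 f • ex l := by
  ext k
  induction k with
  | zero => simp [ex]
  | succ k ih =>
    have h4 : ((k : ℂ) + 1) ≠ 0 := by exact_mod_cast Nat.succ_ne_zero k
    have h1 := congrArg (PowerSeries.coeff k) h
    have h2 := congrArg (PowerSeries.coeff k) (ex_deriv l)
    rw [PowerSeries.coeff_derivative, PowerSeries.coeff_smul] at h1 h2
    apply mul_right_cancel₀ h4
    rw [h1, ih, PowerSeries.coeff_smul, PowerSeries.coeff_smul, smul_eq_mul, smul_eq_mul, smul_eq_mul,
      mul_assoc, h2, smul_eq_mul]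
    ring

theorem qe_recover (u₀ : ℂ) (S : Set ℂ) (d : ℕ) : ∀ (p : Polynomial ℂ), p ≠ 0 → p.natDegree = d →
    (∀ l, p.IsRoot l → l ∈ S) → ∀ f : PowerSeries ℂ, Polynomial.aeval pd p f = 0 →
    ∃ F ∈ QE S, tay u₀ F = f := by
  induction d with
  | zero =>
    intro p hp hdeg _ f hf
    obtain ⟨c, rfl⟩ := Polynomial.natDegree_eq_zero.mp hdeg
    have hc : c ≠ 0 := by rintro rfl; simp at hp
    rw [Polynomial.aeval_C, Module.algebraMap_end_apply] at hf
    refine ⟨0, zero_mem _, ?_⟩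
    rw [(smul_eq_zero.mp hf).resolve_left hc]
    exact tay_zero u₀
  | succ d ih =>
    intro p hp hdeg hroot f hf
    obtain ⟨l, hl⟩ := IsAlgClosed.exists_root p (by
      rw [Polynomial.degree_eq_natDegree hp, hdeg]
      exact_mod_cast Nat.succ_ne_zero d)
    have hlS := hroot l hl
    obtain ⟨q, rfl⟩ := Polynomial.dvd_iff_isRoot.mpr hl
    have hq : q ≠ 0 := right_ne_zero_of_mul hp
    have hqd : q.natDegree = d := by
      rw [Polynomial.natDegree_mul (Polynomial.X_sub_C_ne_zero l) hq, Polynomial.natDegree_X_sub_C] at hdeg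
      omega
    have h1 : Polynomial.aeval pd q (PowerSeries.derivative ℂ f - l • f) = 0 := by
      rw [mul_comm, map_mul, Module.End.mul_apply, map_sub, Polynomial.aeval_X, Polynomial.aeval_C,
        LinearMap.sub_apply, Module.algebraMap_end_apply] at hf
      exact hf
    obtain ⟨G, hG, hGt⟩ := ih q hq hqd (fun m hm => hroot m (by
      rw [Polynomial.IsRoot, Polynomial.eval_mul, hm.eq_zero, mul_zero])) _ h1
    obtain ⟨g, hg, hg2⟩ := qe_solve hlS hG
    have hga : AnalyticAt ℂ g u₀ := (qe_diff hg).analyticAt u₀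
    have h2 : PowerSeries.derivative ℂ (tay u₀ g) - l • tay u₀ g = PowerSeries.derivative ℂ f - l • f := by
      rw [← hGt, ← tay_deriv, ← tay_smul, ← tay_sub hga.deriv (show AnalyticAt ℂ (fun u => l * g u) u₀ from analyticAt_const.mul hga)]
      congr 1
      funext u
      exact hg2 u
    have h3 := ker_pd l (f - tay u₀ g) (by
      rw [map_sub, smul_sub, sub_eq_sub_iff_sub_eq_sub]
      exact h2.symm)
    set c := PowerSeries.coeff 0 (f - tay u₀ g) with hc
    refine ⟨g + (c * (Complex.exp (l * u₀))⁻¹) • (fun u => Complex.exp (l * u) * u ^ 0),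
      add_mem hg (Submodule.smul_mem _ _ (qe_mem hlS 0)), ?_⟩
    have ha : AnalyticAt ℂ (fun u => Complex.exp (l * u)) u₀ :=
      (show Differentiable ℂ (fun u => Complex.exp (l * u)) by fun_prop).analyticAt u₀
    have e : g + (c * (Complex.exp (l * u₀))⁻¹) • (fun u => Complex.exp (l * u) * u ^ 0) =
        fun u => g u + (c * (Complex.exp (l * u₀))⁻¹) * Complex.exp (l * u) := by
      funext u; simp
    rw [e, tay_add hga (show AnalyticAt ℂ (fun u => (c * (Complex.exp (l*u₀))⁻¹) * Complex.exp (l*u)) u₀ from analyticAt_const.mul ha), tay_smul, tay_exp, smul_smul,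
      inv_mul_cancel_right₀ (Complex.exp_ne_zero _), ← h3]
    ring

end GaudinModel

set_option linter.unusedSectionVars false
set_option linter.unusedSimpArgs false
namespace GaudinModel

section VecTay

variable {N n : ℕ} (V : Fin n → Type*) [∀ i, AddCommGroup (V i)] [∀ i, Module ℂ (V i)]
  (M : Type*) [NormedAddCommGroup M] [NormedSpace ℂ M] [FiniteDimensional ℂ M]
  (E : ∀ i : Fin n, Fin N → Fin N → (V i →ₗ[ℂ] V i))
  (φ : M ≃ₗ[ℂ] PiTensorProduct ℂ V)
  (z : Fin n → ℂ) (K : Matrix (Fin N) (Fin N) ℂ)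
  {ι : Type*} [Fintype ι] [DecidableEq ι] (B : Module.Basis ι ℂ M)

/-- vector-valued Taylor series, in coordinates -/
def Tay {M : Type*} [NormedAddCommGroup M] [NormedSpace ℂ M] {ι : Type*}
    (B : Module.Basis ι ℂ M) (u₀ : ℂ) (f : ℂ → M) : ι → PowerSeries ℂ :=
  fun i => tay u₀ (fun u => B.coord i (f u))

/-- matrices of the operators `EE` -/
def eMat (j : Fin n) (a b : Fin N) : Matrix ι ι ℂ := LinearMap.toMatrix B B (EE V M E φ j a b)

variable {M}

theorem lin_analytic {M' : Type*} [NormedAddCommGroup M'] [NormedSpace ℂ M'] (L : M →ₗ[ℂ] M') {u₀ : ℂ}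
    {f : ℂ → M} (hf : AnalyticAt ℂ f u₀) : AnalyticAt ℂ (fun u => L (f u)) u₀ :=
  (ContinuousLinearMap.analyticAt (LinearMap.toContinuousLinearMap L) (f u₀)).comp hf

theorem lin_deriv {M' : Type*} [NormedAddCommGroup M'] [NormedSpace ℂ M'] (L : M →ₗ[ℂ] M') {u : ℂ}
    {f : ℂ → M} (hf : DifferentiableAt ℂ f u) : deriv (fun u => L (f u)) u = L (deriv f u) :=
  ((LinearMap.toContinuousLinearMap L).hasFDerivAt.comp_hasDerivAt u hf.hasDerivAt).deriv

theorem analytic_of_coord {u₀ : ℂ} {f : ℂ → M} (h : ∀ i, AnalyticAt ℂ (fun u => B.coord i (f u)) u₀) :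
    AnalyticAt ℂ f u₀ := by
  have e : f = fun u => ∑ i, B.coord i (f u) • B i := by
    funext u
    simp [B.sum_repr]
  rw [e]
  exact Finset.analyticAt_fun_sum _ fun i _ => (h i).fun_smul analyticAt_const

theorem Tay_congr {u₀ : ℂ} {f g : ℂ → M} (h : f =ᶠ[nhds u₀] g) : Tay B u₀ f = Tay B u₀ g := by
  funext i
  apply tay_congr
  filter_upwards [h] with u hu
  rw [hu]

theorem Tay_eq_zero {u₀ : ℂ} {f : ℂ → M} (hf : AnalyticAt ℂ f u₀) (h : Tay B u₀ f = 0) :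
    ∀ᶠ u in nhds u₀, f u = 0 := by
  have : ∀ i, ∀ᶠ u in nhds u₀, B.coord i (f u) = 0 := fun i =>
    tay_eq_zero (lin_analytic (B.coord i) hf) (congrFun h i)
  have h2 := Filter.eventually_all.mpr this
  filter_upwards [h2] with u hu
  exact B.forall_coord_eq_zero_iff.mp hu

theorem Tay_sum {κ : Type*} [Fintype κ] {u₀ : ℂ} (c : κ → ℂ) (F : κ → ℂ → M)
    (hF : ∀ k, AnalyticAt ℂ (F k) u₀) :
    Tay B u₀ (fun u => ∑ k, c k • F k u) = ∑ k, c k • Tay B u₀ (F k) := by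
  funext i
  simp only [Tay, map_sum, map_smul, Finset.sum_apply, Pi.smul_apply, smul_eq_mul]
  rw [tay_sum]
  · simp only [tay_smul]
  · intro k _
    exact analyticAt_const.mul (lin_analytic (B.coord i) (hF k))

theorem Tay_sub {u₀ : ℂ} {f g : ℂ → M} (hf : AnalyticAt ℂ f u₀) (hg : AnalyticAt ℂ g u₀) :
    Tay B u₀ (fun u => f u - g u) = Tay B u₀ f - Tay B u₀ g := by
  funext i
  simp only [Tay, map_sub, Pi.sub_apply]
  exact tay_sub (lin_analytic (B.coord i) hf) (lin_analytic (B.coord i) hg)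

theorem Xg_analytic {u₀ : ℂ} (hu : GoodG z u₀) {f : ℂ → M} (hf : AnalyticAt ℂ f u₀) (a b : Fin N) :
    AnalyticAt ℂ (Xg V M E φ z K a b f) u₀ := by
  haveI : CompleteSpace M := FiniteDimensional.complete ℂ M
  have h1 : AnalyticAt ℂ (fun u => if a = b then deriv f u else 0) u₀ := by
    split_ifs
    · exact hf.deriv
    · exact analyticAt_const
  have h2 : AnalyticAt ℂ (fun u => K a b • f u) u₀ := analyticAt_const.fun_smul hf
  have h3 : AnalyticAt ℂ (fun u => ∑ j : Fin n, (u - z j)⁻¹ • (EE V M E φ j b a) (f u)) u₀ := by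
    refine Finset.analyticAt_fun_sum _ fun j _ => ?_
    refine AnalyticAt.fun_smul ?_ (lin_analytic _ hf)
    exact (analyticAt_id.sub analyticAt_const).inv (sub_ne_zero.mpr (hu j))
  exact (h1.sub h2).sub h3

theorem Xg_Tay {u₀ : ℂ} (hu : GoodG z u₀) {f : ℂ → M} (hf : AnalyticAt ℂ f u₀) (a b : Fin N) :
    Tay B u₀ (Xg V M E φ z K a b f) =
      fX (fun j => z j - u₀) (eMat V M E φ B) K a b (Tay B u₀ f) := by
  haveI : CompleteSpace M := FiniteDimensional.complete ℂ M
  funext i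
  have hc : ∀ k, AnalyticAt ℂ (fun u => B.coord k (f u)) u₀ := fun k => lin_analytic (B.coord k) hf
  have hd : ∀ᶠ u in nhds u₀, DifferentiableAt ℂ f u := by
    filter_upwards [hf.eventually_analyticAt] with u hu
    exact hu.differentiableAt
  have hinv : ∀ j, AnalyticAt ℂ (fun u => (u - z j)⁻¹) u₀ := fun j =>
    (analyticAt_id.sub analyticAt_const).inv (sub_ne_zero.mpr (hu j))
  have hE : ∀ j u, B.coord i (EE V M E φ j b a (f u)) =
      ∑ k, eMat V M E φ B j b a i k * B.coord k (f u) := by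
    intro j u
    have := congrFun (LinearMap.toMatrix_mulVec_repr B B (EE V M E φ j b a) (f u)) i
    rw [Matrix.mulVec, dotProduct] at this
    exact this.symm
  have hEa : ∀ j, AnalyticAt ℂ (fun u => ∑ k, eMat V M E φ B j b a i k * B.coord k (f u)) u₀ := fun j =>
    Finset.analyticAt_fun_sum _ fun k _ => analyticAt_const.mul (hc k)
  have h1 : (fun u => B.coord i (Xg V M E φ z K a b f u)) =ᶠ[nhds u₀] fun u =>
      ((if a = b then deriv (fun u => B.coord i (f u)) u else 0) - K a b * B.coord i (f u)) -
        ∑ j, (u - z j)⁻¹ * ∑ k, eMat V M E φ B j b a i k * B.coord k (f u) := by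
    filter_upwards [hd] with u hu
    simp only [Xg, map_sub, map_smul, map_sum, hE, smul_eq_mul, lin_deriv (B.coord i) hu]
    split_ifs <;> simp
  have a1 : AnalyticAt ℂ (fun u => if a = b then deriv (fun u => B.coord i (f u)) u else 0) u₀ := by
    split_ifs
    · exact (hc i).deriv
    · exact analyticAt_const
  have a2 : AnalyticAt ℂ (fun u => K a b * B.coord i (f u)) u₀ := analyticAt_const.mul (hc i)
  have a3 : ∀ j, AnalyticAt ℂ (fun u => (u - z j)⁻¹ * ∑ k, eMat V M E φ B j b a i k * B.coord k (f u)) u₀ :=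
    fun j => (hinv j).mul (hEa j)
  have a4 : AnalyticAt ℂ (fun u => ∑ j, (u - z j)⁻¹ * ∑ k, eMat V M E φ B j b a i k * B.coord k (f u)) u₀ :=
    Finset.analyticAt_fun_sum _ fun j _ => a3 j
  have a5 : AnalyticAt ℂ (fun u => (if a = b then deriv (fun u => B.coord i (f u)) u else 0)
    - K a b * B.coord i (f u)) u₀ := a1.sub a2
  have t1 : tay u₀ (fun u => if a = b then deriv (fun u => B.coord i (f u)) u else 0) =
      (if a = b then fd ι ℂ else 0) (Tay B u₀ f) i := by
    split_ifs
    · rw [tay_deriv]; rfl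
    · rw [tay_zero]; rfl
  have t3 : ∀ j, tay u₀ (fun u => (u - z j)⁻¹ * ∑ k, eMat V M E φ B j b a i k * B.coord k (f u)) =
      ((fm (gs ℂ (z j - u₀)) * fe (eMat V M E φ B j b a) : Module.End ℂ (ι → PowerSeries ℂ))) (Tay B u₀ f) i := by
    intro j
    rw [tay_mul (hinv j) (hEa j), tay_inv _ _ (hu j), tay_sum Finset.univ
      (fun k u => eMat V M E φ B j b a i k * B.coord k (f u))
      (fun k _ => (show AnalyticAt ℂ (fun u => eMat V M E φ B j b a i k * B.coord k (f u)) u₀ from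
        analyticAt_const.mul (hc k)))]
    simp only [tay_smul, Module.End.mul_apply, fm_apply, fe_apply]
    rfl
  change tay u₀ _ = _
  rw [tay_congr h1, tay_sub a5 a4, tay_sub a1 a2, tay_sum Finset.univ (fun j u => (u - z j)⁻¹ * ∑ k, eMat V M E φ B j b a i k * B.coord k (f u))
    (fun j _ => a3 j), tay_smul, t1]
  simp only [t3, fX, LinearMap.sub_apply, Pi.sub_apply, LinearMap.sum_apply, Finset.sum_apply, fm_apply]
  congr 2
  rw [PowerSeries.smul_eq_C_mul]
  rfl

theorem foldr_Tay {u₀ : ℂ} (hu : GoodG z u₀) {f : ℂ → M} (hf : AnalyticAt ℂ f u₀)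
    (l : List (Fin N × Fin N)) :
    AnalyticAt ℂ (((l.map fun p => Xg V M E φ z K p.1 p.2).foldr (· ∘ ·) id) f) u₀ ∧
    Tay B u₀ (((l.map fun p => Xg V M E φ z K p.1 p.2).foldr (· ∘ ·) id) f) =
      (l.map fun p => fX (fun j => z j - u₀) (eMat V M E φ B) K p.1 p.2).prod (Tay B u₀ f) := by
  induction l with
  | nil => exact ⟨hf, rfl⟩
  | cons p l ih =>
    simp only [List.map_cons, List.foldr_cons, Function.comp_apply, List.prod_cons, Module.End.mul_apply]
    exact ⟨Xg_analytic V E φ z K hu ih.1 _ _, by rw [Xg_Tay V E φ z K B hu ih.1, ih.2]⟩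

theorem Dg_Tay {u₀ : ℂ} (hu : GoodG z u₀) {f : ℂ → M} (hf : AnalyticAt ℂ f u₀) :
    AnalyticAt ℂ (Dg V M E φ z K f) u₀ ∧
    Tay B u₀ (Dg V M E φ z K f) = fD (fun j => z j - u₀) (eMat V M E φ B) K (Tay B u₀ f) := by
  have key : ∀ σ : Equiv.Perm (Fin N),
      AnalyticAt ℂ (((List.ofFn fun a => Xg V M E φ z K a (σ a)).foldr (· ∘ ·) id) f) u₀ ∧
      Tay B u₀ (((List.ofFn fun a => Xg V M E φ z K a (σ a)).foldr (· ∘ ·) id) f) =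
        (List.ofFn fun a => fX (fun j => z j - u₀) (eMat V M E φ B) K a (σ a)).prod (Tay B u₀ f) := by
    intro σ
    have := foldr_Tay V E φ z K B hu hf (List.ofFn fun a => (a, σ a))
    rw [List.map_ofFn, List.map_ofFn] at this
    exact this
  have e : Dg V M E φ z K f = fun u => ∑ σ : Equiv.Perm (Fin N),
      (((Equiv.Perm.sign σ : ℤˣ) : ℤ) : ℂ) •
      (((List.ofFn fun a : Fin N => Xg V M E φ z K a (σ a)).foldr (· ∘ ·) id) f) u := by
    funext u
    simp only [Dg, Int.cast_smul_eq_zsmul]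
  rw [e]
  refine ⟨Finset.analyticAt_fun_sum _ fun σ _ => analyticAt_const.fun_smul (key σ).1, ?_⟩
  rw [Tay_sum B _ _ fun σ => (key σ).1]
  rw [fD, rdr, LinearMap.sum_apply]
  refine Finset.sum_congr rfl fun σ _ => ?_
  rw [(key σ).2, Int.cast_smul_eq_zsmul]
  rfl

theorem aeval_comp (p : Polynomial ℂ) (f : ι → PowerSeries ℂ) (i : ι) :
    (Polynomial.aeval (fd ι ℂ) p f) i = Polynomial.aeval pd p (f i) := by
  have hp : ∀ (k : ℕ) (f : ι → PowerSeries ℂ), ((fd ι ℂ ^ k) f) i = (pd ^ k) (f i) := by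
    intro k
    induction k with
    | zero => intro f; simp
    | succ k ih =>
      intro f
      rw [pow_succ, pow_succ, Module.End.mul_apply, Module.End.mul_apply, ih]
      rfl
  rw [Polynomial.aeval_eq_sum_range, Polynomial.aeval_eq_sum_range]
  simp only [LinearMap.sum_apply, LinearMap.smul_apply, Finset.sum_apply, Pi.smul_apply, hp]

end VecTay

section Kill

variable {N n : ℕ} (V : Fin n → Type*) [∀ i, AddCommGroup (V i)] [∀ i, Module ℂ (V i)]
  [∀ i, FiniteDimensional ℂ (V i)]
  (M : Type*) [NormedAddCommGroup M] [NormedSpace ℂ M] [FiniteDimensional ℂ M]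
  (Λ : Fin n → Fin N → ℤ)
  (E : ∀ i : Fin n, Fin N → Fin N → (V i →ₗ[ℂ] V i))
  (φ : M ≃ₗ[ℂ] PiTensorProduct ℂ V)
  (z : Fin n → ℂ) (K : Matrix (Fin N) (Fin N) ℂ)
  {ι : Type*} [Fintype ι] [DecidableEq ι] (B : Module.Basis ι ℂ M)

theorem kill_M (hdom : ∀ i, ∀ a b : Fin N, a ≤ b → Λ i b ≤ Λ i a)
    (hpoly : ∀ i a, 0 ≤ Λ i a) (hrel : GlRel V E) (hhw : IsHW V E Λ) : ∃ m : ℕ, ∀ u₀, GoodG z u₀ → ∀ f : ι → PowerSeries ℂ,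
    fD (fun j => z j - u₀) (eMat V M E φ B) K f = 0 →
    Polynomial.aeval (fd ι ℂ) (K.charpoly ^ m) f = 0 := by
  obtain ⟨J, i1, i2, g, hg, hgE⟩ := embed_M V M Λ hdom hpoly E hrel hhw φ
  let Bt := Pi.basisFun ℂ ((Σ i, J i) → Fin N)
  have hrepr : ∀ v, (Bt.repr v : ((Σ i, J i) → Fin N) → ℂ) = v := fun v => by
    funext c; simp [Bt]
  have hmv : ∀ m : M, (LinearMap.toMatrix B Bt g).mulVec (B.repr m) = g m := fun m => by
    rw [LinearMap.toMatrix_mulVec_repr, hrepr]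
  have hrs : ∀ v : ι → ℂ, (B.repr (B.equivFun.symm v) : ι → ℂ) = v := fun v => by
    exact B.equivFun.apply_symm_apply v
  refine ⟨_, fun u₀ hu f hf => formal_kill J (fun j => z j - u₀)
    (fun j => sub_ne_zero.mpr (hu j).symm) (eMat V M E φ B) K (LinearMap.toMatrix B Bt g) ?_ ?_ f hf⟩
  · intro v hv
    have h1 := hmv (B.equivFun.symm v)
    rw [hrs, hv] at h1
    have h2 : B.equivFun.symm v = 0 := hg (by rw [← h1, map_zero])
    exact B.equivFun.symm.map_eq_zero_iff.mp h2
  · intro k a b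
    apply Matrix.ext_of_mulVec_single
    intro s
    have e1 : (Pi.single s 1 : ι → ℂ) = B.repr (B s) := by
      rw [B.repr_self, Finsupp.single_eq_pi_single]
    rw [e1, ← Matrix.mulVec_mulVec, eMat, LinearMap.toMatrix_mulVec_repr, hmv, hgE, Matrix.sum_mulVec]
    refine Finset.sum_congr rfl fun l _ => ?_
    rw [← Matrix.mulVec_mulVec, hmv, et_mulVec']
    rfl

end Kill

end GaudinModel

set_option linter.unusedSectionVars false
set_option linter.unusedSimpArgs false
namespace GaudinModel

theorem qe_repr (T : Finset ℂ) {h : ℂ → ℂ} (hh : h ∈ QE (T : Set ℂ)) :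
    ∃ (d₀ : ℕ) (v : ℂ → ℕ → ℂ), ∀ d, d₀ ≤ d → ∀ u,
      h u = ∑ l ∈ T, ∑ j ∈ Finset.range d, (Complex.exp (l * u) * u ^ j) * v l j := by
  induction hh using Submodule.span_induction with
  | mem x hx =>
    obtain ⟨m, hm, i, rfl⟩ := hx
    refine ⟨i + 1, fun l j => if l = m then (if j = i then 1 else 0) else 0, fun d hd u => ?_⟩
    rw [Finset.sum_eq_single m]
    · rw [Finset.sum_eq_single i]
      · simp
      · intro j _ hj; simp [hj]
      · intro hi; exact absurd (Finset.mem_range.mpr (by omega)) hi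
    · intro l _ hl; simp [hl]
    · intro hm'; exact absurd hm hm'
  | zero => exact ⟨0, fun _ _ => 0, fun d _ u => by simp⟩
  | add x y _ _ hx hy =>
    obtain ⟨d₁, v₁, h₁⟩ := hx
    obtain ⟨d₂, v₂, h₂⟩ := hy
    refine ⟨max d₁ d₂, fun l j => v₁ l j + v₂ l j, fun d hd u => ?_⟩
    rw [Pi.add_apply, h₁ d ((le_max_left _ _).trans hd), h₂ d ((le_max_right _ _).trans hd)]
    simp only [mul_add, Finset.sum_add_distrib]
  | smul c x _ hx =>
    obtain ⟨d₁, v₁, h₁⟩ := hx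
    refine ⟨d₁, fun l j => c * v₁ l j, fun d hd u => ?_⟩
    rw [Pi.smul_apply, h₁ d hd, smul_eq_mul, Finset.mul_sum]
    refine Finset.sum_congr rfl fun l _ => ?_
    rw [Finset.mul_sum]
    exact Finset.sum_congr rfl fun j _ => by ring

theorem qe_vec {M : Type*} [AddCommGroup M] [Module ℂ M] {ι : Type*} [Fintype ι] (w : ι → M)
    (T : Finset ℂ) (h : ι → ℂ → ℂ) (hh : ∀ i, h i ∈ QE (T : Set ℂ)) :
    ∃ (k d : ℕ) (lam : Fin k → ℂ) (v : Fin k → Fin d → M), (∀ t, lam t ∈ T) ∧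
      ∀ u, ∑ i, h i u • w i = ∑ t : Fin k, ∑ j : Fin d,
          (Complex.exp (lam t * u) * u ^ (j : ℕ)) • v t j := by
  choose d₀ v hv using fun i => qe_repr T (hh i)
  refine ⟨T.card, Finset.univ.sup d₀, fun t => (T.equivFin.symm t : ℂ),
    fun t j => ∑ i, v i (T.equivFin.symm t : ℂ) j • w i, fun t => (T.equivFin.symm t).2, fun u => ?_⟩
  have e : ∀ i, h i u = ∑ t : Fin T.card, ∑ j : Fin (Finset.univ.sup d₀),
      (Complex.exp ((T.equivFin.symm t : ℂ) * u) * u ^ (j : ℕ)) * v i (T.equivFin.symm t : ℂ) j := by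
    intro i
    rw [hv i (Finset.univ.sup d₀) (Finset.le_sup (Finset.mem_univ i)) u, ← Finset.sum_coe_sort,
      ← Equiv.sum_comp T.equivFin.symm]
    refine Finset.sum_congr rfl fun t _ => ?_
    rw [Finset.sum_range]
  simp only [e, Finset.sum_smul, Finset.smul_sum, mul_smul]
  rw [Finset.sum_comm]
  refine Finset.sum_congr rfl fun t _ => ?_
  rw [Finset.sum_comm]

theorem eig_of_root {N : ℕ} (K : Matrix (Fin N) (Fin N) ℂ) {l : ℂ} (h : K.charpoly.IsRoot l) :
    ∃ x : Fin N → ℂ, x ≠ 0 ∧ K.mulVec x = l • x := by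
  rw [Polynomial.IsRoot.def, Matrix.eval_charpoly] at h
  obtain ⟨x, hx, hx2⟩ := Matrix.exists_mulVec_eq_zero_iff.mpr h
  refine ⟨x, hx, ?_⟩
  rw [Matrix.sub_mulVec, sub_eq_zero, Matrix.scalar_apply] at hx2
  rw [← hx2]
  funext a
  simp [Matrix.mulVec_diagonal]

theorem good_conn {n : ℕ} (z : Fin n → ℂ) : IsConnected {u | GoodG z u} ∧ IsOpen {u | GoodG z u} := by
  have e : {u | GoodG z u} = (Set.range z)ᶜ := by
    ext u
    simp [GoodG, eq_comm]
  rw [e]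
  refine ⟨(Set.finite_range z).countable.isConnected_compl_of_one_lt_rank ?_,
    (Set.finite_range z).isClosed.isOpen_compl⟩
  rw [Complex.rank_real_complex]
  exact_mod_cast one_lt_two

section Main

variable {N n : ℕ} (V : Fin n → Type*) [∀ i, AddCommGroup (V i)] [∀ i, Module ℂ (V i)]
  [∀ i, FiniteDimensional ℂ (V i)]
  (M : Type*) [NormedAddCommGroup M] [NormedSpace ℂ M] [FiniteDimensional ℂ M]
  (Λ : Fin n → Fin N → ℤ)
  (E : ∀ i : Fin n, Fin N → Fin N → (V i →ₗ[ℂ] V i))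
  (φ : M ≃ₗ[ℂ] PiTensorProduct ℂ V)
  (z : Fin n → ℂ) (K : Matrix (Fin N) (Fin N) ℂ)
  {ι : Type*} [Fintype ι] [DecidableEq ι]

theorem fD_Tay_zero (B : Module.Basis ι ℂ M) {u₁ : ℂ} (hu : GoodG z u₁) {f : ℂ → M} (hf : AnalyticAt ℂ f u₁)
    (h : ∀ᶠ u in nhds u₁, Dg V M E φ z K f u = 0) :
    fD (fun j => z j - u₁) (eMat V M E φ B) K (Tay B u₁ f) = 0 := by
  rw [← (Dg_Tay V E φ z K B hu hf).2, Tay_congr B (g := fun _ => 0) h]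
  funext i
  simp [Tay, tay_zero]

theorem local_sol (B : Module.Basis ι ℂ M) (hdom : ∀ i, ∀ a b : Fin N, a ≤ b → Λ i b ≤ Λ i a)
    (hpoly : ∀ i a, 0 ≤ Λ i a) (hrel : GlRel V E) (hhw : IsHW V E Λ) (u₀ : ℂ) (hu₀ : GoodG z u₀)
    (p : ι → PowerSeries ℂ) :
    ∃ F : ℂ → M, (∃ (k d : ℕ) (lam : Fin k → ℂ) (v : Fin k → Fin d → M),
        (∀ t : Fin k, ∃ x : Fin N → ℂ, x ≠ 0 ∧ K.mulVec x = lam t • x) ∧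
        ∀ u : ℂ, F u = ∑ t : Fin k, ∑ j : Fin d,
          (Complex.exp (lam t * u) * u ^ (j : ℕ)) • v t j) ∧
      Differentiable ℂ F ∧ (∀ u, GoodG z u → Dg V M E φ z K F u = 0) ∧
      Tay B u₀ F - p ∈ Fil ι ℂ N := by
  obtain ⟨m, hm⟩ := kill_M V M Λ E φ z K B hdom hpoly hrel hhw
  obtain ⟨w, hw, hw0⟩ := lead_exists (fD_lead (fun j => z j - u₀) (eMat V M E φ B) K) p
  have h1 := hm u₀ hu₀ w hw0
  have hc0 : K.charpoly ≠ 0 := K.charpoly_monic.ne_zero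
  have h2 : ∀ i, ∃ h ∈ QE (K.charpoly.roots.toFinset : Set ℂ), tay u₀ h = w i := by
    intro i
    refine qe_recover u₀ _ _ (K.charpoly ^ m) (pow_ne_zero _ hc0) rfl (fun l hl => ?_) (w i) ?_
    · rw [Polynomial.IsRoot.def, Polynomial.eval_pow] at hl
      have this : K.charpoly.IsRoot l := eq_zero_of_pow_eq_zero hl
      exact Multiset.mem_toFinset.mpr ((Polynomial.mem_roots hc0).mpr this)
    · rw [← aeval_comp, h1]; rfl
  choose h hh hht using h2
  have hF : Differentiable ℂ (fun u => ∑ i, h i u • B i) :=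
    Differentiable.fun_sum fun i _ => (qe_diff (hh i)).smul_const _
  have hT : Tay B u₀ (fun u => ∑ i, h i u • B i) = w := by
    funext i
    rw [← hht i]
    change tay u₀ _ = _
    congr 1
    funext u
    simp [Finsupp.single_apply]
  refine ⟨fun u => ∑ i, h i u • B i, ?_, hF, ?_, by rw [hT]; exact hw⟩
  · obtain ⟨k, d, lam, v, hl, hv⟩ := qe_vec B _ h hh
    refine ⟨k, d, lam, v, fun t => eig_of_root K ?_, hv⟩
    exact Polynomial.isRoot_of_mem_roots (Multiset.mem_toFinset.mp (hl t))
  · have ha : AnalyticOnNhd ℂ (Dg V M E φ z K (fun u => ∑ i, h i u • B i)) {u | GoodG z u} :=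
      fun u hu => (Dg_Tay V E φ z K B hu (hF.analyticAt u)).1
    have h0 := Tay_eq_zero B (ha u₀ hu₀) (by rw [(Dg_Tay V E φ z K B hu₀ (hF.analyticAt u₀)).2, hT, hw0])
    exact ha.eqOn_zero_of_preconnected_of_eventuallyEq_zero (good_conn z).1.isPreconnected hu₀ h0

theorem main_kappa (B : Module.Basis ι ℂ M) (hdom : ∀ i, ∀ a b : Fin N, a ≤ b → Λ i b ≤ Λ i a)
    (hpoly : ∀ i a, 0 ≤ Λ i a) (hrel : GlRel V E) (hhw : IsHW V E Λ) :
    ∃ F : Fin N × ι → ℂ → M,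
      (∀ i, ∃ (k d : ℕ) (lam : Fin k → ℂ) (v : Fin k → Fin d → M),
        (∀ t : Fin k, ∃ x : Fin N → ℂ, x ≠ 0 ∧ K.mulVec x = lam t • x) ∧
        ∀ u : ℂ, F i u = ∑ t : Fin k, ∑ j : Fin d,
          (Complex.exp (lam t * u) * u ^ (j : ℕ)) • v t j) ∧
      LinearIndependent ℂ F ∧
      (∀ i, ∀ u : ℂ, GoodG z u → Dg V M E φ z K (F i) u = 0) ∧
      (∀ U : Set ℂ, IsOpen U → (∀ j, z j ∉ U) → IsConnected U →
        ∀ f : ℂ → M, DifferentiableOn ℂ f U → (∀ u ∈ U, Dg V M E φ z K f u = 0) →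
          ∃ c : Fin N × ι → ℂ, ∀ u ∈ U, f u = ∑ i, c i • F i u) := by
  haveI : CompleteSpace M := FiniteDimensional.complete ℂ M
  obtain ⟨u₀, hu₀⟩ := (good_conn z).1.nonempty
  choose F hF hFd hFD hFT using fun q : Fin N × ι => local_sol V M Λ E φ z K B hdom hpoly hrel hhw u₀ hu₀
    (fun i => if i = q.2 then PowerSeries.X ^ (q.1 : ℕ) else 0)
  have hcoef : ∀ (q : Fin N × ι) (i : ι) (m : Fin N),
      PowerSeries.coeff (m : ℕ) (Tay B u₀ (F q) i) = if (m, i) = q then 1 else 0 := by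
    intro q i m
    have := hFT q i m m.2
    rw [Pi.sub_apply, map_sub, sub_eq_zero] at this
    rw [this]
    by_cases hi : i = q.2
    · rw [if_pos hi, PowerSeries.coeff_X_pow]
      simp only [Prod.ext_iff, hi, and_true, Fin.ext_iff]
    · rw [if_neg hi, if_neg (fun h => hi (by rw [← h])), map_zero]
  have hindep : ∀ c : Fin N × ι → ℂ, (∀ u, ∑ q, c q • F q u = 0) → c = 0 := by
    intro c hc
    have h1 := Tay_sum B c F (fun q => (hFd q).analyticAt u₀)
    rw [show (fun u => ∑ q, c q • F q u) = fun _ => 0 from funext hc] at h1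
    funext q
    have h2 := congrArg (PowerSeries.coeff (q.1 : ℕ)) (congrFun h1 q.2)
    simp only [Finset.sum_apply, Pi.smul_apply, map_sum, PowerSeries.coeff_smul, hcoef] at h2
    simp [Tay, tay_zero] at h2
    simpa using h2.symm
  refine ⟨F, hF, ?_, hFD, ?_⟩
  · rw [Fintype.linearIndependent_iff]
    intro c hc
    have := hindep c (fun u => by simpa using congrFun hc u)
    exact fun i => congrFun this i
  · intro U hU hzU hUc f hf hDf
    obtain ⟨u₁, hu₁⟩ := hUc.nonempty
    have hg₁ : GoodG z u₁ := fun j h => hzU j (h ▸ hu₁)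
    have hfa : AnalyticOnNhd ℂ f U := hf.analyticOnNhd hU
    have hsd : ∀ c : Fin N × ι → ℂ, Differentiable ℂ (fun u => ∑ q, c q • F q u) := fun c =>
      Differentiable.fun_sum fun q _ => (hFd q).const_smul (c q)
    have hgood : ∀ᶠ u in nhds u₁, GoodG z u := (good_conn z).2.mem_nhds hg₁
    have hker : ∀ q, fD (fun j => z j - u₁) (eMat V M E φ B) K (Tay B u₁ (F q)) = 0 := fun q =>
      fD_Tay_zero V M E φ z K B hg₁ ((hFd q).analyticAt u₁) (hgood.mono fun u hu => hFD q u hu)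
    have hTs : ∀ c : Fin N × ι → ℂ, Tay B u₁ (fun u => ∑ q, c q • F q u) = ∑ q, c q • Tay B u₁ (F q) :=
      fun c => Tay_sum B c F (fun q => (hFd q).analyticAt u₁)
    have hkers : ∀ c : Fin N × ι → ℂ,
        fD (fun j => z j - u₁) (eMat V M E φ B) K (∑ q, c q • Tay B u₁ (F q)) = 0 := fun c => by
      rw [map_sum]
      exact Finset.sum_eq_zero fun q _ => by rw [map_smul, hker, smul_zero]
    let L : (Fin N × ι → ℂ) →ₗ[ℂ] (Fin N × ι → ℂ) :=
      { toFun := fun c q => PowerSeries.coeff (q.1 : ℕ) ((∑ q', c q' • Tay B u₁ (F q')) q.2)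
        map_add' := fun c c' => by
          funext q
          simp [add_smul, Finset.sum_add_distrib, add_mul]
        map_smul' := fun a c => by
          funext q
          simp [mul_smul, Finset.mul_sum, mul_assoc] }
    have hinj : Function.Injective L := by
      rw [← LinearMap.ker_eq_bot, LinearMap.ker_eq_bot']
      intro c hc
      have h1 : (∑ q, c q • Tay B u₁ (F q)) ∈ Fil ι ℂ N := by
        intro i m hm
        exact congrFun hc (⟨m, hm⟩, i)
      have h2 := lead_unique (fD_lead (fun j => z j - u₁) (eMat V M E φ B) K) h1 (hkers c)
      rw [← hTs] at h2
      have h3 := Tay_eq_zero B ((hsd c).analyticAt u₁) h2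
      apply hindep
      intro u
      exact AnalyticOnNhd.eqOn_zero_of_preconnected_of_eventuallyEq_zero
        (f := fun u => ∑ q, c q • F q u) (U := Set.univ) (fun u _ => (hsd c).analyticAt u)
        isPreconnected_univ (Set.mem_univ u₁) h3 (Set.mem_univ u)
    have hsurj : Function.Surjective L := LinearMap.injective_iff_surjective.mp hinj
    obtain ⟨c, hc⟩ := hsurj (fun q => PowerSeries.coeff (q.1 : ℕ) (Tay B u₁ f q.2))
    refine ⟨c, ?_⟩
    have hkf : fD (fun j => z j - u₁) (eMat V M E φ B) K (Tay B u₁ f) = 0 :=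
      fD_Tay_zero V M E φ z K B hg₁ (hfa u₁ hu₁)
        (Filter.mem_of_superset (hU.mem_nhds hu₁) hDf)
    have h1 : Tay B u₁ f - ∑ q, c q • Tay B u₁ (F q) = 0 := by
      refine lead_unique (fD_lead (fun j => z j - u₁) (eMat V M E φ B) K) (L := N) ?_ ?_
      · intro i m hm
        rw [Pi.sub_apply, map_sub, sub_eq_zero]
        exact (congrFun hc (⟨m, hm⟩, i)).symm
      · rw [map_sub, hkf, hkers, sub_zero]
    rw [← hTs, ← Tay_sub B (hfa u₁ hu₁) ((hsd c).analyticAt u₁)] at h1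
    have h2 := Tay_eq_zero B ((hfa u₁ hu₁).fun_sub ((hsd c).analyticAt u₁)) h1
    exact hfa.eqOn_of_preconnected_of_eventuallyEq (g := fun u => ∑ q, c q • F q u)
      (fun u _ => (hsd c).analyticAt u) hUc.isPreconnected hu₁
      (h2.mono fun u hu => sub_eq_zero.mp hu)

end Main

end GaudinModel

namespace GaudinModel

/-- The kernel of the universal differential operator `D_{K,M}(u,∂)` is
generated by quasi-exponentials: there exist `N·dim M` `M`-valued quasi-exponentials,
linearly independent over `ℂ`, all of whose exponents are eigenvalues of `K` (so for `K = 0`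
they are polynomials), each annihilated by `D_{K,M}(u,∂)` on `ℂ∖{z_1,…,z_n}`, and whose
restrictions span the space of holomorphic solutions of `D_{K,M} f = 0` on every simply
connected open subset of `ℂ∖{z_1,…,z_n}`. -/
theorem statement_0
    {N n : ℕ} (hN : 2 ≤ N) (hn : 1 ≤ n)
    (V : Fin n → Type*) [∀ i, AddCommGroup (V i)] [∀ i, Module ℂ (V i)]
    [∀ i, FiniteDimensional ℂ (V i)]
    (M : Type*) [NormedAddCommGroup M] [NormedSpace ℂ M] [FiniteDimensional ℂ M]
    (Λ : Fin n → Fin N → ℤ)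
    (hdom : ∀ i, ∀ a b : Fin N, a ≤ b → Λ i b ≤ Λ i a)
    (hpoly : ∀ i a, 0 ≤ Λ i a)
    (E : ∀ i : Fin n, Fin N → Fin N → (V i →ₗ[ℂ] V i))
    (hrel : GlRel V E)
    (hhw : IsHW V E Λ)
    (φ : M ≃ₗ[ℂ] PiTensorProduct ℂ V)
    (z : Fin n → ℂ) (hz : Function.Injective z)
    (K : Matrix (Fin N) (Fin N) ℂ) :
    ∃ F : Fin (N * Module.finrank ℂ M) → ℂ → M,
      -- each `F i` is a quasi-exponential all of whose exponents are eigenvalues of `K`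
      (∀ i, ∃ (k d : ℕ) (lam : Fin k → ℂ) (v : Fin k → Fin d → M),
        (∀ t : Fin k, ∃ x : Fin N → ℂ, x ≠ 0 ∧ K.mulVec x = lam t • x) ∧
        ∀ u : ℂ, F i u = ∑ t : Fin k, ∑ j : Fin d,
          (Complex.exp (lam t * u) * u ^ (j : ℕ)) • v t j) ∧
      -- linearly independent over `ℂ`
      LinearIndependent ℂ F ∧
      -- each `F i` is annihilated by `D_{K,M}(u,∂)` away from `z_1, …, z_n`
      (∀ i, ∀ u : ℂ, GoodG z u → Dg V M E φ z K (F i) u = 0) ∧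
      -- the restrictions of the `F i` span the holomorphic solutions on every simply
      -- connected open subset of `ℂ∖{z_1,…,z_n}`
      (∀ U : Set ℂ, IsOpen U → (∀ j, z j ∉ U) → SimplyConnectedSpace U →
        ∀ f : ℂ → M, DifferentiableOn ℂ f U → (∀ u ∈ U, Dg V M E φ z K f u = 0) →
          ∃ c : Fin (N * Module.finrank ℂ M) → ℂ,
            ∀ u ∈ U, f u = ∑ i, c i • F i u) := by
  obtain ⟨F, h1, h2, h3, h4⟩ := main_kappa V M Λ E φ z K (Module.finBasis ℂ M) hdom hpoly hrel hhw
  refine ⟨fun i => F (finProdFinEquiv.symm i), fun i => h1 _,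
    h2.comp _ finProdFinEquiv.symm.injective, fun i => h3 _, ?_⟩
  intro U hU hzU hs f hf hDf
  have hc : IsConnected U := isConnected_iff_connectedSpace.mpr inferInstance
  obtain ⟨c, hcf⟩ := h4 U hU hzU hc f hf hDf
  refine ⟨fun i => c (finProdFinEquiv.symm i), fun u hu => ?_⟩
  rw [hcf u hu]
  exact (Equiv.sum_comp finProdFinEquiv.symm (fun q => c q • F q u)).symm

end GaudinModel
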